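/- Let d ≥ 1 and let α be a cone angle on ℝ^d. For every d-dimensional polytope P ⊂ ℝ^d and every S ⊆ {1,…,d−1}: α̌_S(P) = α̌_{S ∪ {0}}(P), and Σ_{i=0}^{t−1} (−1)^i α̂_{S ∪ {i}}(P) = (−1)^{t+1} α̂_S(P) where t = min(S ∪ {d}). Moreover, the affine hull of { α̌(P) = (α̌_S(P))_{∅ ≠ S ⊆ {0,…,d−1}} : P a d-dimensional polytope } has dimension 2^{d−1} − 1, and likewise the affine hull of the interior flag-angle vectors { α̂(P) : P a d-dimensional polytope } has dimension 2^{d−1} − 1. -/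

import Mathlib

open scoped BigOperators InnerProductSpace Pointwise

noncomputable section

/-- Euclidean space `ℝ^d`. -/
abbrev Euc (d : ℕ) : Type := EuclideanSpace ℝ (Fin d)

namespace GramAngles

variable {d : ℕ}

/-- The conical (positive) hull of a set. -/
def posHull (S : Set (Euc d)) : Set (Euc d) :=
  {u | ∃ c : ℝ, ∃ p ∈ S, 0 ≤ c ∧ u = c • p}

/-- The dimension of a set: the rank of the linear subspace parallel to its affine hull. -/
def sdim (S : Set (Euc d)) : ℕ := Module.finrank ℝ (vectorSpan ℝ S)

/-- A polyhedral cone with apex at the origin: a finitely generated convex cone. -/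
def IsPolyhedralCone (C : Set (Euc d)) : Prop :=
  ∃ (n : ℕ) (v : Fin n → Euc d),
    C = {x | ∃ c : Fin n → ℝ, (∀ i, 0 ≤ c i) ∧ x = ∑ i, c i • v i}

/-- A cone angle on `ℝ^d`: a simple, normalized valuation on polyhedral cones. -/
structure ConeAngle (d : ℕ) where
  toFun : Set (Euc d) → ℝ
  zero' : toFun {0} = 0
  union' : ∀ C C' : Set (Euc d), IsPolyhedralCone C → IsPolyhedralCone C' →
    IsPolyhedralCone (C ∪ C') → IsPolyhedralCone (C ∩ C') →
    toFun (C ∪ C') = toFun C + toFun C' - toFun (C ∩ C')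
  simple' : ∀ C : Set (Euc d), IsPolyhedralCone C → sdim C < d → toFun C = 0
  norm' : toFun Set.univ = 1

/-- A (convex) polytope: the convex hull of a nonempty finite point set. -/
def IsPolytope (P : Set (Euc d)) : Prop :=
  ∃ s : Finset (Euc d), s.Nonempty ∧ P = convexHull ℝ (s : Set (Euc d))

/-- Faces of a polytope are its exposed subsets (including `∅` and `P` itself). -/
def IsFace (P F : Set (Euc d)) : Prop := IsExposed ℝ P F

open Classical in
/-- A chosen point in the relative interior of `F`. -/
def relPt (F : Set (Euc d)) : Euc d :=
  if h : (intrinsicInterior ℝ F).Nonempty then h.some else 0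

/-- The tangent (inner) cone `T_F G = cone(-q + G) + L(G)^⊥`, `q ∈ relint F`. -/
def innerCone (F G : Set (Euc d)) : Set (Euc d) :=
  posHull ((fun x => x - relPt F) '' G) + (((vectorSpan ℝ G)ᗮ : Submodule ℝ (Euc d)) : Set (Euc d))

/-- The normal cone `N_F G` of `G` at a face `F`. -/
def normalCone (F G : Set (Euc d)) : Set (Euc d) :=
  {c | ∀ x ∈ F, ∀ y ∈ G, ⟪c, y⟫_ℝ ≤ ⟪c, x⟫_ℝ}

/-- The outer cone `O_F G = N_F G + L(F)`. -/
def outerCone (F G : Set (Euc d)) : Set (Euc d) :=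
  normalCone F G + ((vectorSpan ℝ F : Submodule ℝ (Euc d)) : Set (Euc d))

/-- Interior angle of `G` at its face `F`, measured by the cone angle `α`. -/
def intAngle (α : ConeAngle d) (F G : Set (Euc d)) : ℝ := α.toFun (innerCone F G)

/-- Exterior angle of `G` at its face `F`, measured by the cone angle `α`. -/
def extAngle (α : ConeAngle d) (F G : Set (Euc d)) : ℝ := α.toFun (outerCone F G)

/-- `α̂_i(P)`: sum of interior angles over all `i`-dimensional (nonempty) faces of `P`. -/
def intAngleSum (α : ConeAngle d) (P : Set (Euc d)) (i : ℕ) : ℝ :=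
  ∑ᶠ F ∈ {F : Set (Euc d) | IsFace P F ∧ F.Nonempty ∧ sdim F = i}, intAngle α F P

/-- `α̌_i(P)`: sum of exterior angles over all `i`-dimensional (nonempty) faces of `P`. -/
def extAngleSum (α : ConeAngle d) (P : Set (Euc d)) (i : ℕ) : ℝ :=
  ∑ᶠ F ∈ {F : Set (Euc d) | IsFace P F ∧ F.Nonempty ∧ sdim F = i}, extAngle α F P

/-- A zonotope: a translate of a Minkowski sum of finitely many segments. -/
def IsZonotope (Z : Set (Euc d)) : Prop :=
  ∃ (t : Euc d) (n : ℕ) (z : Fin n → Euc d),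
    Z = {x | ∃ l : Fin n → ℝ, (∀ i, |l i| ≤ 1) ∧ x = t + ∑ i, l i • z i}

/-- The face of `P` on which the linear functional `⟪c, ·⟫` is maximized. -/
def maxFace (P : Set (Euc d)) (c : Euc d) : Set (Euc d) :=
  {x ∈ P | ∀ y ∈ P, ⟪c, y⟫_ℝ ≤ ⟪c, x⟫_ℝ}

/-- A belt polytope: a polytope whose normal fan is the fan induced by a central
hyperplane arrangement (two functionals maximize the same face iff they have the
same sign pattern with respect to the arrangement). -/
def IsBeltPolytope (P : Set (Euc d)) : Prop :=
  IsPolytope P ∧ ∃ (k : ℕ) (z : Fin k → Euc d), (∀ i, z i ≠ 0) ∧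
    ∀ c c' : Euc d,
      ((∀ i, Real.sign ⟪z i, c⟫_ℝ = Real.sign ⟪z i, c'⟫_ℝ) ↔ maxFace P c = maxFace P c')

/-- The set of flats of a polytope: linear subspaces parallel to nonempty faces,
ordered by inclusion (as a subtype of `Submodule ℝ (Euc d)`). -/
def Flats (P : Set (Euc d)) : Set (Submodule ℝ (Euc d)) :=
  {L | ∃ F : Set (Euc d), IsFace P F ∧ F.Nonempty ∧ L = vectorSpan ℝ F}

/-- Strictly increasing chains from `a` to `c` in a poset, encoded as lists. -/
def chainsFromTo {β : Type*} [Preorder β] (a c : β) : Set (List β) :=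
  {l | l.Chain' (· < ·) ∧ l.head? = some a ∧ l.getLast? = some c}

/-- The Möbius function of a poset, via Philip Hall's chain formula. -/
def mob {β : Type*} [Preorder β] (a c : β) : ℝ :=
  ∑ᶠ l ∈ chainsFromTo a c, (-1 : ℝ) ^ (l.length + 1)

/-- Whitney numbers of the first kind of a ranked poset with minimum `bot`. -/
def whitney1 {β : Type*} [Preorder β] (rk : β → ℕ) (bot : β) (i : ℕ) : ℝ :=
  ∑ᶠ a ∈ {a : β | rk a = i}, mob bot a

/-- Flag-Whitney numbers of the second kind: the number of chains with rank set `S`. -/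
def flagW2 {β : Type*} [Preorder β] (rk : β → ℕ) (S : Finset ℕ) : ℕ :=
  Nat.card {l : List β // l.Chain' (· < ·) ∧ l.map rk = S.sort (· ≤ ·)}

/-- Flag-Whitney numbers of the first kind:
`w_S = Σ μ(0̂,c₁) μ(c₁,c₂) ⋯ μ(c_{k-1},c_k)` over chains with rank set `S`. -/
def flagW1 {β : Type*} [Preorder β] (rk : β → ℕ) (bot : β) (S : Finset ℕ) : ℝ :=
  ∑ᶠ l ∈ {l : List β | l.Chain' (· < ·) ∧ l.map rk = S.sort (· ≤ ·)},
    (List.zipWith mob (bot :: l) l).prod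

/-- Chains of nonempty faces of `P` whose dimensions are exactly the set `S`. -/
def faceChains (P : Set (Euc d)) (S : Finset ℕ) : Set (List (Set (Euc d))) :=
  {l | (∀ F ∈ l, IsFace P F ∧ F.Nonempty) ∧ l.Chain' (· ⊂ ·) ∧ l.map sdim = S.sort (· ≤ ·)}

/-- The interior flag-angle `α̂_S(P) = Σ α̂(F₁,F₂) α̂(F₂,F₃) ⋯ α̂(F_k,P)`. -/
def intFlag (α : ConeAngle d) (P : Set (Euc d)) (S : Finset ℕ) : ℝ :=
  ∑ᶠ l ∈ faceChains P S, (List.zipWith (intAngle α) l (l.drop 1 ++ [P])).prod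

/-- The exterior flag-angle `α̌_S(P) = Σ α̌(F₁,F₂) α̌(F₂,F₃) ⋯ α̌(F_k,P)`. -/
def extFlag (α : ConeAngle d) (P : Set (Euc d)) (S : Finset ℕ) : ℝ :=
  ∑ᶠ l ∈ faceChains P S, (List.zipWith (extAngle α) l (l.drop 1 ++ [P])).prod

/-- Membership in the incidence algebra: vanishing off the order relation. -/
def memIA {β : Type*} [Preorder β] (h : β → β → ℝ) : Prop :=
  ∀ a c, ¬ a ≤ c → h a c = 0

/-- Convolution product of the incidence algebra. -/
def conv {β : Type*} [Preorder β] (g h : β → β → ℝ) (a c : β) : ℝ :=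
  ∑ᶠ (b : β) (_ : a ≤ b ∧ b ≤ c), g a b * h b c

/-- The product `∗_k`, summing over middle elements of rank `k`. -/
def convk {β : Type*} (rk : β → ℕ) (k : ℕ) (g h : β → β → ℝ) (a c : β) : ℝ :=
  ∑ᶠ (b : β) (_ : rk b = k), g a b * h b c

/-- The pushforward `φ_* h (q,q') = |φ⁻¹(q')|⁻¹ Σ_{p ∈ φ⁻¹(q), p' ∈ φ⁻¹(q')} h(p,p')`. -/
def pushf {β γ : Type*} (φ : β → γ) (h : β → β → ℝ) (q q' : γ) : ℝ :=
  (Nat.card {p : β // φ p = q'} : ℝ)⁻¹ *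
    ∑ᶠ (p : β) (_ : φ p = q) (p' : β) (_ : φ p' = q'), h p p'

/-- The subspace `I_φ(𝒫)`: elements whose fiberwise column sums are independent of
the representative of the target fiber. -/
def memIphi {β γ : Type*} [Preorder β] (φ : β → γ) (h : β → β → ℝ) : Prop :=
  memIA h ∧ ∀ (q : γ) (p₁ p₂ : β), φ p₁ = φ p₂ →
    (∑ᶠ (p : β) (_ : φ p = q), h p p₁) = (∑ᶠ (p : β) (_ : φ p = q), h p p₂)

open Classical in
/-- The pullback `φ^* g (p,p') = g(φ p, φ p')` for `p ≤ p'`, else `0`. -/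
def pullb {β γ : Type*} [Preorder β] (φ : β → γ) (g : γ → γ → ℝ) (p p' : β) : ℝ :=
  if p ≤ p' then g (φ p) (φ p') else 0

open Classical in
/-- The identity `δ` of the incidence algebra. -/
def deltaIA {β : Type*} (a c : β) : ℝ := if a = c then 1 else 0

end GramAngles

namespace GramAngles

/-! ### Relatively open convex sets and the Euler characteristic -/

/-- Algebraically relatively open. -/
def AlgOpen {E : Type*} [AddCommGroup E] [Module ℝ E] (C : Set E) : Prop :=
  ∀ x ∈ C, ∀ y ∈ C, ∃ ε : ℝ, 0 < ε ∧ x + ε • (x - y) ∈ C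

/-- Algebraic relative interior. -/
def relin {E : Type*} [AddCommGroup E] [Module ℝ E] (F : Set E) : Set E :=
  {x | x ∈ F ∧ ∀ y ∈ F, ∃ ε : ℝ, 0 < ε ∧ x + ε • (x - y) ∈ F}

open Classical in
/-- indicator value -/
def ind {X : Type*} (C : Set X) (x : X) : ℝ := if x ∈ C then 1 else 0

lemma ind_of_mem {X : Type*} {C : Set X} {x : X} (h : x ∈ C) : ind C x = 1 := by simp [ind, h]
lemma ind_of_not_mem {X : Type*} {C : Set X} {x : X} (h : x ∉ C) : ind C x = 0 := by simp [ind, h]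

open Classical in
/-- Euler characteristic of a 1-dimensional relatively open convex set. -/
def e1 (I : Set ℝ) : ℝ := if I = ∅ then 0 else if I.Subsingleton then 1 else -1

lemma algOpen_real {I : Set ℝ} (ho : AlgOpen I) (hn : ¬ I.Subsingleton) :
    (∀ x ∈ I, ∃ y ∈ I, y < x) ∧ (∀ x ∈ I, ∃ y ∈ I, x < y) := by
  have key : ∀ x ∈ I, ∃ y ∈ I, y ≠ x := by
    intro x hx
    by_contra h
    push Not at h
    exact hn (fun a ha b hb => by rw [h a ha, h b hb])
  constructor
  · intro x hx
    obtain ⟨y, hy, hne⟩ := key x hx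
    rcases lt_or_gt_of_ne hne with h | h
    · exact ⟨y, hy, h⟩
    · obtain ⟨ε, hε, hm⟩ := ho x hx y hy
      refine ⟨_, hm, ?_⟩
      simp only [smul_eq_mul]
      nlinarith
  · intro x hx
    obtain ⟨y, hy, hne⟩ := key x hx
    rcases lt_or_gt_of_ne hne with h | h
    · obtain ⟨ε, hε, hm⟩ := ho x hx y hy
      refine ⟨_, hm, ?_⟩
      simp only [smul_eq_mul]
      nlinarith
    · exact ⟨y, hy, h⟩

lemma chi1 {ι : Type*} (s : Finset ι) (I : ι → Set ℝ) (hc : ∀ i ∈ s, Convex ℝ (I i))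
    (ho : ∀ i ∈ s, AlgOpen (I i)) (l : ι → ℝ)
    (h : ∀ x, ∑ i ∈ s, l i * ind (I i) x = 0) : ∑ i ∈ s, l i * e1 (I i) = 0 := by
  classical
  set X : Finset ℝ := s.image (fun i => sInf (I i)) ∪ s.image (fun i => sSup (I i)) with hX
  have hr : ∀ x : ℝ, ∃ r, x < r ∧ ∀ y ∈ X, ¬ (x < y ∧ y ≤ r) := by
    intro x
    by_cases hne : (X.filter (fun y => x < y)).Nonempty
    · set m := (X.filter (fun y => x < y)).min' hne with hm
      have hmm := Finset.min'_mem _ hne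
      rw [Finset.mem_filter] at hmm
      refine ⟨(x + m) / 2, by linarith [hmm.2], ?_⟩
      rintro y hy ⟨h1, h2⟩
      have := Finset.min'_le (X.filter (fun y => x < y)) y (by simp [hy, h1])
      have h3 : x < m := hmm.2
      have : m ≤ y := this
      linarith
    · refine ⟨x + 1, by linarith, ?_⟩
      rintro y hy ⟨h1, h2⟩
      exact hne ⟨y, by simp [hy, h1]⟩
  choose r hr1 hr2 using hr
  obtain ⟨b, hb⟩ : ∃ b, ∀ y ∈ X, b < y := by
    obtain ⟨b, hb⟩ := X.finite_toSet.bddBelow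
    exact ⟨b - 1, fun y hy => by linarith [hb hy]⟩
  have key : ∀ i ∈ s, ∑ x ∈ X, (ind (I i) x - ind (I i) (r x)) - ind (I i) b = e1 (I i) := by
    intro i hi
    have hinf : sInf (I i) ∈ X := Finset.mem_union_left _ (Finset.mem_image_of_mem _ hi)
    have hsup : sSup (I i) ∈ X := Finset.mem_union_right _ (Finset.mem_image_of_mem _ hi)
    by_cases hem : I i = ∅
    · simp [ind, e1, hem]
    by_cases hss : (I i).Subsingleton
    · obtain ⟨p, hp⟩ := Set.nonempty_iff_ne_empty.mpr hem
      have hIp : I i = {p} := hss.eq_singleton_of_mem hp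
      have hpX : p ∈ X := by simpa [hIp] using hinf
      have h1 : ∀ x ∈ X, ind (I i) (r x) = 0 := by
        intro x hx
        apply ind_of_not_mem
        rw [hIp]
        intro hh
        have hh : r x = p := hh
        exact hr2 x p hpX ⟨by rw [← hh]; exact hr1 x, by rw [hh]⟩
      have h2 : ind (I i) b = 0 := by
        apply ind_of_not_mem
        rw [hIp]
        intro hh
        have hh : b = p := hh
        exact absurd (hb p hpX) (by rw [hh]; exact lt_irrefl _)
      rw [Finset.sum_sub_distrib, Finset.sum_eq_zero h1, h2]
      simp [e1, hss, hem, hIp, ind, hpX]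
    · obtain ⟨hlo, hhi⟩ := algOpen_real (ho i hi) hss
      have hne := Set.nonempty_iff_ne_empty.mpr hem
      have hord : ∀ a ∈ I i, ∀ c ∈ I i, ∀ z, a ≤ z → z ≤ c → z ∈ I i := fun a ha c hcc z h1 h2 =>
        (hc i hi).ordConnected.out ha hcc ⟨h1, h2⟩
      have he : e1 (I i) = -1 := by simp [e1, hem, hss]
      -- anything not above all of X-gap: an element above r x
      have habove : ∀ x, (∃ z ∈ I i, x < z) → ∃ z ∈ I i, r x < z := by
        rintro x ⟨z, hz, hxz⟩
        by_cases hbd : BddAbove (I i)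
        · have h1 : x < sSup (I i) := lt_of_lt_of_le hxz (le_csSup hbd hz)
          have h2 : r x < sSup (I i) := by
            by_contra hcon
            exact hr2 x _ hsup ⟨h1, not_lt.mp hcon⟩
          exact exists_lt_of_lt_csSup hne h2
        · rw [not_bddAbove_iff] at hbd
          exact hbd _
      have h1 : ∀ x ∈ X, x ∈ I i → r x ∈ I i := by
        intro x hx hxI
        obtain ⟨z, hz, hlt⟩ := habove x (hhi x hxI)
        exact hord x hxI z hz _ (hr1 x).le hlt.le
      have hba : ∃ z ∈ I i, b < z := by
        by_cases hbd : BddAbove (I i)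
        · exact exists_lt_of_lt_csSup hne (hb _ hsup)
        · rw [not_bddAbove_iff] at hbd
          exact hbd _
      have h2 : ∀ x ∈ X, x ∉ I i → r x ∈ I i → BddBelow (I i) ∧ x = sInf (I i) := by
        intro x hx hxI hrI
        have hlb : ∀ y ∈ I i, x ≤ y := by
          intro y hy
          by_contra hcon
          exact hxI (hord y hy _ hrI x (not_le.mp hcon).le (hr1 x).le)
        refine ⟨⟨x, hlb⟩, ?_⟩
        by_contra hcon
        have h3 : x ≤ sInf (I i) := le_csInf hne hlb
        have h4 : sInf (I i) ≤ r x := csInf_le ⟨x, hlb⟩ hrI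
        exact hr2 x _ hinf ⟨lt_of_le_of_ne h3 hcon, h4⟩
      rw [he]
      by_cases hbd : BddBelow (I i)
      · have ha : sInf (I i) ∉ I i := by
          intro hh
          obtain ⟨y, hy, hlt⟩ := hlo _ hh
          exact absurd (csInf_le hbd hy) (not_le.mpr hlt)
        have hra : r (sInf (I i)) ∈ I i := by
          obtain ⟨z, hz⟩ := hne
          have hz1 : sInf (I i) < z := lt_of_le_of_ne (csInf_le hbd hz) (fun hh => ha (hh ▸ hz))
          obtain ⟨z', hz', hlt'⟩ := habove _ ⟨z, hz, hz1⟩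
          obtain ⟨y, hy, hlt⟩ := exists_lt_of_csInf_lt ⟨z, hz⟩ (hr1 (sInf (I i)))
          exact hord y hy z' hz' _ hlt.le hlt'.le
        have hbI : b ∉ I i := fun hh => absurd (csInf_le hbd hh) (not_le.mpr (hb _ hinf))
        rw [Finset.sum_eq_single_of_mem _ hinf]
        · rw [ind_of_not_mem ha, ind_of_mem hra, ind_of_not_mem hbI]; norm_num
        · intro x hx hxne
          by_cases hxI : x ∈ I i
          · rw [ind_of_mem hxI, ind_of_mem (h1 x hx hxI)]; norm_num
          · have : r x ∉ I i := fun hh => hxne (h2 x hx hxI hh).2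
            rw [ind_of_not_mem hxI, ind_of_not_mem this]; norm_num
      · have hbI : b ∈ I i := by
          obtain ⟨z, hz, hlt⟩ := hba
          have hbd' := hbd
          rw [not_bddBelow_iff] at hbd'
          obtain ⟨y, hy, hyb⟩ := hbd' b
          exact hord y hy z hz _ hyb.le hlt.le
        rw [Finset.sum_eq_zero, ind_of_mem hbI]; · norm_num
        intro x hx
        by_cases hxI : x ∈ I i
        · rw [ind_of_mem hxI, ind_of_mem (h1 x hx hxI)]; norm_num
        · have : r x ∉ I i := fun hh => hbd (h2 x hx hxI hh).1
          rw [ind_of_not_mem hxI, ind_of_not_mem this]; norm_num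
  calc ∑ i ∈ s, l i * e1 (I i)
      = ∑ i ∈ s, l i * (∑ x ∈ X, (ind (I i) x - ind (I i) (r x)) - ind (I i) b) :=
        Finset.sum_congr rfl (fun i hi => by rw [key i hi])
    _ = ∑ x ∈ X, (∑ i ∈ s, l i * ind (I i) x - ∑ i ∈ s, l i * ind (I i) (r x))
          - ∑ i ∈ s, l i * ind (I i) b := by
        simp only [mul_sub, Finset.sum_sub_distrib, Finset.mul_sum]
        rw [Finset.sum_comm]
        congr 2
        rw [Finset.sum_comm]
    _ = 0 := by simp [h]

section
variable {E : Type*} [AddCommGroup E] [Module ℝ E]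

lemma relin_dir {F : Set E} (hF : Convex ℝ F) {q : E} (hq : q ∈ relin F) {l : E}
    (hl : l ∈ vectorSpan ℝ F) : ∃ δ : ℝ, 0 < δ ∧ q + δ • l ∈ F := by
  have hqF := hq.1
  have hneg : ∀ l : E, (∃ δ : ℝ, 0 < δ ∧ q + δ • l ∈ F) → ∃ δ : ℝ, 0 < δ ∧ q + δ • (-l) ∈ F := by
    rintro l ⟨δ, hδ, hm⟩
    obtain ⟨ε, hε, hm'⟩ := hq.2 _ hm
    refine ⟨ε * δ, by positivity, ?_⟩
    convert hm' using 1
    module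
  have hpos : ∀ (c : ℝ), 0 < c → ∀ l : E, (∃ δ : ℝ, 0 < δ ∧ q + δ • l ∈ F) →
      ∃ δ : ℝ, 0 < δ ∧ q + δ • (c • l) ∈ F := by
    rintro c hc l ⟨δ, hδ, hm⟩
    refine ⟨δ / c, by positivity, ?_⟩
    rw [smul_smul, div_mul_cancel₀ _ hc.ne']
    exact hm
  rw [vectorSpan_eq_span_vsub_set_right ℝ hqF] at hl
  induction hl using Submodule.span_induction with
  | mem x hx =>
    obtain ⟨y, hy, rfl⟩ := hx
    exact ⟨1, one_pos, by simpa using hy⟩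
  | zero => exact ⟨1, one_pos, by simpa using hqF⟩
  | add x y _ _ hx hy =>
    obtain ⟨a, ha, hax⟩ := hx
    obtain ⟨b, hb, hby⟩ := hy
    refine ⟨a * b / (a + b), by positivity, ?_⟩
    have hab : a + b ≠ 0 := by positivity
    have := hF hax hby (a := b / (a + b)) (b := a / (a + b)) (by positivity) (by positivity)
      (by field_simp; ring)
    convert this using 1
    have h1 : q = (b / (a + b) + a / (a + b)) • q := by
      rw [← add_div, add_comm b a, div_self hab, one_smul]
    nth_rewrite 1 [h1]
    module
  | smul c x _ hx =>
    rcases lt_trichotomy c 0 with hc | hc | hc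
    · have := hneg _ (hpos (-c) (by linarith) x hx)
      simpa using this
    · exact ⟨1, one_pos, by simpa [hc] using hqF⟩
    · exact hpos c hc x hx

lemma relin_eq_of_algOpen {C : Set E} (h : AlgOpen C) : relin C = C := by
  ext x
  exact ⟨fun hx => hx.1, fun hx => ⟨hx, h x hx⟩⟩

lemma relin_subset (F : Set E) : relin F ⊆ F := fun _ h => h.1

lemma relin_comb {F : Set E} (hF : Convex ℝ F) {q y : E} (hq : q ∈ relin F) (hy : y ∈ F)
    {t : ℝ} (ht : 0 < t) (ht1 : t ≤ 1) : t • q + (1 - t) • y ∈ relin F := by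
  refine ⟨hF hq.1 hy ht.le (by linarith) (by ring), ?_⟩
  intro z hz
  -- find `g ∈ F` with `q + δ (q - z) ∈ F`
  obtain ⟨δ, hδ, hm⟩ := hq.2 z hz
  -- p = t q + (1-t) y;  p + ε (p - z) = combination of q + δ(q-z), y, ...
  -- p + ε (p - z) = (t + ε t) q + (1-t)(1+ε) y - ε z
  refine ⟨t * δ / (1 + δ - t * δ), by
    apply div_pos (by positivity); nlinarith, ?_⟩
  have hD : 0 < 1 + δ - t * δ := by nlinarith
  set ε := t * δ / (1 + δ - t * δ) with hε
  have hεpos : 0 < ε := div_pos (by positivity) hD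
  have hεD : ε * (1 + δ - t * δ) = t * δ := by rw [hε]; field_simp
  -- weights : a on q + δ(q - z), b on y with a δ = ε, a(1+δ) = t(1+ε), b = (1-t)(1+ε)
  have ha : (ε / δ) * δ = ε := by field_simp
  have ha2 : (ε / δ) * (1 + δ) = t * (1 + ε) := by
    field_simp
    nlinarith
  have := hF hm hy (a := ε / δ) (b := (1 - t) * (1 + ε)) (by positivity)
    (mul_nonneg (by linarith) (by linarith)) (by nlinarith)
  convert this using 1
  have e1 : (ε / δ) • (q + δ • (q - z)) = ((ε / δ) * (1 + δ)) • q - ((ε / δ) * δ) • z := by module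
  rw [e1, ha, ha2]
  module

lemma relin_convex {F : Set E} (hF : Convex ℝ F) : Convex ℝ (relin F) := by
  intro x hx y hy a b ha hb hab
  rcases eq_or_lt_of_le ha with h | h
  · have : b = 1 := by linarith
    subst this; simpa [← h] using hy
  · have hb' : b = 1 - a := by linarith
    rw [hb']
    exact relin_comb hF hx hy.1 h (by linarith)

lemma relin_algOpen {F : Set E} (hF : Convex ℝ F) : AlgOpen (relin F) := by
  intro x hx y hy
  obtain ⟨ε, hε, hm⟩ := hx.2 y hy.1
  refine ⟨ε / 2, by positivity, ?_⟩
  have := relin_comb hF hx hm (t := 1/2) (by norm_num) (by norm_num)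
  convert this using 1
  module

lemma vectorSpan_relin {F : Set E} (hF : Convex ℝ F) (hne : (relin F).Nonempty) :
    vectorSpan ℝ (relin F) = vectorSpan ℝ F := by
  apply le_antisymm (vectorSpan_mono ℝ (relin_subset F))
  obtain ⟨q, hq⟩ := hne
  rw [vectorSpan_eq_span_vsub_set_right ℝ hq.1, Submodule.span_le]
  rintro _ ⟨y, hy, rfl⟩
  have h := relin_comb hF hq hy (t := 1/2) (by norm_num) (by norm_num)
  have h2 := vsub_mem_vectorSpan ℝ h hq
  have h3 := Submodule.smul_mem _ (2:ℝ) h2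
  have h4 : y - q = (2:ℝ) • (((1/2:ℝ) • q + (1 - 1/2 : ℝ) • y) - q) := by module
  show y - q ∈ _
  rw [h4]
  exact h3

lemma algOpen_image {E' : Type*} [AddCommGroup E'] [Module ℝ E'] {C : Set E} (h : AlgOpen C)
    (f : E →ₗ[ℝ] E') : AlgOpen (f '' C) := by
  rintro _ ⟨x, hx, rfl⟩ _ ⟨y, hy, rfl⟩
  obtain ⟨ε, hε, hm⟩ := h x hx y hy
  exact ⟨ε, hε, _, hm, by simp⟩

lemma vectorSpan_image_lin {E' : Type*} [AddCommGroup E'] [Module ℝ E'] (C : Set E)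
    (f : E →ₗ[ℝ] E') : vectorSpan ℝ (f '' C) = (vectorSpan ℝ C).map f := by
  have := AffineMap.map_vectorSpan (k := ℝ) (f := f.toAffineMap) (s := C)
  simpa using this.symm

end

lemma finrank_map_of_mem {E E' : Type*} [AddCommGroup E] [Module ℝ E] [FiniteDimensional ℝ E]
    [AddCommGroup E'] [Module ℝ E'] (f : E →ₗ[ℝ] E') (L : Submodule ℝ E) :
    Module.finrank ℝ (L.map f) + Module.finrank ℝ (LinearMap.ker f ⊓ L : Submodule ℝ E)
      = Module.finrank ℝ L := by
  have h := LinearMap.finrank_range_add_finrank_ker (f.domRestrict L)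
  rw [LinearMap.range_domRestrict] at h
  rw [← h]
  congr 1
  rw [LinearMap.ker_domRestrict]
  have := Submodule.finrank_map_subtype_eq L ((LinearMap.ker f).comap L.subtype)
  rw [← this, Submodule.map_comap_subtype, inf_comm]

theorem chi_lemma (n : ℕ) : ∀ (E : Type) [AddCommGroup E] [Module ℝ E] [FiniteDimensional ℝ E]
    (_ : Module.finrank ℝ E = n) {ι : Type} (s : Finset ι) (C : ι → Set E)
    (_ : ∀ i ∈ s, Convex ℝ (C i)) (_ : ∀ i ∈ s, AlgOpen (C i)) (_ : ∀ i ∈ s, (C i).Nonempty)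
    (l : ι → ℝ) (_ : ∀ x, ∑ i ∈ s, l i * ind (C i) x = 0),
    ∑ i ∈ s, l i * (-1) ^ (Module.finrank ℝ (vectorSpan ℝ (C i))) = 0 := by
  induction n with
  | zero =>
    intro E _ _ _ hE ι s C hc ho hne l h
    have hsub : Subsingleton E := Module.finrank_zero_iff.mp hE
    rw [← h 0]
    apply Finset.sum_congr rfl
    intro i hi
    obtain ⟨x, hx⟩ := hne i hi
    have : (0 : E) ∈ C i := by rwa [Subsingleton.elim 0 x]
    rw [ind_of_mem this]
    have : Module.finrank ℝ (vectorSpan ℝ (C i)) = 0 := by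
      have := Submodule.finrank_le (vectorSpan ℝ (C i))
      omega
    rw [this]; norm_num
  | succ n ih =>
    intro E _ _ _ hE ι s C hc ho hne l h
    have hnt : Nontrivial E := Module.nontrivial_of_finrank_pos (R := ℝ) (by omega)
    obtain ⟨u, hu⟩ := exists_ne (0 : E)
    let π : E →ₗ[ℝ] (E ⧸ (ℝ ∙ u)) := (ℝ ∙ u).mkQ
    have hker : LinearMap.ker π = ℝ ∙ u := Submodule.ker_mkQ _
    have hfr : Module.finrank ℝ (E ⧸ (ℝ ∙ u)) = n := by
      have h1 := Submodule.finrank_quotient_add_finrank (ℝ ∙ u)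
      rw [finrank_span_singleton hu] at h1
      omega
    classical
    let sg : ι → ℝ := fun i => if u ∈ vectorSpan ℝ (C i) then -1 else 1
    have hsg : ∀ i ∈ s, (-1 : ℝ) ^ (Module.finrank ℝ (vectorSpan ℝ (C i))) =
        sg i * (-1) ^ (Module.finrank ℝ (vectorSpan ℝ (π '' C i))) := by
      intro i hi
      have h1 := finrank_map_of_mem π (vectorSpan ℝ (C i))
      rw [vectorSpan_image_lin, ← h1, hker]
      by_cases hm : u ∈ vectorSpan ℝ (C i)
      · have : (ℝ ∙ u) ⊓ vectorSpan ℝ (C i) = ℝ ∙ u := by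
          rw [inf_eq_left, Submodule.span_singleton_le_iff_mem]; exact hm
        rw [this, finrank_span_singleton hu]
        simp only [sg, hm, if_true]
        ring
      · have : (ℝ ∙ u) ⊓ vectorSpan ℝ (C i) = ⊥ := by
          rw [← disjoint_iff, disjoint_comm, Submodule.disjoint_span_singleton' hu]; exact hm
        rw [this, finrank_bot]
        simp [sg, hm]
    have hmain := ih (E ⧸ (ℝ ∙ u)) hfr s (fun i => π '' C i)
      (fun i hi => (hc i hi).linear_image π) (fun i hi => algOpen_image (ho i hi) π)
      (fun i hi => (hne i hi).image π) (fun i => l i * sg i) ?_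
    · rw [← hmain]
      apply Finset.sum_congr rfl
      intro i hi
      rw [hsg i hi]; ring
    · intro y
      obtain ⟨x0, rfl⟩ := Submodule.mkQ_surjective _ y
      let I : ι → Set ℝ := fun i => {t | x0 + t • u ∈ C i}
      have hfib : ∀ x : E, π x = π x0 ↔ ∃ t : ℝ, x = x0 + t • u := by
        intro x
        rw [← sub_eq_zero, ← map_sub, ← LinearMap.mem_ker, hker, Submodule.mem_span_singleton]
        constructor
        · rintro ⟨t, ht⟩; exact ⟨t, by rw [ht]; abel⟩
        · rintro ⟨t, rfl⟩; exact ⟨t, by abel⟩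
      have hIc : ∀ i ∈ s, Convex ℝ (I i) := by
        intro i hi a ha b hb p q hp hq hpq
        have := hc i hi ha hb hp hq hpq
        show x0 + (p • a + q • b) • u ∈ C i
        convert this using 1
        have : x0 = (p + q) • x0 := by rw [hpq, one_smul]
        nth_rewrite 1 [this]
        simp only [smul_eq_mul]
        module
      have hIo : ∀ i ∈ s, AlgOpen (I i) := by
        intro i hi a ha b hb
        obtain ⟨ε, hε, hm⟩ := ho i hi _ ha _ hb
        refine ⟨ε, hε, ?_⟩
        show x0 + (a + ε • (a - b)) • u ∈ C i
        convert hm using 1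
        simp only [smul_eq_mul]
        module
      have h1 := chi1 s I hIc hIo l (fun t => by
        rw [← h (x0 + t • u)]
        rfl)
      rw [← h1]
      apply Finset.sum_congr rfl
      intro i hi
      rw [mul_assoc]
      congr 1
      by_cases hy : π x0 ∈ π '' C i
      · have : ind (π '' C i) ((ℝ ∙ u).mkQ x0) = 1 := ind_of_mem hy
        rw [this, mul_one]
        obtain ⟨x, hx, hxy⟩ := hy
        obtain ⟨t, rfl⟩ := (hfib x).mp hxy
        have htI : t ∈ I i := hx
        have hIne : I i ≠ ∅ := Set.Nonempty.ne_empty ⟨t, htI⟩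
        by_cases hm : u ∈ vectorSpan ℝ (C i)
        · have : ¬ (I i).Subsingleton := by
            intro hss
            have hq : x0 + t • u ∈ relin (C i) := by rwa [relin_eq_of_algOpen (ho i hi)]
            obtain ⟨δ, hδ, hmem⟩ := relin_dir (hc i hi) hq hm
            have h2 : t + δ ∈ I i := by
              show x0 + (t + δ) • u ∈ C i
              convert hmem using 1
              module
            have := hss htI h2
            linarith
          simp [sg, hm, e1, hIne, this]
        · have : (I i).Subsingleton := by
            intro a ha b hb
            by_contra hab
            apply hm
            have ha' : x0 + a • u ∈ C i := ha
            have hb' : x0 + b • u ∈ C i := hb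
            have h3 : (x0 + a • u) - (x0 + b • u) ∈ vectorSpan ℝ (C i) :=
              vsub_mem_vectorSpan ℝ ha' hb'
            have h4 := Submodule.smul_mem _ (a - b)⁻¹ h3
            have : x0 + a • u - (x0 + b • u) = (a - b) • u := by module
            rwa [this, smul_smul, inv_mul_cancel₀ (sub_ne_zero.mpr hab), one_smul] at h4
          simp [sg, hm, e1, hIne, this]
      · have : ind (π '' C i) ((ℝ ∙ u).mkQ x0) = 0 := ind_of_not_mem hy
        rw [this, mul_zero]
        have : I i = ∅ := by
          rw [Set.eq_empty_iff_forall_notMem]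
          intro t ht
          exact hy ⟨_, ht, (hfib _).mpr ⟨t, rfl⟩⟩
        simp [e1, this]

end GramAngles

namespace GramAngles

/-! ### Polyhedral cones: Minkowski-Weyl -/
section cones
variable {d : ℕ}

/-- cone cut out by half-spaces -/
def hcone (N : Finset (Euc d)) : Set (Euc d) := {x | ∀ a ∈ N, 0 ≤ ⟪a, x⟫_ℝ}

/-- cone generated by a finite set -/
def vcone (N : Finset (Euc d)) : Set (Euc d) :=
  {x | ∃ c : Euc d → ℝ, (∀ v, 0 ≤ c v) ∧ x = ∑ v ∈ N, c v • v}

/-- `C` is a finite intersection of half-spaces -/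
def IsH (C : Set (Euc d)) : Prop := ∃ N : Finset (Euc d), C = hcone N

lemma isH_zero : IsH ({0} : Set (Euc d)) := by
  classical
  let b := EuclideanSpace.basisFun (Fin d) ℝ
  refine ⟨Finset.univ.image (fun i => b i) ∪ Finset.univ.image (fun i => - b i), ?_⟩
  ext x
  simp only [Set.mem_singleton_iff, hcone, Set.mem_setOf_eq, Finset.mem_union, Finset.mem_image,
    Finset.mem_univ, true_and]
  constructor
  · rintro rfl; simp
  · intro h
    apply b.repr.injective
    ext i
    rw [b.repr_apply_apply, b.repr_apply_apply]
    have h1 := h (b i) (Or.inl ⟨i, rfl⟩)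
    have h2 := h (- b i) (Or.inr ⟨i, rfl⟩)
    rw [inner_neg_left] at h2
    rw [inner_zero_right]
    linarith

lemma isH_add_ray {K : Set (Euc d)} (hK : IsH K) (v : Euc d) :
    IsH {x | ∃ l : ℝ, 0 ≤ l ∧ x - l • v ∈ K} := by
  classical
  obtain ⟨N, rfl⟩ := hK
  let Np := N.filter (fun a => 0 ≤ ⟪a, v⟫_ℝ)
  let M : Finset (Euc d) := Np ∪ (N ×ˢ N).image
    (fun p => if 0 < ⟪p.1, v⟫_ℝ ∧ ⟪p.2, v⟫_ℝ < 0 then ⟪p.1, v⟫_ℝ • p.2 - ⟪p.2, v⟫_ℝ • p.1 else 0)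
  refine ⟨M, ?_⟩
  ext x
  simp only [hcone, Set.mem_setOf_eq]
  constructor
  · rintro ⟨l, hl, h⟩ a ha
    rcases Finset.mem_union.mp ha with h1 | h1
    · obtain ⟨h2, h3⟩ := Finset.mem_filter.mp h1
      have := h a h2
      rw [inner_sub_right, inner_smul_right] at this
      nlinarith
    · obtain ⟨⟨p, q⟩, h2, rfl⟩ := Finset.mem_image.mp h1
      rw [Finset.mem_product] at h2
      simp only
      split_ifs with h3
      · have hp := h p h2.1
        have hq := h q h2.2
        rw [inner_sub_right, inner_smul_right] at hp hq
        rw [inner_sub_left, real_inner_smul_left, real_inner_smul_left]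
        nlinarith [h3.1, h3.2]
      · simp
  · intro h
    -- lower bounds
    let B : Finset ℝ := insert 0 ((N.filter (fun a => ⟪a, v⟫_ℝ < 0)).image (fun a => ⟪a, x⟫_ℝ / ⟪a, v⟫_ℝ))
    have hB : B.Nonempty := Finset.insert_nonempty _ _
    refine ⟨B.max' hB, Finset.le_max' _ _ (Finset.mem_insert_self _ _), ?_⟩
    intro a ha
    rw [inner_sub_right, inner_smul_right]
    rcases lt_trichotomy (⟪a, v⟫_ℝ) 0 with hv | hv | hv
    · have : ⟪a, x⟫_ℝ / ⟪a, v⟫_ℝ ≤ B.max' hB := by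
        apply Finset.le_max'
        apply Finset.mem_insert_of_mem
        exact Finset.mem_image.mpr ⟨a, Finset.mem_filter.mpr ⟨ha, hv⟩, rfl⟩
      rw [div_le_iff_of_neg hv] at this
      linarith
    · rw [hv, mul_zero, sub_zero]
      exact h a (Finset.mem_union_left _ (Finset.mem_filter.mpr ⟨ha, hv.ge⟩))
    · have hup : B.max' hB ≤ ⟪a, x⟫_ℝ / ⟪a, v⟫_ℝ := by
        apply Finset.max'_le
        intro y hy
        rcases Finset.mem_insert.mp hy with rfl | hy
        · have := h a (Finset.mem_union_left _ (Finset.mem_filter.mpr ⟨ha, hv.le⟩))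
          positivity
        · obtain ⟨q, hq, rfl⟩ := Finset.mem_image.mp hy
          obtain ⟨hqN, hqv⟩ := Finset.mem_filter.mp hq
          have := h _ (Finset.mem_union_right _ (Finset.mem_image.mpr ⟨(a, q), by simp [ha, hqN], rfl⟩))
          simp only [hv, hqv, and_self, if_true, inner_sub_left, real_inner_smul_left] at this
          rw [div_le_iff_of_neg hqv, div_mul_eq_mul_div, div_le_iff₀ hv]
          linarith
      rw [le_div_iff₀ hv] at hup
      linarith

lemma vcone_isH (N : Finset (Euc d)) : IsH (vcone N) := by
  classical
  induction N using Finset.induction_on with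
  | empty =>
    convert isH_zero (d := d) using 1
    ext x
    simp only [vcone, Finset.sum_empty, Set.mem_setOf_eq, Set.mem_singleton_iff]
    exact ⟨fun ⟨_, _, h⟩ => h, fun h => ⟨0, fun _ => le_rfl, h⟩⟩
  | insert v N hv ih =>
    convert isH_add_ray ih v using 1
    ext x
    simp only [vcone, Set.mem_setOf_eq]
    constructor
    · rintro ⟨c, hc, rfl⟩
      refine ⟨c v, hc v, c, hc, ?_⟩
      rw [Finset.sum_insert hv]; abel
    · rintro ⟨l, hl, c, hc, h⟩
      refine ⟨Function.update c v l, ?_, ?_⟩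
      · intro w
        by_cases hw : w = v
        · subst hw; simpa using hl
        · simpa [hw] using hc w
      · rw [Finset.sum_insert hv, Function.update_self]
        rw [Finset.sum_congr rfl (fun w hw => by
          rw [Function.update_of_ne (ne_of_mem_of_not_mem hw hv)]), ← h]
        abel

lemma mem_vcone_self {N : Finset (Euc d)} {v : Euc d} (hv : v ∈ N) : v ∈ vcone N := by
  classical
  exact ⟨fun w => if w = v then 1 else 0, fun w => by dsimp only; split_ifs <;> norm_num, by simp [hv]⟩

lemma vcone_dual (N : Finset (Euc d)) (a : Euc d) :
    (∀ x ∈ vcone N, 0 ≤ ⟪a, x⟫_ℝ) ↔ ∀ v ∈ N, 0 ≤ ⟪a, v⟫_ℝ := by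
  constructor
  · intro h v hv; exact h v (mem_vcone_self hv)
  · rintro h x ⟨c, hc, rfl⟩
    rw [inner_sum]
    apply Finset.sum_nonneg
    intro v hv
    rw [inner_smul_right]
    exact mul_nonneg (hc v) (h v hv)

/-- Farkas -/
lemma mem_vcone_iff (N : Finset (Euc d)) (x : Euc d) :
    x ∈ vcone N ↔ ∀ a, (∀ v ∈ N, 0 ≤ ⟪a, v⟫_ℝ) → 0 ≤ ⟪a, x⟫_ℝ := by
  constructor
  · intro hx a ha; exact (vcone_dual N a).mpr ha x hx
  · intro h
    obtain ⟨M, hM⟩ := vcone_isH N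
    rw [hM]
    intro a ha
    apply h
    intro v hv
    have := mem_vcone_self hv
    rw [hM] at this
    exact this a ha

lemma hcone_eq_vcone (N : Finset (Euc d)) : ∃ M : Finset (Euc d), hcone N = vcone M := by
  obtain ⟨M, hM⟩ := vcone_isH N
  refine ⟨M, ?_⟩
  ext x
  rw [mem_vcone_iff]
  constructor
  · intro hx a ha
    have ha' : a ∈ vcone N := by
      rw [hM]; intro m hm
      rw [real_inner_comm]; exact ha m hm
    rw [real_inner_comm]
    exact (vcone_dual N x).mpr (fun v hv => by rw [real_inner_comm]; exact hx v hv) a ha'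
  · intro h a ha
    apply h
    have := mem_vcone_self ha
    rw [hM] at this
    intro m hm
    rw [real_inner_comm]
    exact this m hm

lemma vcone_poly (N : Finset (Euc d)) : IsPolyhedralCone (vcone N) := by
  refine ⟨N.card, fun i => (N.equivFin.symm i : Euc d), ?_⟩
  ext x
  simp only [vcone, Set.mem_setOf_eq]
  have hs : ∀ f : Euc d → Euc d, ∑ v ∈ N, f v = ∑ i, f (N.equivFin.symm i : Euc d) := by
    intro f
    rw [← Finset.sum_coe_sort N, ← Equiv.sum_comp N.equivFin.symm]
  classical
  constructor
  · rintro ⟨c, hc, rfl⟩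
    exact ⟨fun i => c (N.equivFin.symm i : Euc d), fun i => hc _, hs _⟩
  · rintro ⟨c, hc, rfl⟩
    refine ⟨fun v => if h : v ∈ N then c (N.equivFin ⟨v, h⟩) else 0, ?_, ?_⟩
    · intro v
      dsimp only
      split_ifs with h
      · exact hc _
      · exact le_rfl
    · rw [hs]
      apply Finset.sum_congr rfl
      intro i _
      simp

lemma IsH.poly {C : Set (Euc d)} (h : IsH C) : IsPolyhedralCone C := by
  obtain ⟨N, rfl⟩ := h
  obtain ⟨M, hM⟩ := hcone_eq_vcone N
  rw [hM]; exact vcone_poly M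

lemma IsH.inter {C C' : Set (Euc d)} (h : IsH C) (h' : IsH C') : IsH (C ∩ C') := by
  classical
  obtain ⟨N, rfl⟩ := h
  obtain ⟨N', rfl⟩ := h'
  refine ⟨N ∪ N', ?_⟩
  ext x
  simp only [hcone, Set.mem_inter_iff, Set.mem_setOf_eq, Finset.mem_union]
  constructor
  · rintro ⟨h1, h2⟩ a (h | h)
    exacts [h1 a h, h2 a h]
  · intro h
    exact ⟨fun a ha => h a (Or.inl ha), fun a ha => h a (Or.inr ha)⟩

lemma isH_half (a : Euc d) : IsH {x | 0 ≤ ⟪a, x⟫_ℝ} := ⟨{a}, by ext x; simp [hcone]⟩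
lemma isH_half' (a : Euc d) : IsH {x | ⟪a, x⟫_ℝ ≤ 0} := ⟨{-a}, by ext x; simp [hcone]⟩
lemma isH_univ : IsH (Set.univ : Set (Euc d)) := ⟨∅, by ext x; simp [hcone]⟩

/-- Minkowski sum of `IsH` cones is `IsH`. -/
lemma IsH.add {C C' : Set (Euc d)} (h : IsH C) (h' : IsH C') : IsH (C + C') := by
  classical
  obtain ⟨N, rfl⟩ := h'
  obtain ⟨M, hM⟩ := hcone_eq_vcone N
  rw [hM]
  clear hM
  induction M using Finset.induction_on with
  | empty =>
    convert h using 1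
    have : vcone (∅ : Finset (Euc d)) = 0 := by
      ext x; simp only [vcone, Finset.sum_empty, Set.mem_setOf_eq, Set.mem_zero]
      exact ⟨fun ⟨_, _, h⟩ => h, fun h => ⟨0, fun _ => le_rfl, h⟩⟩
    rw [this, add_zero]
  | insert v M hv ih =>
    convert isH_add_ray ih v using 1
    ext x
    simp only [Set.mem_add, Set.mem_setOf_eq]
    constructor
    · rintro ⟨y, hy, z, ⟨c, hc, rfl⟩, rfl⟩
      refine ⟨c v, hc v, y, hy, _, ⟨c, hc, rfl⟩, ?_⟩
      rw [Finset.sum_insert hv]; abel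
    · rintro ⟨l, hl, y, hy, z, ⟨c, hc, rfl⟩, h⟩
      refine ⟨y, hy, l • v + ∑ w ∈ M, c w • w, ⟨Function.update c v l, ?_, ?_⟩, ?_⟩
      · intro w
        by_cases hw : w = v
        · subst hw; simpa using hl
        · simpa [hw] using hc w
      · rw [Finset.sum_insert hv, Function.update_self]
        congr 1
        exact Finset.sum_congr rfl (fun w hw => by
          rw [Function.update_of_ne (ne_of_mem_of_not_mem hw hv)])
      · rw [eq_sub_iff_add_eq] at h
        rw [← h]; abel

lemma isH_submodule (L : Submodule ℝ (Euc d)) : IsH (L : Set (Euc d)) := by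
  classical
  let b := stdOrthonormalBasis ℝ Lᗮ
  refine ⟨Finset.univ.image (fun i => (b i : Euc d)) ∪ Finset.univ.image (fun i => - (b i : Euc d)), ?_⟩
  ext x
  simp only [hcone, Set.mem_setOf_eq, Finset.mem_union, Finset.mem_image,
    Finset.mem_univ, true_and, SetLike.mem_coe]
  constructor
  · intro hx a ha
    have : ∀ i, ⟪(b i : Euc d), x⟫_ℝ = 0 := fun i =>
      (Submodule.mem_orthogonal' _ _).mp (b i).2 x hx
    rcases ha with ⟨i, rfl⟩ | ⟨i, rfl⟩
    · rw [this]
    · rw [inner_neg_left, this, neg_zero]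
  · intro h
    rw [← Submodule.orthogonal_orthogonal L, Submodule.mem_orthogonal]
    have h0 : ∀ i, ⟪(b i : Euc d), x⟫_ℝ = 0 := by
      intro i
      have h1 := h _ (Or.inl ⟨i, rfl⟩)
      have h2 := h _ (Or.inr ⟨i, rfl⟩)
      rw [inner_neg_left] at h2
      linarith
    intro u hu
    have hsum := b.sum_repr ⟨u, hu⟩
    have : u = ∑ i, (b.repr ⟨u, hu⟩ i) • (b i : Euc d) := by
      have := congrArg (Submodule.subtype _) hsum
      simpa using this.symm
    rw [this, sum_inner]
    apply Finset.sum_eq_zero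
    intro i _
    rw [real_inner_smul_left, h0, mul_zero]

lemma sdim_lt_of_subset_hyper {C : Set (Euc d)} {a : Euc d} (ha : a ≠ 0)
    (h : ∀ x ∈ C, ⟪a, x⟫_ℝ = 0) : sdim C < d := by
  have hle : vectorSpan ℝ C ≤ (ℝ ∙ a)ᗮ := by
    rw [vectorSpan_def, Submodule.span_le]
    rintro _ ⟨x, hx, y, hy, rfl⟩
    show x - y ∈ (ℝ ∙ a)ᗮ
    rw [Submodule.mem_orthogonal_singleton_iff_inner_right, inner_sub_right, h x hx, h y hy, sub_zero]
  have h1 := Submodule.finrank_mono hle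
  have h2 := Submodule.finrank_add_finrank_orthogonal (ℝ ∙ a)
  rw [finrank_span_singleton ha, finrank_euclideanSpace_fin] at h2
  unfold sdim
  omega

lemma alpha_cut (α : ConeAngle d) {C : Set (Euc d)} (hC : IsH C) {a : Euc d} (ha : a ≠ 0) :
    α.toFun C = α.toFun (C ∩ {x | 0 ≤ ⟪a, x⟫_ℝ}) + α.toFun (C ∩ {x | ⟪a, x⟫_ℝ ≤ 0}) := by
  have h1 := hC.inter (isH_half a)
  have h2 := hC.inter (isH_half' a)
  have hu : (C ∩ {x | 0 ≤ ⟪a, x⟫_ℝ}) ∪ (C ∩ {x | ⟪a, x⟫_ℝ ≤ 0}) = C := by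
    ext x
    simp only [Set.mem_union, Set.mem_inter_iff, Set.mem_setOf_eq]
    have := le_total 0 (⟪a, x⟫_ℝ)
    tauto
  have h3 := α.union' _ _ h1.poly h2.poly (by rw [hu]; exact hC.poly) (h1.inter h2).poly
  rw [hu] at h3
  rw [h3, α.simple' _ (h1.inter h2).poly, sub_zero]
  apply sdim_lt_of_subset_hyper ha
  rintro x ⟨⟨_, hx1⟩, ⟨_, hx2⟩⟩
  exact le_antisymm hx2 hx1

lemma exists_inner_ne_of_sdim {K : Set (Euc d)} (hK : sdim K = d) (h0 : (0 : Euc d) ∈ K) {a : Euc d}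
    (ha : a ≠ 0) : ∃ x ∈ K, ⟪a, x⟫_ℝ ≠ 0 := by
  by_contra h
  push Not at h
  exact absurd (sdim_lt_of_subset_hyper ha h) (by omega)

lemma hcone_zero_mem (N : Finset (Euc d)) : (0 : Euc d) ∈ hcone N := fun a _ => by simp

lemma hcone_add_mem {N : Finset (Euc d)} {x y : Euc d} (hx : x ∈ hcone N) (hy : y ∈ hcone N) :
    x + y ∈ hcone N := fun a ha => by
  rw [inner_add_right]; exact add_nonneg (hx a ha) (hy a ha)

/-- The master lemma: an identity of indicator functions at generic points gives an identity
of cone angles. -/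
theorem master (α : ConeAngle d) {ι : Type*} (J : Finset ι) (C : ι → Set (Euc d))
    (hC : ∀ j ∈ J, IsH (C j)) (l : ι → ℝ) (κ : ℝ) (N : Finset (Euc d)) (hN : ∀ a ∈ N, a ≠ 0)
    (h : ∀ u, (∀ a ∈ N, ⟪a, u⟫_ℝ ≠ 0) → ∑ j ∈ J, l j * ind (C j) u = κ) :
    ∑ j ∈ J, l j * α.toFun (C j) = κ := by
  classical
  have hC' : ∀ j, ∃ M : Finset (Euc d), j ∈ J → C j = hcone M := by
    intro j
    by_cases hj : j ∈ J
    · obtain ⟨M, hM⟩ := hC j hj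
      exact ⟨M, fun _ => hM⟩
    · exact ⟨∅, fun hh => absurd hh hj⟩
  choose M hM using hC'
  let A : Finset (Euc d) := (N ∪ J.biUnion M).erase 0
  have hA0 : ∀ a ∈ A, a ≠ 0 := fun a ha => Finset.ne_of_mem_erase ha
  have hAN : ∀ a ∈ N, a ∈ A := fun a ha => Finset.mem_erase.mpr ⟨hN a ha, Finset.mem_union_left _ ha⟩
  have hAM : ∀ j ∈ J, ∀ a ∈ M j, a ≠ 0 → a ∈ A := fun j hj a ha h0 =>
    Finset.mem_erase.mpr ⟨h0, Finset.mem_union_right _ (Finset.mem_biUnion.mpr ⟨j, hj, ha⟩)⟩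
  -- induction on undecided hyperplanes
  have key : ∀ B : Finset (Euc d), B ⊆ A → ∀ K : Set (Euc d), IsH K →
      (∀ a ∈ A, a ∉ B → (∀ x ∈ K, 0 ≤ ⟪a, x⟫_ℝ) ∨ (∀ x ∈ K, ⟪a, x⟫_ℝ ≤ 0)) →
      ∑ j ∈ J, l j * α.toFun (C j ∩ K) = κ * α.toFun K := by
    intro B
    induction B using Finset.induction_on with
    | empty =>
      intro _ K hK hdec
      have hdec' : ∀ a ∈ A, (∀ x ∈ K, 0 ≤ ⟪a, x⟫_ℝ) ∨ (∀ x ∈ K, ⟪a, x⟫_ℝ ≤ 0) :=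
        fun a ha => hdec a ha (Finset.notMem_empty a)
      by_cases hdim : sdim K < d
      · rw [α.simple' K hK.poly hdim, mul_zero]
        apply Finset.sum_eq_zero
        intro j hj
        rw [α.simple' _ ((hC j hj).inter hK).poly, mul_zero]
        exact lt_of_le_of_lt (Submodule.finrank_mono (vectorSpan_mono ℝ Set.inter_subset_right)) hdim
      · have hd : sdim K = d := by
          have : sdim K ≤ d := by
            have := Submodule.finrank_le (vectorSpan ℝ K)
            rwa [finrank_euclideanSpace_fin] at this
          omega
        obtain ⟨MK, rfl⟩ := hK
        have hx : ∀ a : Euc d, ∃ x ∈ hcone MK, a ∈ A → ⟪a, x⟫_ℝ ≠ 0 := by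
          intro a
          by_cases ha : a ∈ A
          · obtain ⟨x, hx, hne⟩ := exists_inner_ne_of_sdim hd (hcone_zero_mem MK) (hA0 a ha)
            exact ⟨x, hx, fun _ => hne⟩
          · exact ⟨0, hcone_zero_mem MK, fun hh => absurd hh ha⟩
        choose x hxK hxne using hx
        let u := ∑ a ∈ A, x a
        have huK : u ∈ hcone MK := by
          intro m hm
          rw [inner_sum]
          exact Finset.sum_nonneg (fun a _ => hxK a m hm)
        have hune : ∀ a ∈ A, ⟪a, u⟫_ℝ ≠ 0 := by
          intro a ha
          rw [inner_sum]
          rcases hdec' a ha with hs | hs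
          · have : 0 < ∑ i ∈ A, ⟪a, x i⟫_ℝ := Finset.sum_pos' (fun i _ => hs _ (hxK i))
              ⟨a, ha, lt_of_le_of_ne (hs _ (hxK a)) (hxne a ha).symm⟩
            exact this.ne'
          · have : ∑ i ∈ A, ⟪a, x i⟫_ℝ < 0 := Finset.sum_neg' (fun i _ => hs _ (hxK i))
              ⟨a, ha, lt_of_le_of_ne (hs _ (hxK a)) (hxne a ha)⟩
            exact this.ne
        have h1 := h u (fun a ha => hune a (hAN a ha))
        rw [← h1, Finset.sum_mul]
        apply Finset.sum_congr rfl
        intro j hj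
        rw [mul_assoc]
        congr 1
        by_cases hu : u ∈ C j
        · rw [ind_of_mem hu, one_mul]
          congr 1
          apply Set.inter_eq_right.mpr
          intro y hy
          rw [hM j hj] at hu ⊢
          intro a ha
          by_cases ha0 : a = 0
          · simp [ha0]
          have haA := hAM j hj a ha ha0
          rcases hdec' a haA with hs | hs
          · exact hs y hy
          · exact absurd (le_antisymm (hs u huK) (hu a ha)) (hune a haA)
        · rw [ind_of_not_mem hu, zero_mul]
          have hu' := hu
          rw [hM j hj] at hu'
          simp only [hcone, Set.mem_setOf_eq, not_forall, not_le] at hu'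
          obtain ⟨a, ha, hlt⟩ := hu'
          have ha0 : a ≠ 0 := by rintro rfl; simp at hlt
          apply α.simple' _ ((hC j hj).inter ⟨MK, rfl⟩).poly
          apply sdim_lt_of_subset_hyper ha0
          rintro y ⟨hy1, hy2⟩
          rw [hM j hj] at hy1
          rcases hdec' a (hAM j hj a ha ha0) with hs | hs
          · exact absurd (hs u huK) (not_le.mpr hlt)
          · exact le_antisymm (hs y hy2) (hy1 a ha)
    | insert b B hb ih =>
      intro hsub K hK hdec
      have hbA : b ∈ A := hsub (Finset.mem_insert_self _ _)
      have hBA : B ⊆ A := (Finset.subset_insert _ _).trans hsub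
      have hb0 := hA0 b hbA
      have i1 := ih hBA _ (hK.inter (isH_half b)) (by
        intro a ha haB
        by_cases hab : a = b
        · subst hab; left; rintro x ⟨_, hx⟩; exact hx
        · rcases hdec a ha (by simp [hab, haB]) with hs | hs
          · left; rintro x ⟨hx, _⟩; exact hs x hx
          · right; rintro x ⟨hx, _⟩; exact hs x hx)
      have i2 := ih hBA _ (hK.inter (isH_half' b)) (by
        intro a ha haB
        by_cases hab : a = b
        · subst hab; right; rintro x ⟨_, hx⟩; exact hx
        · rcases hdec a ha (by simp [hab, haB]) with hs | hs
          · left; rintro x ⟨hx, _⟩; exact hs x hx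
          · right; rintro x ⟨hx, _⟩; exact hs x hx)
      rw [alpha_cut α hK hb0, mul_add, ← i1, ← i2, ← Finset.sum_add_distrib]
      apply Finset.sum_congr rfl
      intro j hj
      rw [alpha_cut α ((hC j hj).inter hK) hb0, Set.inter_assoc, Set.inter_assoc]
      ring
  have := key A (le_refl _) Set.univ isH_univ (fun a ha hna => absurd ha hna)
  simpa [α.norm'] using this

end cones
end GramAngles

namespace GramAngles

/-! ### Faces of polytopes -/
section faces
variable {d : ℕ}

/-- nonempty faces -/
def faces (G : Set (Euc d)) : Set (Set (Euc d)) := {F | IsFace G F ∧ F.Nonempty}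

lemma maxFace_subset (G : Set (Euc d)) (c : Euc d) : maxFace G c ⊆ G := fun _ h => h.1

lemma maxFace_zero (G : Set (Euc d)) : maxFace G 0 = G := by
  ext x; simp [maxFace]

lemma maxFace_isFace (G : Set (Euc d)) (c : Euc d) : IsFace G (maxFace G c) :=
  fun _ => ⟨innerSL ℝ c, by ext x; simp [maxFace]⟩

lemma maxFace_convex {G : Set (Euc d)} (hG : Convex ℝ G) (c : Euc d) : Convex ℝ (maxFace G c) :=
  (maxFace_isFace G c).convex hG

lemma exists_maxFace_of_faces {G F : Set (Euc d)} (h : F ∈ faces G) : ∃ c, F = maxFace G c := by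
  obtain ⟨l, hl⟩ := h.1 h.2
  refine ⟨(InnerProductSpace.toDual ℝ (Euc d)).symm l, ?_⟩
  rw [hl]
  ext x
  simp [maxFace]

lemma convexHull_inner_le {s : Finset (Euc d)} {c : Euc d} {m : ℝ} (h : ∀ v ∈ s, ⟪c, v⟫_ℝ ≤ m)
    {y : Euc d} (hy : y ∈ convexHull ℝ (s : Set (Euc d))) : ⟪c, y⟫_ℝ ≤ m := by
  obtain ⟨w, hw, hw1, rfl⟩ := Finset.mem_convexHull'.mp hy
  rw [inner_sum]
  calc ∑ i ∈ s, ⟪c, w i • i⟫_ℝ ≤ ∑ i ∈ s, w i * m := Finset.sum_le_sum (fun i hi => by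
        rw [inner_smul_right]; exact mul_le_mul_of_nonneg_left (h i hi) (hw i hi))
    _ = m := by rw [← Finset.sum_mul, hw1, one_mul]

open Classical in
/-- maximizers in a finite set -/
def mx (s : Finset (Euc d)) (c : Euc d) : Finset (Euc d) :=
  s.filter (fun v => ∀ w ∈ s, ⟪c, w⟫_ℝ ≤ ⟪c, v⟫_ℝ)

lemma mem_mx {s : Finset (Euc d)} {c v : Euc d} :
    v ∈ mx s c ↔ v ∈ s ∧ ∀ w ∈ s, ⟪c, w⟫_ℝ ≤ ⟪c, v⟫_ℝ := by
  classical
  exact Finset.mem_filter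

lemma mx_nonempty {s : Finset (Euc d)} (hs : s.Nonempty) (c : Euc d) : (mx s c).Nonempty := by
  obtain ⟨v, hv, h⟩ := s.exists_max_image (fun v => ⟪c, v⟫_ℝ) hs
  exact ⟨v, mem_mx.mpr ⟨hv, h⟩⟩

lemma mx_subset (s : Finset (Euc d)) (c : Euc d) : mx s c ⊆ s := fun _ h => (mem_mx.mp h).1

lemma maxFace_hull {s : Finset (Euc d)} (hs : s.Nonempty) (c : Euc d) :
    maxFace (convexHull ℝ (s : Set (Euc d))) c = convexHull ℝ (mx s c : Set (Euc d)) := by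
  classical
  apply Set.Subset.antisymm
  · rintro x ⟨hx, hmax⟩
    obtain ⟨m, hm⟩ := mx_nonempty hs c
    obtain ⟨w, hw, hw1, hwx⟩ := Finset.mem_convexHull'.mp hx
    have hmx : ⟪c, m⟫_ℝ ≤ ⟪c, x⟫_ℝ := hmax m (subset_convexHull ℝ _ (mx_subset _ _ hm))
    have hzero : ∀ v ∈ s, w v * (⟪c, m⟫_ℝ - ⟪c, v⟫_ℝ) = 0 := by
      have hnn : ∀ v ∈ s, 0 ≤ w v * (⟪c, m⟫_ℝ - ⟪c, v⟫_ℝ) := fun v hv =>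
        mul_nonneg (hw v hv) (sub_nonneg.mpr ((mem_mx.mp hm).2 v hv))
      apply (Finset.sum_eq_zero_iff_of_nonneg hnn).mp
      apply le_antisymm _ (Finset.sum_nonneg hnn)
      have : ∑ v ∈ s, w v * (⟪c, m⟫_ℝ - ⟪c, v⟫_ℝ) = ⟪c, m⟫_ℝ - ⟪c, x⟫_ℝ := by
        rw [← hwx, inner_sum]
        simp only [mul_sub, Finset.sum_sub_distrib, ← Finset.sum_mul, hw1, one_mul, inner_smul_right]
      rw [this]; linarith
    have hout : ∀ v ∈ s, v ∉ mx s c → w v = 0 := by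
      intro v hv hvn
      rcases mul_eq_zero.mp (hzero v hv) with h | h
      · exact h
      · exact absurd (mem_mx.mpr ⟨hv, fun w hw => by
          have := (mem_mx.mp hm).2 w hw; linarith⟩) hvn
    rw [Finset.mem_convexHull']
    refine ⟨w, fun y hy => hw y (mx_subset _ _ hy), ?_, ?_⟩
    · rw [← hw1]
      exact Finset.sum_subset (mx_subset _ _) hout
    · rw [← hwx]
      exact Finset.sum_subset (mx_subset _ _) (fun v hv hn => by rw [hout v hv hn, zero_smul])
  · apply convexHull_min
    · intro v hv
      obtain ⟨h1, h2⟩ := mem_mx.mp hv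
      exact ⟨subset_convexHull ℝ _ h1, fun y hy => convexHull_inner_le h2 hy⟩
    · exact maxFace_convex (convex_convexHull ℝ _) c

lemma IsPolytope.convex {G : Set (Euc d)} (h : IsPolytope G) : Convex ℝ G := by
  obtain ⟨s, _, rfl⟩ := h; exact convex_convexHull ℝ _

lemma IsPolytope.nonempty {G : Set (Euc d)} (h : IsPolytope G) : G.Nonempty := by
  obtain ⟨s, hs, rfl⟩ := h
  exact (convexHull_nonempty_iff (𝕜 := ℝ)).mpr hs

lemma IsPolytope.isCompact {G : Set (Euc d)} (h : IsPolytope G) : IsCompact G := by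
  obtain ⟨s, _, rfl⟩ := h
  exact s.finite_toSet.isCompact_convexHull ℝ

lemma IsPolytope.maxFace {G : Set (Euc d)} (h : IsPolytope G) (c : Euc d) :
    IsPolytope (maxFace G c) := by
  obtain ⟨s, hs, rfl⟩ := h
  exact ⟨mx s c, mx_nonempty hs c, maxFace_hull hs c⟩

lemma maxFace_mem_faces {G : Set (Euc d)} (h : IsPolytope G) (c : Euc d) : maxFace G c ∈ faces G :=
  ⟨maxFace_isFace G c, (h.maxFace c).nonempty⟩

lemma mem_faces_iff {G F : Set (Euc d)} (h : IsPolytope G) : F ∈ faces G ↔ ∃ c, F = maxFace G c :=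
  ⟨exists_maxFace_of_faces, by rintro ⟨c, rfl⟩; exact maxFace_mem_faces h c⟩

lemma self_mem_faces {G : Set (Euc d)} (h : IsPolytope G) : G ∈ faces G := by
  have := maxFace_mem_faces h 0
  rwa [maxFace_zero] at this

lemma IsPolytope.face {G F : Set (Euc d)} (h : IsPolytope G) (hF : F ∈ faces G) : IsPolytope F := by
  obtain ⟨c, rfl⟩ := exists_maxFace_of_faces hF
  exact h.maxFace c

lemma faces_subset {G F : Set (Euc d)} (hF : F ∈ faces G) : F ⊆ G := by
  obtain ⟨c, rfl⟩ := exists_maxFace_of_faces hF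
  exact maxFace_subset G c

lemma faces_finite {G : Set (Euc d)} (h : IsPolytope G) : (faces G).Finite := by
  classical
  obtain ⟨s, hs, hG⟩ := id h
  apply ((s.powerset.image (fun t : Finset (Euc d) => convexHull ℝ (t : Set (Euc d)))).finite_toSet).subset
  intro F hF
  obtain ⟨c, rfl⟩ := exists_maxFace_of_faces hF
  rw [Finset.mem_coe, Finset.mem_image]
  refine ⟨mx s c, Finset.mem_powerset.mpr (mx_subset _ _), ?_⟩
  rw [hG, maxFace_hull hs]

lemma face_trans {G F K : Set (Euc d)} (h : IsPolytope G) (hF : F ∈ faces G) (hK : K ∈ faces F) :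
    K ∈ faces G := by
  classical
  obtain ⟨c, rfl⟩ := exists_maxFace_of_faces hF
  obtain ⟨c2, rfl⟩ := exists_maxFace_of_faces hK
  obtain ⟨s, hs, hG⟩ := id h
  have hev : ∀ᶠ N : ℝ in Filter.atTop, ∀ v ∈ s, ∀ w ∈ s, ⟪c, v⟫_ℝ < ⟪c, w⟫_ℝ →
      N * ⟪c, v⟫_ℝ + ⟪c2, v⟫_ℝ < N * ⟪c, w⟫_ℝ + ⟪c2, w⟫_ℝ := by
    rw [Filter.eventually_all_finset]
    intro v hv
    rw [Filter.eventually_all_finset]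
    intro w hw
    filter_upwards [Filter.eventually_gt_atTop ((⟪c2, v⟫_ℝ - ⟪c2, w⟫_ℝ) / (⟪c, w⟫_ℝ - ⟪c, v⟫_ℝ))] with N hN hlt
    rw [div_lt_iff₀ (by linarith)] at hN
    linarith
  obtain ⟨N, hN⟩ := hev.exists
  have : maxFace (maxFace G c) c2 = maxFace G (N • c + c2) := by
    rw [hG, maxFace_hull hs, maxFace_hull (mx_nonempty hs c), maxFace_hull hs]
    congr 2
    ext v
    simp only [mem_mx, inner_add_left, real_inner_smul_left]
    constructor
    · rintro ⟨⟨h1, h2⟩, h3⟩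
      refine ⟨h1, fun w hw => ?_⟩
      rcases (h2 w hw).lt_or_eq with h4 | h4
      · exact (hN w hw v h1 h4).le
      · have := h3 w ⟨hw, fun u hu => by rw [h4]; exact h2 u hu⟩
        rw [h4]; linarith
    · rintro ⟨h1, h2⟩
      have hmax : ∀ w ∈ s, ⟪c, w⟫_ℝ ≤ ⟪c, v⟫_ℝ := by
        intro w hw
        by_contra hlt
        push Not at hlt
        have := hN v h1 w hw hlt
        have := h2 w hw
        linarith
      refine ⟨⟨h1, hmax⟩, ?_⟩
      rintro w ⟨hw, hw2⟩
      have e : ⟪c, w⟫_ℝ = ⟪c, v⟫_ℝ := le_antisymm (hmax w hw) (hw2 v h1)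
      have := h2 w hw
      rw [e] at this
      linarith
  rw [this]
  exact maxFace_mem_faces h _

lemma face_mono {G F K : Set (Euc d)} (hF : F ∈ faces G) (hK : K ∈ faces G) (hKF : K ⊆ F) :
    K ∈ faces F :=
  ⟨IsExposed.mono hK.1 (faces_subset hF) hKF, hK.2⟩

lemma inner_maxFace_span {G : Set (Euc d)} {c l : Euc d} (hl : l ∈ vectorSpan ℝ (maxFace G c)) :
    ⟪c, l⟫_ℝ = 0 := by
  have : vectorSpan ℝ (maxFace G c) ≤ LinearMap.ker (innerSL ℝ c).toLinearMap := by
    rw [vectorSpan_def, Submodule.span_le]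
    rintro _ ⟨x, hx, y, hy, rfl⟩
    show (innerSL ℝ c) (x - y) = 0
    rw [innerSL_apply_apply, inner_sub_right]
    have := hx.2 y hy.1
    have := hy.2 x hx.1
    linarith
  exact this hl

lemma face_eq_of_span {G F K : Set (Euc d)} (hF : F ∈ faces G) (hK : K ⊆ G) (hFK : F ⊆ K)
    (hs : vectorSpan ℝ K ≤ vectorSpan ℝ F) : F = K := by
  apply Set.Subset.antisymm hFK
  obtain ⟨x, hx⟩ := hF.2
  obtain ⟨c, rfl⟩ := exists_maxFace_of_faces hF
  intro y hy
  have h1 : y - x ∈ vectorSpan ℝ (maxFace G c) :=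
    hs (vsub_mem_vectorSpan ℝ hy (hFK hx))
  have h2 := inner_maxFace_span h1
  rw [inner_sub_right] at h2
  exact ⟨hK hy, fun z hz => by have := hx.2 z hz; linarith⟩

lemma face_eq_of_sdim {G F K : Set (Euc d)} (hF : F ∈ faces G) (hK : K ⊆ G) (hFK : F ⊆ K)
    (hs : sdim K ≤ sdim F) : F = K := by
  apply face_eq_of_span hF hK hFK
  exact (Submodule.eq_of_le_of_finrank_le (vectorSpan_mono ℝ hFK) hs).ge

lemma sdim_mono {F K : Set (Euc d)} (hFK : F ⊆ K) : sdim F ≤ sdim K :=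
  Submodule.finrank_mono (vectorSpan_mono ℝ hFK)

lemma face_sdim_lt {G F K : Set (Euc d)} (hF : F ∈ faces G) (hK : K ⊆ G) (hFK : F ⊂ K) :
    sdim F < sdim K := by
  by_contra h
  exact hFK.ne (face_eq_of_sdim hF hK hFK.subset (not_lt.mp h))

lemma intrinsicInterior_subset_relin {F : Set (Euc d)} : intrinsicInterior ℝ F ⊆ relin F := by
  intro x hx
  have hxF : x ∈ F := intrinsicInterior_subset hx
  refine ⟨hxF, fun y hy => ?_⟩
  obtain ⟨z, hz, rfl⟩ := mem_intrinsicInterior.mp hx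
  let f : ℝ → affineSpan ℝ F := fun ε => ⟨(z : Euc d) + ε • ((z : Euc d) - y), by
    have := AffineSubspace.vadd_mem_of_mem_direction (s := affineSpan ℝ F)
      (Submodule.smul_mem _ ε (AffineSubspace.vsub_mem_direction z.2 (subset_affineSpan ℝ F hy))) z.2
    rw [vadd_eq_add, add_comm] at this
    exact this⟩
  have hf : Continuous f := by
    apply Continuous.subtype_mk
    fun_prop
  have hf0 : f 0 = z := by ext; simp [f]
  have hnh : f ⁻¹' ((↑) ⁻¹' F) ∈ nhds (0 : ℝ) := by
    apply hf.continuousAt.preimage_mem_nhds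
    rw [hf0]
    exact mem_interior_iff_mem_nhds.mp hz
  obtain ⟨δ, hδ, hball⟩ := Metric.mem_nhds_iff.mp hnh
  refine ⟨δ / 2, by linarith, ?_⟩
  have : δ / 2 ∈ Metric.ball (0 : ℝ) δ := by
    rw [Metric.mem_ball, Real.dist_eq, sub_zero, abs_of_pos] <;> linarith
  exact hball this

lemma relPt_mem {F : Set (Euc d)} (hF : Convex ℝ F) (hne : F.Nonempty) : relPt F ∈ relin F := by
  have h := hne.intrinsicInterior hF
  unfold relPt
  rw [dif_pos h]
  exact intrinsicInterior_subset_relin h.some_mem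

lemma mem_vcone_dir [DecidableEq (Euc d)] {s : Finset (Euc d)} {x w : Euc d}
    (hx : x ∈ convexHull ℝ (s : Set (Euc d))) :
    w ∈ vcone (s.image (fun v => v - x)) ↔ ∃ ε : ℝ, 0 < ε ∧ x + ε • w ∈ convexHull ℝ (s : Set (Euc d)) := by
  have hsum : ∀ c : Euc d → Euc d, ∑ v ∈ s.image (fun v => v - x), c v = ∑ v ∈ s, c (v - x) := by
    intro c
    rw [Finset.sum_image]
    intro a _ b _ h
    exact sub_left_injective h
  constructor
  · rintro ⟨c, hc, rfl⟩
    rw [hsum]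
    obtain ⟨m, hm, hm1, hmx⟩ := Finset.mem_convexHull'.mp hx
    let C := ∑ v ∈ s, c (v - x)
    have hC : 0 ≤ C := Finset.sum_nonneg (fun v _ => hc _)
    refine ⟨1 / (1 + C), by positivity, ?_⟩
    rw [Finset.mem_convexHull']
    refine ⟨fun v => (1 / (1 + C)) * (m v + c (v - x)), ?_, ?_, ?_⟩
    · intro v hv
      have := hm v hv
      have := hc (v - x)
      positivity
    · rw [← Finset.mul_sum, Finset.sum_add_distrib, hm1]
      show 1 / (1 + C) * (1 + C) = 1
      field_simp
    · simp only [mul_smul, ← Finset.smul_sum, add_smul, Finset.sum_add_distrib, hmx]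
      have : ∑ v ∈ s, c (v - x) • (v - x) = ∑ v ∈ s, c (v - x) • v - C • x := by
        simp only [smul_sub, Finset.sum_sub_distrib, ← Finset.sum_smul, C]
      rw [this]
      have h1 : (1 + C) ≠ 0 := by positivity
      have h2 : x = (1 / (1 + C)) • ((1 + C) • x) := by
        rw [smul_smul]; field_simp; simp
      generalize ∑ v ∈ s, c (v - x) • v = Y
      nth_rewrite 2 [h2]
      rw [← smul_add]
      congr 1
      module
  · rintro ⟨ε, hε, h⟩
    obtain ⟨m, hm, hm1, hmx⟩ := Finset.mem_convexHull'.mp h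
    rw [mem_vcone_iff]
    intro a ha
    have h1 : ∀ v ∈ s, ⟪-a, v⟫_ℝ ≤ ⟪-a, x⟫_ℝ := by
      intro v hv
      have := ha _ (Finset.mem_image_of_mem _ hv)
      rw [inner_sub_right] at this
      rw [inner_neg_left, inner_neg_left]; linarith
    have h2 := convexHull_inner_le h1 h
    rw [inner_add_right, inner_smul_right, inner_neg_left, inner_neg_left] at h2
    by_contra hn
    push Not at hn
    nlinarith

/-- each point lies in the relative interior of a face -/
lemma exists_face_relin {G : Set (Euc d)} (hG : IsPolytope G) {x : Euc d} (hx : x ∈ G) :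
    ∃ F ∈ faces G, x ∈ relin F := by
  classical
  have hfin : {F ∈ faces G | x ∈ F}.Finite := (faces_finite hG).subset (fun F h => h.1)
  obtain ⟨F, ⟨hF, hxF⟩, hmin⟩ := Set.exists_min_image _ (fun F => sdim F) hfin ⟨G, self_mem_faces hG, hx⟩
  refine ⟨F, hF, hxF, ?_⟩
  by_contra hcon
  push Not at hcon
  obtain ⟨y, hy, hyn⟩ := hcon
  obtain ⟨s, hs, hFs⟩ := hG.face hF
  have hnot : x - y ∉ vcone (s.image (fun v => v - x)) := by
    rw [mem_vcone_dir (by rw [← hFs]; exact hxF), ← hFs]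
    rintro ⟨ε, hε, h⟩
    exact hyn ε hε h
  rw [mem_vcone_iff] at hnot
  push Not at hnot
  obtain ⟨a, ha, hlt⟩ := hnot
  have hxm : x ∈ maxFace F (-a) := by
    refine ⟨hxF, fun z hz => ?_⟩
    rw [hFs] at hz
    apply convexHull_inner_le _ hz
    intro v hv
    have := ha _ (Finset.mem_image_of_mem _ hv)
    rw [inner_sub_right] at this
    rw [inner_neg_left, inner_neg_left]; linarith
  have hmf : maxFace F (-a) ∈ faces G := face_trans hG hF (maxFace_mem_faces (hG.face hF) _)
  have hle := hmin _ ⟨hmf, hxm⟩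
  have heq := face_eq_of_sdim hmf (faces_subset hF) (maxFace_subset F (-a)) hle
  have hyF : y ∈ maxFace F (-a) := by rw [heq]; exact hy
  have := hyF.2 x hxF
  rw [inner_sub_right] at hlt
  rw [inner_neg_left, inner_neg_left] at this
  linarith

lemma face_subset_of_relin {G F K : Set (Euc d)} (hF : F ⊆ G) (hK : K ∈ faces G) {x : Euc d}
    (hx : x ∈ relin F) (hxK : x ∈ K) : F ⊆ K := by
  obtain ⟨c, rfl⟩ := exists_maxFace_of_faces hK
  intro y hy
  obtain ⟨ε, hε, h⟩ := hx.2 y hy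
  have := hxK.2 _ (hF h)
  rw [inner_add_right, inner_smul_right, inner_sub_right] at this
  refine ⟨hF hy, fun z hz => ?_⟩
  have := hxK.2 z hz
  nlinarith

lemma relin_face_unique {G F K : Set (Euc d)} (hF : F ∈ faces G) (hK : K ∈ faces G) {x : Euc d}
    (hx : x ∈ relin F) (hxK : x ∈ relin K) : F = K :=
  Set.Subset.antisymm (face_subset_of_relin (faces_subset hF) hK hx hxK.1)
    (face_subset_of_relin (faces_subset hK) hF hxK hx.1)

/-- `w` points from `q` into `G` -/
def Pnt (q : Euc d) (G : Set (Euc d)) (w : Euc d) : Prop := ∃ ε : ℝ, 0 < ε ∧ q + ε • w ∈ G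

lemma Pnt.relin {F G : Set (Euc d)} (hFG : F ⊆ G) (hG : Convex ℝ G) {q q' w : Euc d}
    (hq : q ∈ F) (hq' : q' ∈ relin F) (h : Pnt q G w) : Pnt q' G w := by
  obtain ⟨ε, hε, h⟩ := h
  obtain ⟨δ, hδ, hd⟩ := hq'.2 q hq
  refine ⟨(δ / (1 + δ)) * ε, by positivity, ?_⟩
  have := hG (hFG hd) h (a := 1 / (1 + δ)) (b := δ / (1 + δ)) (by positivity) (by positivity)
    (by field_simp)
  convert this using 1
  have h1 : (1 + δ) ≠ 0 := by positivity
  have h2 : q' = (1 / (1 + δ)) • ((1 + δ) • q') := by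
    rw [smul_smul]; field_simp; simp
  have h3 : (δ / (1 + δ)) = (1 / (1 + δ)) * δ := by ring
  nth_rewrite 1 [h2]
  rw [h3]
  module

lemma mem_innerCone {F G : Set (Euc d)} (hG : Convex ℝ G) (hF : Convex ℝ F) (hne : F.Nonempty)
    (hFG : F ⊆ G) (u : Euc d) :
    u ∈ innerCone F G ↔ Pnt (relPt F) G ((vectorSpan ℝ G).starProjection u) := by
  have hq : relPt F ∈ G := hFG (relPt_mem hF hne).1
  unfold innerCone posHull
  rw [Set.mem_add]
  constructor
  · rintro ⟨_, ⟨c, _, ⟨p, hp, rfl⟩, hc, rfl⟩, l, hl, rfl⟩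
    have h1 : (vectorSpan ℝ G).starProjection (c • (p - relPt F) + l) = c • (p - relPt F) := by
      rw [map_add, Submodule.starProjection_eq_self_iff.mpr, 
        (Submodule.starProjection_apply_eq_zero_iff _).mpr hl, add_zero]
      exact Submodule.smul_mem _ _ (vsub_mem_vectorSpan ℝ hp hq)
    dsimp only
    rw [h1]
    refine ⟨1 / (1 + c), by positivity, ?_⟩
    have := hG hq hp (a := 1 / (1 + c)) (b := c / (1 + c)) (by positivity) (by positivity)
      (by field_simp)
    convert this using 1
    have h1 : (1 + c) ≠ 0 := by positivity
    have h2 : relPt F = (1 / (1 + c)) • ((1 + c) • relPt F) := by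
      rw [smul_smul]; field_simp; simp
    have h3 : (c / (1 + c)) = (1 / (1 + c)) * c := by ring
    nth_rewrite 1 [h2]
    rw [h3]
    module
  · rintro ⟨ε, hε, h⟩
    refine ⟨(vectorSpan ℝ G).starProjection u, ⟨1 / ε, _, ⟨_, h, rfl⟩, by positivity, ?_⟩,
      u - (vectorSpan ℝ G).starProjection u, ?_, by abel⟩
    · simp only [add_sub_cancel_left, smul_smul]
      rw [one_div, inv_mul_cancel₀ hε.ne', one_smul]
    · exact Submodule.sub_starProjection_mem_orthogonal u

lemma innerCone_isH {F G : Set (Euc d)} (hG : IsPolytope G) (hF : Convex ℝ F) (hne : F.Nonempty)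
    (hFG : F ⊆ G) : IsH (innerCone F G) := by
  classical
  obtain ⟨s, hs, hGs⟩ := id hG
  have hq : relPt F ∈ G := hFG (relPt_mem hF hne).1
  unfold innerCone
  have : posHull ((fun x => x - relPt F) '' G) = vcone (s.image (fun v => v - relPt F)) := by
    ext w
    rw [mem_vcone_dir (by rw [← hGs]; exact hq), ← hGs]
    constructor
    · rintro ⟨c, _, ⟨p, hp, rfl⟩, hc, rfl⟩
      refine ⟨1 / (1 + c), by positivity, ?_⟩
      have := hG.convex hq hp (a := 1 / (1 + c)) (b := c / (1 + c)) (by positivity) (by positivity)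
        (by field_simp)
      convert this using 1
      have h1 : (1 + c) ≠ 0 := by positivity
      have h2 : relPt F = (1 / (1 + c)) • ((1 + c) • relPt F) := by
        rw [smul_smul]; field_simp; simp
      have h3 : (c / (1 + c)) = (1 / (1 + c)) * c := by ring
      nth_rewrite 1 [h2]
      rw [h3]
      module
    · rintro ⟨ε, hε, h⟩
      refine ⟨1 / ε, _, ⟨_, h, rfl⟩, by positivity, ?_⟩
      simp only [add_sub_cancel_left, smul_smul]
      rw [one_div, inv_mul_cancel₀ hε.ne', one_smul]
  rw [this]
  exact (vcone_isH _).add (isH_submodule _)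

lemma outerCone_isH {F G : Set (Euc d)} (hG : IsPolytope G) (hF : IsPolytope F) :
    IsH (outerCone F G) := by
  classical
  obtain ⟨s, hs, rfl⟩ := hG
  obtain ⟨t, ht, hFt⟩ := id hF
  have : IsH (normalCone F (convexHull ℝ (s : Set (Euc d)))) := by
    refine ⟨(t ×ˢ s).image (fun p => p.1 - p.2), ?_⟩
    ext c
    simp only [normalCone, hcone, Set.mem_ofPred_eq, Finset.mem_image, Finset.mem_product]
    constructor
    · rintro h _ ⟨⟨x, y⟩, ⟨hx, hy⟩, rfl⟩
      have := h x (by rw [hFt]; exact subset_convexHull ℝ _ hx) y (subset_convexHull ℝ _ hy)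
      rw [real_inner_comm, inner_sub_right]; linarith
    · intro h x hx y hy
      have h1 : ∀ x ∈ t, ∀ v ∈ s, ⟪c, v⟫_ℝ ≤ ⟪c, x⟫_ℝ := by
        intro x hx v hv
        have := h _ ⟨(x, v), ⟨hx, hv⟩, rfl⟩
        rw [real_inner_comm, inner_sub_right] at this; linarith
      have h2 : ∀ x ∈ t, ⟪-c, x⟫_ℝ ≤ - ⟪c, y⟫_ℝ := by
        intro x hx
        rw [inner_neg_left]
        have := convexHull_inner_le (h1 x hx) hy
        linarith
      rw [hFt] at hx
      have := convexHull_inner_le h2 hx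
      rw [inner_neg_left] at this
      linarith
  exact this.add (isH_submodule _)

end faces
end GramAngles

namespace GramAngles

/-! ### Angle identities -/
section angles
variable {d : ℕ}

open Classical in
/-- finset of nonempty faces (empty if there are infinitely many) -/
def fcs (G : Set (Euc d)) : Finset (Set (Euc d)) :=
  if h : (faces G).Finite then h.toFinset else ∅

lemma mem_fcs {G F : Set (Euc d)} (hG : IsPolytope G) : F ∈ fcs G ↔ F ∈ faces G := by
  unfold fcs
  rw [dif_pos (faces_finite hG)]
  exact Set.Finite.mem_toFinset _

open Classical in
lemma ext_sum (α : ConeAngle d) {G : Set (Euc d)} (hG : IsPolytope G) (L : Submodule ℝ (Euc d))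
    (N : Finset (Euc d)) (hN : ∀ a ∈ N, a ≠ 0)
    (h : ∀ c, (∀ a ∈ N, ⟪a, c⟫_ℝ ≠ 0) → vectorSpan ℝ (maxFace G (Lᗮ.starProjection c)) = L) :
    ∑ F ∈ (fcs G).filter (fun F => vectorSpan ℝ F = L), extAngle α F G = 1 := by
  have key := master α ((fcs G).filter (fun F => vectorSpan ℝ F = L)) (fun F => outerCone F G)
    (fun F hF => outerCone_isH hG (hG.face ((mem_fcs hG).mp (Finset.mem_filter.mp hF).1)))
    (fun _ => 1) 1 N hN ?_
  · simpa [extAngle] using key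
  intro c hc
  have hL := h c hc
  set F0 := maxFace G (Lᗮ.starProjection c) with hF0
  have hF0m : F0 ∈ faces G := maxFace_mem_faces hG _
  rw [Finset.sum_eq_single F0]
  · rw [ind_of_mem, one_mul]
    unfold outerCone
    rw [Set.mem_add]
    refine ⟨Lᗮ.starProjection c, fun x hx y hy => hx.2 y hy, c - Lᗮ.starProjection c, ?_, by abel⟩
    rw [hL]
    have := Submodule.sub_starProjection_mem_orthogonal (K := Lᗮ) c
    rwa [Submodule.orthogonal_orthogonal] at this
  · intro F hF hne
    rw [ind_of_not_mem, mul_zero]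
    intro hmem
    apply hne
    obtain ⟨hF1, hF2⟩ := Finset.mem_filter.mp hF
    have hF1 := (mem_fcs hG).mp hF1
    unfold outerCone at hmem
    obtain ⟨c1, hc1, l, hl, rfl⟩ := Set.mem_add.mp hmem
    rw [hF2] at hl
    have hc1L : c1 ∈ Lᗮ := by
      rw [← hF2, Submodule.mem_orthogonal']
      have : vectorSpan ℝ F ≤ LinearMap.ker (innerSL ℝ c1).toLinearMap := by
        rw [vectorSpan_def, Submodule.span_le]
        rintro _ ⟨x, hx, y, hy, rfl⟩
        show (innerSL ℝ c1) (x - y) = 0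
        rw [innerSL_apply_apply, inner_sub_right]
        have := hc1 x hx y (faces_subset hF1 hy)
        have := hc1 y hy x (faces_subset hF1 hx)
        linarith
      intro u hu
      exact this hu
    have hp : Lᗮ.starProjection (c1 + l) = c1 := by
      rw [map_add, Submodule.starProjection_eq_self_iff.mpr hc1L,
        (Submodule.starProjection_apply_eq_zero_iff _).mpr, add_zero]
      rwa [Submodule.orthogonal_orthogonal]
    have hsub : F ⊆ F0 := by
      intro x hx
      rw [hF0, hp]
      exact ⟨faces_subset hF1 hx, fun y hy => hc1 x hx y hy⟩
    exact face_eq_of_span hF1 (maxFace_subset _ _) hsub (by rw [hL, hF2])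
  · intro hn
    exact absurd (Finset.mem_filter.mpr ⟨(mem_fcs hG).mpr hF0m, hL⟩) hn

open Classical in
lemma ext_vertices (α : ConeAngle d) {G : Set (Euc d)} (hG : IsPolytope G) :
    ∑ F ∈ (fcs G).filter (fun F => sdim F = 0), extAngle α F G = 1 := by
  obtain ⟨s, hs, hGs⟩ := id hG
  have key := ext_sum α hG ⊥ (((s ×ˢ s).image (fun p => p.1 - p.2)).erase 0)
    (fun a ha => Finset.ne_of_mem_erase ha) ?_
  · rw [← key]
    congr 1
    ext F
    simp only [Finset.mem_filter, sdim, Submodule.finrank_eq_zero]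
  intro c hc
  have : (⊥ : Submodule ℝ (Euc d))ᗮ.starProjection c = c := by
    rw [Submodule.starProjection_eq_self_iff]; simp
  rw [this, hGs, maxFace_hull hs]
  obtain ⟨v, hv⟩ := mx_nonempty hs c
  have : mx s c = {v} := by
    ext w
    rw [Finset.mem_singleton]
    refine ⟨fun hw => ?_, fun hw => hw ▸ hv⟩
    obtain ⟨hv1, hv2⟩ := mem_mx.mp hv
    obtain ⟨hw1, hw2⟩ := mem_mx.mp hw
    by_contra hne
    apply hc (w - v)
    · rw [Finset.mem_erase, Finset.mem_image]
      exact ⟨sub_ne_zero.mpr hne, (w, v), Finset.mem_product.mpr ⟨hw1, hv1⟩, rfl⟩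
    · rw [real_inner_comm, inner_sub_right]
      have := hv2 w hw1
      have := hw2 v hv1
      linarith
  rw [this]
  simp

lemma span_of_seg {G K : Set (Euc d)} (hK : K ∈ faces G) {m w : Euc d} (hm : m ∈ K) {ε δ : ℝ}
    (hε : 0 < ε) (hδ : 0 < δ) (h1 : m + ε • w ∈ G) (h2 : m - δ • w ∈ G) : w ∈ vectorSpan ℝ K := by
  obtain ⟨c, rfl⟩ := exists_maxFace_of_faces hK
  have e1 := hm.2 _ h1
  have e2 := hm.2 _ h2
  rw [inner_add_right, inner_smul_right] at e1
  rw [inner_sub_right, inner_smul_right] at e2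
  have hcw : ⟪c, w⟫_ℝ = 0 := by
    apply le_antisymm <;> by_contra h <;> push Not at h <;> nlinarith
  have : m + ε • w ∈ maxFace G c := by
    refine ⟨h1, fun y hy => ?_⟩
    rw [inner_add_right, inner_smul_right, hcw]
    have := hm.2 y hy
    linarith
  have h3 := vsub_mem_vectorSpan ℝ this hm
  rw [vsub_eq_sub, add_sub_cancel_left] at h3
  exact (Submodule.smul_mem_iff _ hε.ne').mp h3

open Classical in
lemma gram_pt {G : Set (Euc d)} (hG : IsPolytope G) {w : Euc d} (hw0 : w ≠ 0)
    (hwG : w ∈ vectorSpan ℝ G) (hw : ∀ F ∈ faces G, F ≠ G → w ∉ vectorSpan ℝ F) :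
    ∑ F ∈ fcs G, (-1 : ℝ) ^ sdim F * (if Pnt (relPt F) G w then 1 else 0) = 0 := by
  let J := (fcs G).filter (fun F => Pnt (relPt F) G w)
  let f : Euc d →ₗ[ℝ] Euc d := ((ℝ ∙ w)ᗮ.starProjection).toLinearMap
  have hfw : ∀ x y, f x = f y ↔ ∃ τ : ℝ, y = x + τ • w := by
    intro x y
    have : f x = f y ↔ f (y - x) = 0 := by rw [map_sub, sub_eq_zero]; exact eq_comm
    rw [this]
    show (ℝ ∙ w)ᗮ.starProjection (y - x) = 0 ↔ _
    rw [Submodule.starProjection_apply_eq_zero_iff, Submodule.orthogonal_orthogonal,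
      Submodule.mem_span_singleton]
    constructor
    · rintro ⟨τ, h⟩; exact ⟨τ, by rw [h]; abel⟩
    · rintro ⟨τ, h⟩; exact ⟨τ, by rw [h]; abel⟩
  have hker : LinearMap.ker f = ℝ ∙ w := by
    ext x
    rw [LinearMap.mem_ker]
    show (ℝ ∙ w)ᗮ.starProjection x = 0 ↔ _
    rw [Submodule.starProjection_apply_eq_zero_iff, Submodule.orthogonal_orthogonal]
  have hJ : ∀ F ∈ J, F ∈ faces G ∧ Pnt (relPt F) G w := fun F hF =>
    ⟨(mem_fcs hG).mp (Finset.mem_filter.mp hF).1, (Finset.mem_filter.mp hF).2⟩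
  have hcvx : ∀ F ∈ faces G, Convex ℝ F := fun F hF => (hG.face hF).convex
  have hrel : ∀ F ∈ faces G, relPt F ∈ relin F := fun F hF => relPt_mem (hcvx F hF) hF.2
  have hGG := self_mem_faces hG
  have hGJ : G ∈ J := Finset.mem_filter.mpr ⟨(mem_fcs hG).mpr hGG, relin_dir hG.convex (hrel G hGG) hwG⟩
  let l : Set (Euc d) → ℝ := fun F => if F = G then -1 else 1
  have key := chi_lemma (Module.finrank ℝ (Euc d)) (Euc d) rfl J (fun F => f '' relin F)
    (fun F hF => (relin_convex (hcvx F (hJ F hF).1)).linear_image f)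
    (fun F hF => algOpen_image (relin_algOpen (hcvx F (hJ F hF).1)) f)
    (fun F hF => ⟨_, _, hrel F (hJ F hF).1, rfl⟩) l ?_
  · have hsum : ∑ F ∈ fcs G, (-1 : ℝ) ^ sdim F * (if Pnt (relPt F) G w then 1 else 0)
        = ∑ F ∈ J, (-1 : ℝ) ^ sdim F := by
      rw [Finset.sum_filter]
      apply Finset.sum_congr rfl
      intro F _
      split_ifs <;> simp
    rw [hsum, ← key]
    apply Finset.sum_congr rfl
    intro F hF
    have h1 : vectorSpan ℝ (f '' relin F) = (vectorSpan ℝ F).map f := by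
      rw [vectorSpan_image_lin, vectorSpan_relin (hcvx F (hJ F hF).1) ⟨_, hrel F (hJ F hF).1⟩]
    have h2 := finrank_map_of_mem f (vectorSpan ℝ F)
    rw [hker] at h2
    rw [h1]
    unfold sdim
    by_cases hFG : F = G
    · have h3 : (ℝ ∙ w) ⊓ vectorSpan ℝ F = ℝ ∙ w := by
        rw [inf_eq_left, Submodule.span_singleton_le_iff_mem, hFG]; exact hwG
      rw [h3, finrank_span_singleton hw0] at h2
      rw [← h2, pow_succ]
      simp [l, hFG]
    · have h3 : (ℝ ∙ w) ⊓ vectorSpan ℝ F = ⊥ := by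
        rw [Submodule.eq_bot_iff]
        rintro x ⟨hx1, hx2⟩
        obtain ⟨τ, rfl⟩ := Submodule.mem_span_singleton.mp hx1
        by_cases hτ : τ = 0
        · simp [hτ]
        · exact absurd ((Submodule.smul_mem_iff _ hτ).mp hx2) (hw F (hJ F hF).1 hFG)
      rw [h3, finrank_bot, add_zero] at h2
      rw [← h2]
      simp [l, hFG]
  · intro y
    rw [← Finset.add_sum_erase J _ hGJ]
    have hlG : l G = -1 := by simp [l]
    by_cases hy : y ∈ f '' relin G
    · obtain ⟨x, hx, rfl⟩ := hy
      rw [ind_of_mem (Set.mem_image_of_mem _ hx), hlG]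
      -- lowest point of the fiber
      have hcont : Continuous (fun τ : ℝ => x + τ • w) := by fun_prop
      have hTc : IsCompact ((fun τ : ℝ => x + τ • w) ⁻¹' G) := by
        apply Topology.IsClosedEmbedding.isCompact_preimage _ hG.isCompact
        have h1 := (isClosedEmbedding_smul_left hw0 : Topology.IsClosedEmbedding fun c : ℝ => c • w)
        exact (Homeomorph.addLeft x).isClosedEmbedding.comp h1
      obtain ⟨τ0, hτ0, hmin⟩ := hTc.exists_isLeast ⟨0, by simpa using hx.1⟩
      have hτneg : τ0 < 0 := by
        obtain ⟨δ, hδ, hm⟩ := relin_dir hG.convex hx (Submodule.neg_mem _ hwG)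
        have : -δ ∈ (fun τ : ℝ => x + τ • w) ⁻¹' G := by
          show x + (-δ) • w ∈ G
          rwa [neg_smul, ← smul_neg]
        have := hmin this
        linarith
      have haG : x + τ0 • w ∈ G := hτ0
      obtain ⟨F, hF, haF⟩ := exists_face_relin hG haG
      have hPa : Pnt (x + τ0 • w) G w := ⟨-τ0, by linarith, by
        rw [add_assoc, ← add_smul]; simpa using hx.1⟩
      have hPF : Pnt (relPt F) G w := hPa.relin (faces_subset hF) hG.convex haF.1 (hrel F hF)
      have hFG : F ≠ G := by
        rintro rfl
        obtain ⟨δ, hδ, hm⟩ := relin_dir hG.convex haF (Submodule.neg_mem _ hwG)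
        have : τ0 - δ ∈ (fun τ : ℝ => x + τ • w) ⁻¹' F := by
          show x + (τ0 - δ) • w ∈ F
          convert hm using 1
          module
        have := hmin this
        linarith
      have hFJ : F ∈ J.erase G := Finset.mem_erase.mpr ⟨hFG, Finset.mem_filter.mpr
        ⟨(mem_fcs hG).mpr hF, hPF⟩⟩
      rw [Finset.sum_eq_single_of_mem F hFJ]
      · rw [ind_of_mem]
        · simp [l, hFG]
        · exact ⟨_, haF, ((hfw _ _).mpr ⟨τ0, rfl⟩).symm⟩
      · intro F2 hF2 hne
        rw [ind_of_not_mem, mul_zero]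
        rintro ⟨a2, ha2, hfa2⟩
        obtain ⟨hF2G, hF2J⟩ := Finset.mem_erase.mp hF2
        obtain ⟨hF2f, hP2⟩ := hJ F2 hF2J
        obtain ⟨τ2, rfl⟩ := (hfw x a2).mp hfa2.symm
        have hle : τ0 ≤ τ2 := hmin (faces_subset hF2f ha2.1)
        rcases hle.eq_or_lt with h | h
        · subst h
          exact hne (relin_face_unique hF2f hF ha2 haF)
        · obtain ⟨ε, hε, hm⟩ := hP2.relin (faces_subset hF2f) hG.convex (hrel F2 hF2f).1 ha2
          refine hw F2 hF2f hF2G (span_of_seg hF2f ha2.1 hε (sub_pos.mpr h) hm ?_)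
          convert haG using 1
          module
    · rw [ind_of_not_mem hy, mul_zero, zero_add]
      apply Finset.sum_eq_zero
      intro F hF
      rw [ind_of_not_mem, mul_zero]
      rintro ⟨a, ha, rfl⟩
      obtain ⟨hFG, hFJ⟩ := Finset.mem_erase.mp hF
      obtain ⟨hFf, hP⟩ := hJ F hFJ
      obtain ⟨ε, hε, hm⟩ := hP.relin (faces_subset hFf) hG.convex (hrel F hFf).1 ha
      have haG := faces_subset hFf ha.1
      have hmid : a + (ε / 2) • w ∈ G := by
        have := hG.convex haG hm (a := 1/2) (b := 1/2) (by norm_num) (by norm_num) (by norm_num)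
        convert this using 1
        module
      obtain ⟨K, hK, hmK⟩ := exists_face_relin hG hmid
      have hwK : w ∈ vectorSpan ℝ K := by
        refine span_of_seg hK hmK.1 (half_pos hε) (half_pos hε) ?_ ?_
        · convert hm using 1
          module
        · convert haG using 1
          module
      have hKG : K = G := by
        by_contra hne
        exact hw K hK hne hwK
      subst hKG
      exact hy ⟨_, hmK, ((hfw _ _).mpr ⟨ε / 2, rfl⟩).symm⟩

end angles
end GramAngles

namespace GramAngles

section gram
variable {d : ℕ}

lemma relin_image {F : Set (Euc d)} {q : Euc d} (hq : q ∈ relin F) (p : Euc d →ₗ[ℝ] Euc d) :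
    p q ∈ relin (p '' F) := by
  refine ⟨⟨q, hq.1, rfl⟩, ?_⟩
  rintro _ ⟨y, hy, rfl⟩
  obtain ⟨ε, hε, h⟩ := hq.2 y hy
  exact ⟨ε, hε, _, h, by simp⟩

open Classical in
theorem gram_L0 (α : ConeAngle d) {G : Set (Euc d)} (hG : IsPolytope G) (L0 : Submodule ℝ (Euc d))
    (hL0 : L0 < vectorSpan ℝ G) (h : ∀ c ∈ L0ᗮ, L0 ≤ vectorSpan ℝ (maxFace G c)) :
    ∑ F ∈ (fcs G).filter (fun F => L0 ≤ vectorSpan ℝ F), (-1 : ℝ) ^ sdim F * intAngle α F G = 0 := by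
  let p : Euc d →ₗ[ℝ] Euc d := (L0ᗮ.starProjection).toLinearMap
  have hker : ∀ x, p x = 0 ↔ x ∈ L0 := by
    intro x
    show L0ᗮ.starProjection x = 0 ↔ _
    rw [Submodule.starProjection_apply_eq_zero_iff, Submodule.orthogonal_orthogonal]
  have hker' : LinearMap.ker p = L0 := by ext x; rw [LinearMap.mem_ker, hker]
  have hpm : ∀ x, p x ∈ L0ᗮ := fun x => Submodule.starProjection_apply_mem _ x
  have hpid : ∀ x ∈ L0ᗮ, p x = x := fun x hx => Submodule.starProjection_eq_self_iff.mpr hx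
  have hsub : ∀ x, x - p x ∈ L0 := fun x => by rw [← hker, map_sub, hpid _ (hpm x), sub_self]
  have hinner : ∀ c ∈ L0ᗮ, ∀ x, ⟪c, p x⟫_ℝ = ⟪c, x⟫_ℝ := by
    intro c hc x
    have := (Submodule.mem_orthogonal' _ _).mp hc _ (hsub x)
    rw [inner_sub_right] at this
    linarith
  have hinner2 : ∀ c x, ⟪p c, p x⟫_ℝ = ⟪c, p x⟫_ℝ := by
    intro c x
    rw [real_inner_comm, hinner _ (hpm x), real_inner_comm]
  let G' := p '' G
  have hG' : IsPolytope G' := by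
    obtain ⟨s, hs, hGs⟩ := id hG
    refine ⟨s.image p, hs.image _, ?_⟩
    show p '' G = _
    rw [hGs, p.image_convexHull, Finset.coe_image]
  -- structure of relevant faces
  have hface : ∀ F ∈ faces G, L0 ≤ vectorSpan ℝ F → ∃ c ∈ L0ᗮ, F = maxFace G c := by
    intro F hF hL
    obtain ⟨c, rfl⟩ := exists_maxFace_of_faces hF
    refine ⟨c, ?_, rfl⟩
    rw [Submodule.mem_orthogonal']
    intro l hl
    exact inner_maxFace_span (hL hl)
  have himg : ∀ c ∈ L0ᗮ, p '' maxFace G c = maxFace G' c := by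
    intro c hc
    ext y
    constructor
    · rintro ⟨x, hx, rfl⟩
      refine ⟨⟨x, hx.1, rfl⟩, ?_⟩
      rintro _ ⟨z, hz, rfl⟩
      rw [hinner c hc, hinner c hc]
      exact hx.2 z hz
    · rintro ⟨⟨x, hx, rfl⟩, hmax⟩
      refine ⟨x, ⟨hx, fun z hz => ?_⟩, rfl⟩
      have := hmax _ ⟨z, hz, rfl⟩
      rwa [hinner c hc, hinner c hc] at this
  have hspanimg : ∀ F : Set (Euc d), vectorSpan ℝ (p '' F) = (vectorSpan ℝ F).map p :=
    fun F => vectorSpan_image_lin F p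
  have hdim : ∀ F : Set (Euc d), L0 ≤ vectorSpan ℝ F →
      sdim (p '' F) + Module.finrank ℝ L0 = sdim F := by
    intro F hF
    have := finrank_map_of_mem p (vectorSpan ℝ F)
    rw [hker', inf_eq_left.mpr hF] at this
    unfold sdim
    rw [hspanimg, this]
  -- generic vectors
  have hLG' : ∀ a ∈ vectorSpan ℝ G', a ∈ L0ᗮ ∧ a ∈ vectorSpan ℝ G := by
    intro a ha
    rw [hspanimg] at ha
    obtain ⟨x, hx, rfl⟩ := ha
    refine ⟨hpm x, ?_⟩
    have := (vectorSpan ℝ G).sub_mem hx (hL0.le (hsub x))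
    rwa [sub_sub_cancel] at this
  have hex : ∀ F : Set (Euc d), ∃ a : Euc d, F ∈ faces G' → F ≠ G' →
      a ≠ 0 ∧ a ∈ vectorSpan ℝ G' ∧ a ∈ (vectorSpan ℝ F)ᗮ := by
    intro F
    by_cases hF : F ∈ faces G' ∧ F ≠ G'
    · have hlt : vectorSpan ℝ F < vectorSpan ℝ G' := by
        refine lt_of_le_of_ne (vectorSpan_mono ℝ (faces_subset hF.1)) ?_
        intro he
        exact hF.2 (face_eq_of_span hF.1 (le_refl _) (faces_subset hF.1) he.ge)
      obtain ⟨x, hx, hxn⟩ := SetLike.exists_of_lt hlt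
      refine ⟨x - (vectorSpan ℝ F).starProjection x, fun _ _ => ⟨?_, ?_, ?_⟩⟩
      · intro h0
        apply hxn
        rw [sub_eq_zero.mp h0]
        exact Submodule.starProjection_apply_mem _ x
      · exact Submodule.sub_mem _ hx (hlt.le (Submodule.starProjection_apply_mem _ x))
      · exact Submodule.sub_starProjection_mem_orthogonal x
    · exact ⟨0, fun h1 h2 => absurd ⟨h1, h2⟩ hF⟩
  choose a ha using hex
  obtain ⟨a0, ha0, ha0n⟩ : ∃ a0 ∈ vectorSpan ℝ G', a0 ≠ 0 := by
    obtain ⟨x, hx, hxn⟩ := SetLike.exists_of_lt hL0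
    refine ⟨p x, by rw [hspanimg]; exact ⟨x, hx, rfl⟩, ?_⟩
    intro h0
    exact hxn ((hker x).mp h0)
  let N : Finset (Euc d) := insert a0 ((((fcs G').erase G').image a))
  have key := master α ((fcs G).filter (fun F => L0 ≤ vectorSpan ℝ F)) (fun F => innerCone F G)
    (fun F hF => by
      have hFf := (mem_fcs hG).mp (Finset.mem_filter.mp hF).1
      exact innerCone_isH hG (hG.face hFf).convex hFf.2 (faces_subset hFf))
    (fun F => (-1 : ℝ) ^ sdim F) 0 N ?_ ?_
  · exact key
  · intro v hv
    rcases Finset.mem_insert.mp hv with rfl | hv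
    · exact ha0n
    · obtain ⟨F, hF, rfl⟩ := Finset.mem_image.mp hv
      obtain ⟨h1, h2⟩ := Finset.mem_erase.mp hF
      exact (ha F ((mem_fcs hG').mp h2) h1).1
  intro u hu
  set w' := (vectorSpan ℝ G).starProjection u with hw'
  set w := p w' with hwdef
  have hw'G : w' ∈ vectorSpan ℝ G := Submodule.starProjection_apply_mem _ u
  have hwG : w ∈ vectorSpan ℝ G' := by rw [hspanimg]; exact ⟨w', hw'G, rfl⟩
  have hinw : ∀ b ∈ vectorSpan ℝ G', ⟪b, w⟫_ℝ = ⟪b, u⟫_ℝ := by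
    intro b hb
    obtain ⟨hb1, hb2⟩ := hLG' b hb
    rw [hwdef, hinner b hb1]
    have := (Submodule.mem_orthogonal _ _).mp
      (Submodule.sub_starProjection_mem_orthogonal (K := vectorSpan ℝ G) u) b hb2
    rw [inner_sub_right] at this
    linarith
  have hgp := gram_pt hG' (w := w) ?_ hwG ?_
  · have hcorr : ∑ F ∈ (fcs G).filter (fun F => L0 ≤ vectorSpan ℝ F),
        (-1 : ℝ) ^ sdim F * ind (innerCone F G) u =
        ∑ F' ∈ fcs G', (-1 : ℝ) ^ (Module.finrank ℝ L0) *
          ((-1 : ℝ) ^ sdim F' * (if Pnt (relPt F') G' w then 1 else 0)) := by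
      apply Finset.sum_bij (fun F _ => p '' F)
      · intro F hF
        obtain ⟨hF1, hF2⟩ := Finset.mem_filter.mp hF
        obtain ⟨c, hc, rfl⟩ := hface F ((mem_fcs hG).mp hF1) hF2
        rw [himg c hc, mem_fcs hG']
        exact maxFace_mem_faces hG' c
      · intro F hF K hK he
        obtain ⟨hF1, hF2⟩ := Finset.mem_filter.mp hF
        obtain ⟨hK1, hK2⟩ := Finset.mem_filter.mp hK
        have haux : ∀ F ∈ faces G, L0 ≤ vectorSpan ℝ F → ∀ K ∈ faces G, L0 ≤ vectorSpan ℝ K →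
            p '' F = p '' K → F ⊆ K := by
          intro F hF hF2 K hK hK2 he x hx
          obtain ⟨c, hc, rfl⟩ := hface K hK hK2
          obtain ⟨y, hy, hyx⟩ : p x ∈ p '' maxFace G c := he ▸ ⟨x, hx, rfl⟩
          have e : ⟪c, x⟫_ℝ = ⟪c, y⟫_ℝ := by rw [← hinner c hc x, ← hyx, hinner c hc]
          exact ⟨faces_subset hF hx, fun z hz => by rw [e]; exact hy.2 z hz⟩
        have hF1 := (mem_fcs hG).mp hF1
        have hK1 := (mem_fcs hG).mp hK1
        exact Set.Subset.antisymm (haux F hF1 hF2 K hK1 hK2 he) (haux K hK1 hK2 F hF1 hF2 he.symm)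
      · intro F' hF'
        obtain ⟨c', rfl⟩ := exists_maxFace_of_faces ((mem_fcs hG').mp hF')
        refine ⟨maxFace G (p c'), Finset.mem_filter.mpr ⟨(mem_fcs hG).mpr (maxFace_mem_faces hG _),
          h _ (hpm c')⟩, ?_⟩
        rw [himg _ (hpm c')]
        ext y
        constructor
        · rintro ⟨⟨x, hx, rfl⟩, hm⟩
          refine ⟨⟨x, hx, rfl⟩, ?_⟩
          rintro _ ⟨z, hz, rfl⟩
          have := hm _ ⟨z, hz, rfl⟩
          rwa [hinner2, hinner2] at this
        · rintro ⟨⟨x, hx, rfl⟩, hm⟩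
          refine ⟨⟨x, hx, rfl⟩, ?_⟩
          rintro _ ⟨z, hz, rfl⟩
          have := hm _ ⟨z, hz, rfl⟩
          rwa [hinner2, hinner2]
      · intro F hF
        obtain ⟨hF1, hF2⟩ := Finset.mem_filter.mp hF
        have hF1 := (mem_fcs hG).mp hF1
        have hFc := (hG.face hF1).convex
        have hFsub := faces_subset hF1
        have hq := relPt_mem hFc hF1.2
        have hq' := relPt_mem (hFc.linear_image p) (hF1.2.image p)
        have hpq := relin_image hq p
        have hsub' : p '' F ⊆ G' := Set.image_mono hFsub
        rw [← mul_assoc, ← pow_add, add_comm (Module.finrank ℝ L0), hdim F hF2]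
        congr 1
        have hiff : u ∈ innerCone F G ↔ Pnt (relPt (p '' F)) G' w := by
          rw [mem_innerCone hG.convex hFc hF1.2 hFsub, ← hw']
          have h1 : Pnt (relPt (p '' F)) G' w ↔ Pnt (p (relPt F)) G' w :=
            ⟨fun hh => hh.relin hsub' hG'.convex hq'.1 hpq, fun hh => hh.relin hsub' hG'.convex hpq.1 hq'⟩
          rw [h1]
          constructor
          · rintro ⟨ε, hε, hm⟩
            exact ⟨ε, hε, _, hm, by simp [hwdef]⟩
          · rintro ⟨ε, hε, z, hz, hzz⟩
            have hl : z - (relPt F + ε • w') ∈ L0 := by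
              rw [← hker, map_sub, hzz]; simp [hwdef]
            obtain ⟨δ, hδ, hm⟩ := relin_dir hFc hq (Submodule.neg_mem _ (hF2 hl))
            refine ⟨δ / (1 + δ) * ε, by positivity, ?_⟩
            have := hG.convex (hFsub hm) hz (a := 1 / (1 + δ)) (b := δ / (1 + δ)) (by positivity)
              (by positivity) (by field_simp)
            convert this using 1
            have h1 : (1 + δ) ≠ 0 := by positivity
            have h3 : (δ / (1 + δ)) = (1 / (1 + δ)) * δ := by ring
            have h4 : relPt F = (1 / (1 + δ)) • ((1 + δ) • relPt F) := by
              rw [smul_smul]; field_simp; simp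
            rw [h3]
            generalize relPt F = q at *
            nth_rewrite 1 [h4]
            module
        unfold ind
        by_cases hh : u ∈ innerCone F G
        · rw [if_pos hh, if_pos (hiff.mp hh)]
        · rw [if_neg hh, if_neg (fun h' => hh (hiff.mpr h'))]
    rw [hcorr, ← Finset.mul_sum, hgp, mul_zero]
  · intro h0
    apply hu a0 (Finset.mem_insert_self _ _)
    rw [← hinw a0 ha0, h0, inner_zero_right]
  · intro F hF hne hmem
    obtain ⟨_, h2, h3⟩ := ha F hF hne
    apply hu (a F) (Finset.mem_insert_of_mem (Finset.mem_image_of_mem _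
      (Finset.mem_erase.mpr ⟨hne, (mem_fcs hG').mpr hF⟩)))
    rw [← hinw _ h2]
    exact (Submodule.mem_orthogonal' _ _).mp h3 w hmem

theorem gram (α : ConeAngle d) {G : Set (Euc d)} (hG : IsPolytope G) (hd : 0 < sdim G) :
    ∑ F ∈ fcs G, (-1 : ℝ) ^ sdim F * intAngle α F G = 0 := by
  classical
  have := gram_L0 α hG ⊥ ?_ (fun c _ => bot_le)
  · simpa using this
  · rw [bot_lt_iff_ne_bot]
    intro h
    unfold sdim at hd
    rw [h, finrank_bot] at hd
    exact lt_irrefl _ hd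

lemma intAngle_self (α : ConeAngle d) {G : Set (Euc d)} (hG : IsPolytope G) : intAngle α G G = 1 := by
  unfold intAngle
  rw [← α.norm']
  congr 1
  ext u
  rw [mem_innerCone hG.convex hG.convex hG.nonempty (le_refl _)]
  simp only [Set.mem_univ, iff_true]
  exact relin_dir hG.convex (relPt_mem hG.convex hG.nonempty) (Submodule.starProjection_apply_mem _ u)

end gram
end GramAngles

namespace GramAngles

/-! ### Flag recursion -/
section flag
variable {d : ℕ}

/-- flag sums for a general angle function -/
def flag (ang : Set (Euc d) → Set (Euc d) → ℝ) (P : Set (Euc d)) (S : Finset ℕ) : ℝ :=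
  ∑ᶠ l ∈ faceChains P S, (List.zipWith ang l (l.drop 1 ++ [P])).prod

lemma intFlag_eq (α : ConeAngle d) (P : Set (Euc d)) (S : Finset ℕ) :
    intFlag α P S = flag (intAngle α) P S := rfl
lemma extFlag_eq (α : ConeAngle d) (P : Set (Euc d)) (S : Finset ℕ) :
    extFlag α P S = flag (extAngle α) P S := rfl

lemma faceChains_empty (P : Set (Euc d)) : faceChains P ∅ = {[]} := by
  ext l
  simp only [faceChains, Finset.sort_empty, List.map_eq_nil_iff, Set.mem_ofPred_eq,
    Set.mem_singleton_iff]
  constructor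
  · rintro ⟨_, _, h⟩; exact h
  · rintro rfl
    exact ⟨by simp, List.IsChain.nil, rfl⟩

lemma flag_empty (ang : Set (Euc d) → Set (Euc d) → ℝ) (P : Set (Euc d)) : flag ang P ∅ = 1 := by
  unfold flag
  rw [faceChains_empty, finsum_mem_singleton]
  simp

lemma sort_insert_max {t : ℕ} {S : Finset ℕ} (h : ∀ s ∈ S, s < t) :
    (insert t S).sort (· ≤ ·) = S.sort (· ≤ ·) ++ [t] := by
  have ht : t ∉ S := fun hh => lt_irrefl _ (h t hh)
  apply List.Perm.eq_of_pairwise' (r := (· ≤ ·))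
  · exact Finset.pairwise_sort _ _
  · rw [List.pairwise_append]
    refine ⟨Finset.pairwise_sort _ _, List.pairwise_singleton _ _, ?_⟩
    intro a ha b hb
    rw [List.mem_singleton] at hb
    subst hb
    exact (h a ((Finset.mem_sort _).mp ha)).le
  · rw [← Multiset.coe_eq_coe, Finset.sort_eq, ← Multiset.coe_add, Finset.sort_eq,
      Finset.insert_val_of_notMem ht, ← Multiset.singleton_add, add_comm]
    rfl

lemma mem_faceChains {P : Set (Euc d)} {S : Finset ℕ} {l : List (Set (Euc d))} :
    l ∈ faceChains P S ↔ (∀ F ∈ l, F ∈ faces P) ∧ l.Pairwise (· ⊂ ·) ∧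
      l.map sdim = S.sort (· ≤ ·) := by
  unfold faceChains faces
  rw [← List.isChain_iff_pairwise]
  rfl

open Classical in
lemma faceChains_insert {G : Set (Euc d)} (hG : IsPolytope G) {t : ℕ} {S : Finset ℕ}
    (h : ∀ s ∈ S, s < t) :
    faceChains G (insert t S) = ⋃ F ∈ (((fcs G).filter (fun F => sdim F = t) : Finset _) : Set (Set (Euc d))),
      (fun l => l ++ [F]) '' faceChains F S := by
  ext l
  simp only [Set.mem_iUnion, Finset.coe_filter, Set.mem_ofPred_eq, Set.mem_image, exists_prop]
  constructor
  · intro hl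
    obtain ⟨h1, h2, h3⟩ := mem_faceChains.mp hl
    rw [sort_insert_max h, List.map_eq_append_iff] at h3
    obtain ⟨l1, l2, rfl, h4, h5⟩ := h3
    obtain ⟨F, l3, rfl, h6, h7⟩ := List.map_eq_cons_iff.mp h5
    rw [List.map_eq_nil_iff] at h7
    subst h7
    have hF : F ∈ faces G := h1 F (by simp)
    rw [List.pairwise_append] at h2
    refine ⟨F, ⟨(mem_fcs hG).mpr hF, h6⟩, l1, mem_faceChains.mpr ⟨?_, h2.1, h4⟩, rfl⟩
    intro K hK
    exact face_mono hF (h1 K (by simp [hK])) (h2.2.2 K hK F (by simp)).subset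
  · rintro ⟨F, ⟨hF, hFt⟩, l1, hl1, rfl⟩
    have hF := (mem_fcs hG).mp hF
    obtain ⟨h1, h2, h3⟩ := mem_faceChains.mp hl1
    refine mem_faceChains.mpr ⟨?_, ?_, ?_⟩
    · intro K hK
      rcases List.mem_append.mp hK with hK | hK
      · exact face_trans hG hF (h1 K hK)
      · rw [List.mem_singleton] at hK
        subst hK; exact hF
    · rw [List.pairwise_append]
      refine ⟨h2, List.pairwise_singleton _ _, ?_⟩
      intro K hK F' hF'
      rw [List.mem_singleton] at hF'
      subst hF'
      refine ssubset_of_subset_of_ne (faces_subset (h1 K hK)) ?_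
      rintro rfl
      have : sdim K ∈ l1.map sdim := List.mem_map_of_mem hK
      rw [h3, Finset.mem_sort] at this
      have := h _ this
      omega
    · rw [sort_insert_max h, List.map_append, h3]
      simp [hFt]

lemma faceChains_finite (S : Finset ℕ) : ∀ {G : Set (Euc d)} (_ : IsPolytope G),
    (faceChains G S).Finite := by
  classical
  induction S using Finset.induction_on_max with
  | empty => intro G _; rw [faceChains_empty]; exact Set.finite_singleton _
  | insert t S ht ih =>
    intro G hG
    rw [faceChains_insert hG ht]
    apply Set.Finite.biUnion (Finset.finite_toSet _)
    intro F hF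
    exact (ih (hG.face ((mem_fcs hG).mp (Finset.mem_filter.mp hF).1))).image _

open Classical in
lemma flag_insert (ang : Set (Euc d) → Set (Euc d) → ℝ) {G : Set (Euc d)} (hG : IsPolytope G)
    {t : ℕ} {S : Finset ℕ} (h : ∀ s ∈ S, s < t) :
    flag ang G (insert t S) = ∑ F ∈ (fcs G).filter (fun F => sdim F = t), ang F G * flag ang F S := by
  unfold flag
  rw [faceChains_insert hG h, finsum_mem_biUnion, finsum_mem_coe_finset]
  · apply Finset.sum_congr rfl
    intro F hF
    rw [finsum_mem_image, mul_finsum_mem]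
    · apply finsum_congr
      intro l
      apply finsum_congr
      intro _
      rcases l with _ | ⟨a, l⟩
      · simp
      · have : (a :: l ++ [F]).drop 1 ++ [G] = ((a :: l).drop 1 ++ [F]) ++ [G] := by simp
        rw [this, List.zipWith_append (by simp), List.prod_append, mul_comm]
        simp
    · intro l1 _ l2 _ he
      simpa using he
  · intro F _ K _ hne
    rw [Function.onFun, Set.disjoint_left]
    rintro _ ⟨l1, _, rfl⟩ ⟨l2, _, he⟩
    apply hne
    have := (List.append_inj' he rfl).2
    simpa using this.symm
  · exact Finset.finite_toSet _
  · intro F hF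
    exact (faceChains_finite S (hG.face ((mem_fcs hG).mp (Finset.mem_filter.mp hF).1))).image _

theorem ext_rel (α : ConeAngle d) (S : Finset ℕ) : ∀ {G : Set (Euc d)} (_ : IsPolytope G)
    (_ : ∀ s ∈ S, 1 ≤ s), extFlag α G (insert 0 S) = extFlag α G S := by
  classical
  simp only [extFlag_eq]
  induction S using Finset.induction_on_max with
  | empty =>
    intro G hG _
    rw [flag_insert _ hG (by simp), flag_empty]
    simp only [flag_empty, mul_one]
    exact ext_vertices α hG
  | insert t S ht ih =>
    intro G hG hS
    have ht1 := hS t (Finset.mem_insert_self _ _)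
    rw [Finset.insert_comm, flag_insert _ hG ht, flag_insert _ hG]
    · apply Finset.sum_congr rfl
      intro F hF
      rw [ih (hG.face ((mem_fcs hG).mp (Finset.mem_filter.mp hF).1))
        (fun s hs => hS s (Finset.mem_insert_of_mem hs))]
    · intro s hs
      rcases Finset.mem_insert.mp hs with rfl | hs
      · omega
      · exact ht s hs

theorem int_rel (α : ConeAngle d) (S : Finset ℕ) : ∀ {G : Set (Euc d)} (_ : IsPolytope G)
    (_ : 0 < sdim G) (_ : ∀ s ∈ S, 1 ≤ s ∧ s < sdim G) (t : ℕ)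
    (_ : t = (insert (sdim G) S).min' (Finset.insert_nonempty _ _)),
    ∑ i ∈ Finset.range t, (-1 : ℝ) ^ i * intFlag α G (insert i S) = (-1) ^ (t + 1) * intFlag α G S := by
  classical
  simp only [intFlag_eq]
  induction S using Finset.induction_on_max with
  | empty =>
    intro G hG hpos _ t ht
    have ht : t = sdim G := by rw [ht]; simp
    subst ht
    have hgram := gram α hG hpos
    have h1 : ∀ i ∈ Finset.range (sdim G), (-1 : ℝ) ^ i * flag (intAngle α) G (insert i ∅) =
        ∑ F ∈ ((fcs G).erase G).filter (fun F => sdim F = i), (-1 : ℝ) ^ sdim F * intAngle α F G := by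
      intro i hi
      rw [flag_insert _ hG (by simp), Finset.mul_sum]
      simp only [flag_empty, mul_one]
      have : ((fcs G).erase G).filter (fun F => sdim F = i) = (fcs G).filter (fun F => sdim F = i) := by
        ext F
        simp only [Finset.mem_filter, Finset.mem_erase]
        constructor
        · rintro ⟨⟨_, h⟩, h'⟩; exact ⟨h, h'⟩
        · rintro ⟨h, h'⟩
          refine ⟨⟨?_, h⟩, h'⟩
          rintro rfl
          have := Finset.mem_range.mp hi
          omega
      rw [this]
      apply Finset.sum_congr rfl
      intro F hF
      rw [(Finset.mem_filter.mp hF).2]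
    rw [Finset.sum_congr rfl h1, Finset.sum_fiberwise_of_maps_to]
    · rw [← Finset.add_sum_erase _ _ ((mem_fcs hG).mpr (self_mem_faces hG)), intAngle_self α hG] at hgram
      rw [flag_empty, pow_succ]
      linarith
    · intro F hF
      obtain ⟨hne, hF⟩ := Finset.mem_erase.mp hF
      have hF := (mem_fcs hG).mp hF
      rw [Finset.mem_range]
      exact face_sdim_lt hF (le_refl _) (ssubset_of_subset_of_ne (faces_subset hF) hne)
  | insert m S hm ih =>
    intro G hG hpos hS t ht
    obtain ⟨hm1, hmG⟩ := hS m (Finset.mem_insert_self _ _)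
    have ht' : t = (insert m S).min' (Finset.insert_nonempty _ _) := by
      rw [ht]
      apply le_antisymm
      · apply Finset.le_min'
        intro y hy
        exact Finset.min'_le _ _ (Finset.mem_insert_of_mem hy)
      · apply Finset.le_min'
        intro y hy
        rcases Finset.mem_insert.mp hy with rfl | hy
        · exact (Finset.min'_le _ m (Finset.mem_insert_self _ _)).trans hmG.le
        · exact Finset.min'_le _ _ hy
    have htm : t ≤ m := by rw [ht']; exact Finset.min'_le _ m (Finset.mem_insert_self _ _)
    rw [flag_insert _ hG hm, Finset.mul_sum]
    have h1 : ∀ i ∈ Finset.range t, (-1 : ℝ) ^ i * flag (intAngle α) G (insert i (insert m S)) =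
        ∑ F ∈ (fcs G).filter (fun F => sdim F = m),
          (-1 : ℝ) ^ i * (intAngle α F G * flag (intAngle α) F (insert i S)) := by
      intro i hi
      rw [Finset.insert_comm, flag_insert _ hG, Finset.mul_sum]
      intro s hs
      have := Finset.mem_range.mp hi
      rcases Finset.mem_insert.mp hs with rfl | hs
      · omega
      · exact hm s hs
    rw [Finset.sum_congr rfl h1, Finset.sum_comm]
    apply Finset.sum_congr rfl
    intro F hF
    obtain ⟨hF1, hF2⟩ := Finset.mem_filter.mp hF
    have := ih (hG.face ((mem_fcs hG).mp hF1)) (by omega) (fun s hs => ⟨(hS s (Finset.mem_insert_of_mem hs)).1,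
      by rw [hF2]; exact hm s hs⟩) t (by rw [ht']; congr 2; exact hF2.symm)
    rw [mul_left_comm, ← this, Finset.mul_sum]
    apply Finset.sum_congr rfl
    intro i _
    ring

end flag
end GramAngles

namespace GramAngles

/-! ### Flats of vector configurations and flag Whitney numbers -/
section flats
variable {d : ℕ}

/-- linear span of a finite set -/
def sp (V : Finset (Euc d)) : Submodule ℝ (Euc d) := Submodule.span ℝ (V : Set (Euc d))

open Classical in
/-- flats of a configuration: spans of subsets -/
def Fl (V : Finset (Euc d)) : Finset (Submodule ℝ (Euc d)) := V.powerset.image sp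

lemma mem_Fl {V : Finset (Euc d)} {L : Submodule ℝ (Euc d)} : L ∈ Fl V ↔ ∃ U ⊆ V, L = sp U := by
  classical
  simp only [Fl, Finset.mem_image, Finset.mem_powerset]
  constructor
  · rintro ⟨U, hU, rfl⟩; exact ⟨U, hU, rfl⟩
  · rintro ⟨U, hU, rfl⟩; exact ⟨U, hU, rfl⟩

lemma sp_mono {U V : Finset (Euc d)} (h : U ⊆ V) : sp U ≤ sp V :=
  Submodule.span_mono (Finset.coe_subset.mpr h)

lemma mem_sp {V : Finset (Euc d)} {v : Euc d} (h : v ∈ V) : v ∈ sp V :=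
  Submodule.subset_span (Finset.mem_coe.mpr h)

lemma sp_union [DecidableEq (Euc d)] (U V : Finset (Euc d)) : sp (U ∪ V) = sp U ⊔ sp V := by
  unfold sp; rw [Finset.coe_union, Submodule.span_union]

lemma sp_insert [DecidableEq (Euc d)] (v : Euc d) (V : Finset (Euc d)) :
    sp (insert v V) = sp V ⊔ (ℝ ∙ v) := by
  unfold sp; rw [Finset.coe_insert, Submodule.span_insert, sup_comm]

lemma sp_mem_Fl (V : Finset (Euc d)) : sp V ∈ Fl V := mem_Fl.mpr ⟨V, le_refl _, rfl⟩

lemma bot_mem_Fl (V : Finset (Euc d)) : ⊥ ∈ Fl V := mem_Fl.mpr ⟨∅, by simp, by simp [sp]⟩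

lemma Fl_le {V : Finset (Euc d)} {L : Submodule ℝ (Euc d)} (h : L ∈ Fl V) : L ≤ sp V := by
  obtain ⟨U, hU, rfl⟩ := mem_Fl.mp h
  exact sp_mono hU

lemma sup_mem_Fl {V : Finset (Euc d)} {K L : Submodule ℝ (Euc d)} (hK : K ∈ Fl V) (hL : L ∈ Fl V) :
    K ⊔ L ∈ Fl V := by
  classical
  obtain ⟨U, hU, rfl⟩ := mem_Fl.mp hK
  obtain ⟨U', hU', rfl⟩ := mem_Fl.mp hL
  exact mem_Fl.mpr ⟨U ∪ U', Finset.union_subset hU hU', (sp_union _ _).symm⟩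

open Classical in
/-- chains of flats below `M` with prescribed (descending) dimensions -/
def WL (V : Finset (Euc d)) : List ℕ → Submodule ℝ (Euc d) → ℝ
  | [], _ => 1
  | t :: l, M => ∑ L ∈ (Fl V).filter (fun L => L ≤ M ∧ Module.finrank ℝ L = t), WL V l L

/-- flag Whitney numbers (of the second kind) below `M` -/
def Wh (V : Finset (Euc d)) (M : Submodule ℝ (Euc d)) (S : Finset ℕ) : ℝ :=
  WL V (S.sort (· ≥ ·)) M

lemma Wh_empty (V : Finset (Euc d)) (M : Submodule ℝ (Euc d)) : Wh V M ∅ = 1 := by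
  unfold Wh; rw [Finset.sort_empty]; rfl

open Classical in
lemma Wh_insert (V : Finset (Euc d)) (M : Submodule ℝ (Euc d)) {t : ℕ} {S : Finset ℕ}
    (h : ∀ s ∈ S, s < t) :
    Wh V M (insert t S) = ∑ L ∈ (Fl V).filter (fun L => L ≤ M ∧ Module.finrank ℝ L = t), Wh V L S := by
  unfold Wh
  rw [Finset.sort_insert (· ≥ ·) (fun b hb => (h b hb).le) (fun hh => lt_irrefl _ (h t hh))]
  rfl

lemma Wh_congr (S : Finset ℕ) : ∀ {V V' : Finset (Euc d)} {M : Submodule ℝ (Euc d)}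
    (_ : ∀ K ≤ M, K ∈ Fl V ↔ K ∈ Fl V'), Wh V M S = Wh V' M S := by
  classical
  induction S using Finset.induction_on_max with
  | empty => intro V V' M _; rw [Wh_empty, Wh_empty]
  | insert t S ht ih =>
    intro V V' M h
    rw [Wh_insert V M ht, Wh_insert V' M ht]
    apply Finset.sum_congr
    · ext L
      simp only [Finset.mem_filter]
      constructor
      · rintro ⟨h1, h2, h3⟩; exact ⟨(h L h2).mp h1, h2, h3⟩
      · rintro ⟨h1, h2, h3⟩; exact ⟨(h L h2).mpr h1, h2, h3⟩
    · intro L hL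
      exact ih (fun K hK => h K (hK.trans (Finset.mem_filter.mp hL).2.1))

lemma Wh_top {V : Finset (Euc d)} {M : Submodule ℝ (Euc d)} (hM : M ∈ Fl V) {t : ℕ} {S : Finset ℕ}
    (h : ∀ s ∈ S, s < t) (ht : Module.finrank ℝ M = t) : Wh V M (insert t S) = Wh V M S := by
  classical
  rw [Wh_insert V M h]
  have : (Fl V).filter (fun L => L ≤ M ∧ Module.finrank ℝ L = t) = {M} := by
    ext L
    simp only [Finset.mem_filter, Finset.mem_singleton]
    constructor
    · rintro ⟨_, h2, h3⟩
      exact Submodule.eq_of_le_of_finrank_le h2 (by omega)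
    · rintro rfl; exact ⟨hM, le_refl _, ht⟩
  rw [this, Finset.sum_singleton]

lemma Wh_zero {V : Finset (Euc d)} {M : Submodule ℝ (Euc d)} {t : ℕ} {S : Finset ℕ} (htS : t ∈ S)
    (ht : Module.finrank ℝ M < t) : Wh V M S = 0 := by
  classical
  induction S using Finset.induction_on_max with
  | empty => simp at htS
  | insert m S hm ih =>
    rw [Wh_insert V M hm]
    have htm : t ≤ m := by
      rcases Finset.mem_insert.mp htS with rfl | h
      · exact le_rfl
      · exact (hm t h).le
    apply Finset.sum_eq_zero_iff_of_nonneg _ |>.mpr _ <;> intro L hL <;> exfalso <;>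
    · obtain ⟨_, h2, h3⟩ := Finset.mem_filter.mp hL
      have := Submodule.finrank_mono h2
      omega

open Classical in
/-- weak insertion -/
lemma Wh_weak (V : Finset (Euc d)) (M : Submodule ℝ (Euc d)) {u : ℕ} {S : Finset ℕ}
    (h : ∀ s ∈ S, 1 ≤ s ∧ s ≤ u) :
    ∑ L ∈ (Fl V).filter (fun L => L ≤ M ∧ Module.finrank ℝ L = u), Wh V L S =
      Wh V M ((insert u S).erase 0) := by
  have hS0 : (0 : ℕ) ∉ S := fun hh => by have := (h 0 hh).1; omega
  rcases Nat.eq_zero_or_pos u with rfl | hu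
  · have hSe : S = ∅ := by
      rw [Finset.eq_empty_iff_forall_notMem]
      intro s hs; have := h s hs; omega
    subst hSe
    have : (Fl V).filter (fun L => L ≤ M ∧ Module.finrank ℝ L = 0) = {⊥} := by
      ext L
      simp only [Finset.mem_filter, Finset.mem_singleton, Submodule.finrank_eq_zero]
      constructor
      · rintro ⟨_, _, h⟩; exact h
      · rintro rfl; exact ⟨bot_mem_Fl V, bot_le, rfl⟩
    rw [this, Finset.sum_singleton, Wh_empty]
    simp [Wh_empty]
  · have h0 : (insert u S).erase 0 = insert u S := by
      apply Finset.erase_eq_of_notMem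
      rw [Finset.mem_insert]; push Not
      exact ⟨by omega, hS0⟩
    rw [h0]
    by_cases huS : u ∈ S
    · have hlt : ∀ s ∈ S.erase u, s < u := fun s hs =>
        lt_of_le_of_ne (h s (Finset.mem_of_mem_erase hs)).2 (Finset.ne_of_mem_erase hs)
      have e : insert u S = insert u (S.erase u) := by
        rw [Finset.insert_erase huS, Finset.insert_eq_of_mem huS]
      rw [e, Wh_insert V M hlt]
      apply Finset.sum_congr rfl
      intro L hL
      obtain ⟨h1, _, h3⟩ := Finset.mem_filter.mp hL
      rw [← Wh_top h1 hlt h3, Finset.insert_erase huS]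
    · rw [Wh_insert V M]
      intro s hs
      exact lt_of_le_of_ne (h s hs).2 (fun hh => huS (hh ▸ hs))

/-- decrement the elements `≥ s` -/
def cut (s : ℕ) (S : Finset ℕ) : Finset ℕ := (S.image (fun x => if s ≤ x then x - 1 else x)).erase 0

lemma cut_subset {s m : ℕ} {S : Finset ℕ} (hS : S ⊆ Finset.Icc 1 m) (hs : s ∈ S) :
    cut s S ⊆ Finset.Icc 1 (m - 1) := by
  intro y hy
  unfold cut at hy
  obtain ⟨h0, hy⟩ := Finset.mem_erase.mp hy
  obtain ⟨x, hx, rfl⟩ := Finset.mem_image.mp hy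
  have h1 := Finset.mem_Icc.mp (hS hx)
  have h2 := Finset.mem_Icc.mp (hS hs)
  rw [Finset.mem_Icc]
  split_ifs at h0 ⊢ <;> omega

lemma cut_top {t : ℕ} {S : Finset ℕ} (h : ∀ s ∈ S, s < t) :
    cut t (insert t S) = (insert (t - 1) S).erase 0 := by
  unfold cut
  rw [Finset.image_insert, if_pos le_rfl]
  congr 2
  conv_rhs => rw [← Finset.image_id (s := S)]
  apply Finset.image_congr
  intro x hx
  have := h x hx
  simp only [id]
  rw [if_neg (by omega)]

lemma cut_insert {s t : ℕ} {S : Finset ℕ} (hs : s < t) :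
    cut s (insert t S) = (insert (t - 1) (cut s S)).erase 0 := by
  unfold cut
  rw [Finset.image_insert, if_pos hs.le]
  ext x
  simp only [Finset.mem_erase, Finset.mem_insert]
  tauto

lemma cut_sum_lt {s m : ℕ} {S : Finset ℕ} (hS : S ⊆ Finset.Icc 1 m) (hs : s ∈ S) :
    ∑ x ∈ cut s S, x < ∑ x ∈ S, x := by
  calc ∑ x ∈ cut s S, x ≤ ∑ x ∈ S.image (fun x => if s ≤ x then x - 1 else x), x :=
        Finset.sum_le_sum_of_subset (Finset.erase_subset _ _)
    _ ≤ ∑ x ∈ S, (if s ≤ x then x - 1 else x) :=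
        Finset.sum_image_le_of_nonneg (fun _ _ => Nat.zero_le _)
    _ < ∑ x ∈ S, x := by
        apply Finset.sum_lt_sum
        · intro x _; split_ifs <;> omega
        · refine ⟨s, hs, ?_⟩
          have := Finset.mem_Icc.mp (hS hs)
          rw [if_pos le_rfl]; omega

lemma finrank_sup_singleton {L : Submodule ℝ (Euc d)} {v : Euc d} (hv : v ∉ L) :
    Module.finrank ℝ (L ⊔ (ℝ ∙ v) : Submodule ℝ (Euc d)) = Module.finrank ℝ L + 1 := by
  have h := Submodule.finrank_sup_add_finrank_inf_eq L (ℝ ∙ v)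
  have h0 : L ⊓ (ℝ ∙ v) = ⊥ := by
    rw [Submodule.eq_bot_iff]
    rintro x ⟨hx1, hx2⟩
    obtain ⟨τ, rfl⟩ := Submodule.mem_span_singleton.mp hx2
    by_cases hτ : τ = 0
    · simp [hτ]
    · exact absurd ((Submodule.smul_mem_iff _ hτ).mp hx1) hv
  have hv0 : v ≠ 0 := by rintro rfl; exact hv L.zero_mem
  rw [h0, finrank_bot, finrank_span_singleton hv0] at h
  omega

/-- exchange: if `K ≤ L ⊔ ⟨v⟩` and `K` is not below `L` then `v ∈ K ⊔ L` -/
lemma exch {K L : Submodule ℝ (Euc d)} {v : Euc d} (h : K ≤ L ⊔ (ℝ ∙ v)) (hn : ¬ K ≤ L) :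
    v ∈ K ⊔ L := by
  obtain ⟨x, hx, hxL⟩ := SetLike.not_le_iff_exists.mp hn
  obtain ⟨y, hy, z, hz, rfl⟩ := Submodule.mem_sup.mp (h hx)
  obtain ⟨τ, rfl⟩ := Submodule.mem_span_singleton.mp hz
  have hτ : τ ≠ 0 := by rintro rfl; apply hxL; simpa using hy
  have : τ • v ∈ K ⊔ L := by
    have := (K ⊔ L).sub_mem (Submodule.mem_sup_left hx) (Submodule.mem_sup_right hy)
    rwa [add_sub_cancel_left] at this
  exact (Submodule.smul_mem_iff _ hτ).mp this

open Classical in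
lemma Fl_insert {V : Finset (Euc d)} {v : Euc d} {L : Submodule ℝ (Euc d)} :
    L ∈ Fl (insert v V) ↔ L ∈ Fl V ∨ ∃ K ∈ Fl V, L = K ⊔ (ℝ ∙ v) := by
  constructor
  · intro h
    obtain ⟨U, hU, rfl⟩ := mem_Fl.mp h
    by_cases hv : v ∈ U
    · right
      refine ⟨sp (U.erase v), mem_Fl.mpr ⟨_, ?_, rfl⟩, ?_⟩
      · intro x hx
        obtain ⟨h1, h2⟩ := Finset.mem_erase.mp hx
        exact (Finset.mem_insert.mp (hU h2)).resolve_left h1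
      · rw [← sp_insert, Finset.insert_erase hv]
    · left
      refine mem_Fl.mpr ⟨U, ?_, rfl⟩
      intro x hx
      exact (Finset.mem_insert.mp (hU hx)).resolve_left (fun hh => hv (hh ▸ hx))
  · rintro (h | ⟨K, hK, rfl⟩)
    · obtain ⟨U, hU, rfl⟩ := mem_Fl.mp h
      exact mem_Fl.mpr ⟨U, hU.trans (Finset.subset_insert _ _), rfl⟩
    · obtain ⟨U, hU, rfl⟩ := mem_Fl.mp hK
      exact mem_Fl.mpr ⟨insert v U, Finset.insert_subset_insert _ hU, (sp_insert _ _).symm⟩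

open Classical in
/-- the extension formula -/
theorem Wh_ext (S : Finset ℕ) : ∀ {V : Finset (Euc d)} {v : Euc d} {M N : Submodule ℝ (Euc d)} {k : ℕ}
    (_ : ∀ s ∈ S, 1 ≤ s ∧ s ≤ k) (_ : v ∈ N) (_ : M ≤ N)
    (_ : ∀ K ∈ Fl V, K ≤ N → Module.finrank ℝ K ≤ k → v ∉ K)
    (_ : ∀ K ∈ Fl V, K ≤ N → Module.finrank ℝ K ≤ k → K ≤ M),
    Wh (insert v V) N S = Wh V M S + ∑ s ∈ S, Wh V M (cut s S) := by
  induction S using Finset.induction_on_max with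
  | empty => intros; simp [Wh_empty]
  | insert t S ht ih =>
    intro V v M N k hS hvN hMN hgen hN
    obtain ⟨ht1, htk⟩ := hS t (Finset.mem_insert_self _ _)
    have htS : t ∉ S := fun hh => lt_irrefl _ (ht t hh)
    have hS1 : ∀ s ∈ S, 1 ≤ s := fun s hs => (hS s (Finset.mem_insert_of_mem hs)).1
    have hsplit : (Fl (insert v V)).filter (fun L => L ≤ N ∧ Module.finrank ℝ L = t) =
        (Fl V).filter (fun L => L ≤ M ∧ Module.finrank ℝ L = t) ∪
        ((Fl V).filter (fun L => L ≤ M ∧ Module.finrank ℝ L = t - 1)).image (fun L => L ⊔ (ℝ ∙ v)) := by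
      ext L
      simp only [Finset.mem_filter, Finset.mem_union, Finset.mem_image, Fl_insert]
      constructor
      · rintro ⟨h | ⟨K, hK, rfl⟩, h2, h3⟩
        · exact Or.inl ⟨h, hN L h h2 (by omega), h3⟩
        · right
          have hKN : K ≤ N := le_sup_left.trans h2
          have hKk : Module.finrank ℝ K ≤ k := by
            have := Submodule.finrank_mono (le_sup_left : K ≤ K ⊔ (ℝ ∙ v))
            omega
          have := finrank_sup_singleton (hgen K hK hKN hKk)
          exact ⟨K, ⟨hK, hN K hK hKN hKk, by omega⟩, rfl⟩
      · rintro (⟨h1, h2, h3⟩ | ⟨K, ⟨h1, h2, h3⟩, rfl⟩)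
        · exact ⟨Or.inl h1, h2.trans hMN, h3⟩
        · refine ⟨Or.inr ⟨K, h1, rfl⟩, sup_le (h2.trans hMN)
            ((Submodule.span_singleton_le_iff_mem _ _).mpr hvN), ?_⟩
          rw [finrank_sup_singleton (hgen K h1 (h2.trans hMN) (by omega))]
          omega
    have hdisj : Disjoint ((Fl V).filter (fun L => L ≤ M ∧ Module.finrank ℝ L = t))
        (((Fl V).filter (fun L => L ≤ M ∧ Module.finrank ℝ L = t - 1)).image (fun L => L ⊔ (ℝ ∙ v))) := by
      rw [Finset.disjoint_left]
      intro L hL hL2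
      obtain ⟨h1, h2, h3⟩ := Finset.mem_filter.mp hL
      obtain ⟨K, _, rfl⟩ := Finset.mem_image.mp hL2
      exact hgen _ h1 (h2.trans hMN) (by omega)
        (Submodule.mem_sup_right (Submodule.mem_span_singleton_self v))
    have hlow : ∀ L ∈ Fl V, L ≤ M → Module.finrank ℝ L = t - 1 → ∀ K ∈ Fl V, K ≤ L ⊔ (ℝ ∙ v) → K ≤ L := by
      intro L hL hLM hLt K hK hKL
      by_contra hn
      have hvL : v ∉ L := hgen L hL (hLM.trans hMN) (by omega)
      have hle : K ⊔ L ≤ L ⊔ (ℝ ∙ v) := sup_le hKL le_sup_left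
      refine hgen (K ⊔ L) (sup_mem_Fl hK hL) (hle.trans (sup_le (hLM.trans hMN)
        ((Submodule.span_singleton_le_iff_mem _ _).mpr hvN))) ?_ (exch hKL hn)
      have := Submodule.finrank_mono hle
      rw [finrank_sup_singleton hvL] at this
      omega
    have hinj : Set.InjOn (fun L => L ⊔ (ℝ ∙ v)) ((Fl V).filter (fun L => L ≤ M ∧ Module.finrank ℝ L = t - 1) : Finset _) := by
      intro L hL K hK he
      obtain ⟨h1, h2, h3⟩ := Finset.mem_filter.mp (Finset.mem_coe.mp hL)
      obtain ⟨k1, k2, k3⟩ := Finset.mem_filter.mp (Finset.mem_coe.mp hK)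
      have he : L ⊔ (ℝ ∙ v) = K ⊔ (ℝ ∙ v) := he
      exact le_antisymm (hlow K k1 k2 k3 L h1 (he ▸ le_sup_left)) (hlow L h1 h2 h3 K k1 (he ▸ le_sup_left))
    rw [Wh_insert _ _ ht, hsplit, Finset.sum_union hdisj, Finset.sum_image hinj, Wh_insert _ _ ht]
    congr 1
    · apply Finset.sum_congr rfl
      intro L hL
      obtain ⟨h1, h2, h3⟩ := Finset.mem_filter.mp hL
      apply Wh_congr
      intro K hK
      rw [Fl_insert]
      constructor
      · rintro (h | ⟨K', _, rfl⟩)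
        · exact h
        · exact absurd (hK (Submodule.mem_sup_right (Submodule.mem_span_singleton_self v)))
            (hgen L h1 (h2.trans hMN) (by omega))
      · exact Or.inl
    · have hrec : ∀ L ∈ (Fl V).filter (fun L => L ≤ M ∧ Module.finrank ℝ L = t - 1),
          Wh (insert v V) (L ⊔ (ℝ ∙ v)) S = Wh V L S + ∑ s ∈ S, Wh V L (cut s S) := by
        intro L hL
        obtain ⟨h1, h2, h3⟩ := Finset.mem_filter.mp hL
        have hle : L ⊔ (ℝ ∙ v) ≤ N := sup_le (h2.trans hMN)
          ((Submodule.span_singleton_le_iff_mem _ _).mpr hvN)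
        apply ih (k := k) (fun s hs => hS s (Finset.mem_insert_of_mem hs))
          (Submodule.mem_sup_right (Submodule.mem_span_singleton_self v)) le_sup_left
        · intro K hK hKL hKk
          exact hgen K hK (hKL.trans hle) hKk
        · intro K hK hKL _
          exact hlow L h1 h2 h3 K hK hKL
      rw [Finset.sum_congr rfl hrec, Finset.sum_add_distrib, Finset.sum_comm, Finset.sum_insert htS,
        cut_top ht, Wh_weak V M (fun s hs => ⟨hS1 s hs, by have := ht s hs; omega⟩)]
      congr 1
      apply Finset.sum_congr rfl
      intro s hs
      rw [cut_insert (ht s hs), Wh_weak]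
      have hsub : S ⊆ Finset.Icc 1 (t - 1) := fun x hx => Finset.mem_Icc.mpr
        ⟨hS1 x hx, by have := ht x hx; omega⟩
      intro x hx
      have := Finset.mem_Icc.mp (cut_subset hsub hs hx)
      omega

end flats
end GramAngles

namespace GramAngles
variable {d : ℕ}

/-- zonotope with generators `V`, centred at `t` -/
def zono (V : Finset (Euc d)) (t : Euc d) : Set (Euc d) :=
  {x | ∃ l : Euc d → ℝ, (∀ v ∈ V, |l v| ≤ 1) ∧ x = t + ∑ v ∈ V, l v • v}

lemma mem_zono {V : Finset (Euc d)} {t x : Euc d} :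
    x ∈ zono V t ↔ ∃ l : Euc d → ℝ, (∀ v ∈ V, |l v| ≤ 1) ∧ x = t + ∑ v ∈ V, l v • v := Iff.rfl

lemma zono_polytope (V : Finset (Euc d)) (t : Euc d) : IsPolytope (zono V t) := by
  classical
  induction V using Finset.induction_on with
  | empty =>
    refine ⟨{t}, Finset.singleton_nonempty t, ?_⟩
    ext x
    simp [mem_zono]
    try exact fun _ => ⟨0, by simp⟩
  | insert v V hv ih =>
    obtain ⟨s, hs, he⟩ := ih
    refine ⟨s + {v, -v}, hs.add (Finset.insert_nonempty _ _), ?_⟩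
    rw [Finset.coe_add, convexHull_add, ← he]
    have h2 : ((({v, -v} : Finset (Euc d))) : Set (Euc d)) = {v, -v} := by simp
    rw [h2, convexHull_pair]
    ext x
    rw [Set.mem_add, mem_zono]
    constructor
    · rintro ⟨l, hl, rfl⟩
      refine ⟨t + ∑ u ∈ V, l u • u, ⟨l, fun u hu => hl u (Finset.mem_insert_of_mem hu), rfl⟩,
        l v • v, ?_, ?_⟩
      · have hlv := abs_le.mp (hl v (Finset.mem_insert_self _ _))
        refine ⟨(1 + l v) / 2, (1 - l v) / 2, by linarith, by linarith, by ring, ?_⟩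
        rw [smul_neg, ← sub_eq_add_neg, ← sub_smul]
        congr 1; ring
      · rw [Finset.sum_insert hv]; abel
    · rintro ⟨y, ⟨l, hl, rfl⟩, z, ⟨a, b, ha, hb, hab, rfl⟩, rfl⟩
      refine ⟨Function.update l v (a - b), ?_, ?_⟩
      · intro u hu
        by_cases huv : u = v
        · subst huv
          rw [Function.update_self, abs_le]
          constructor <;> linarith
        · rw [Function.update_of_ne huv]
          exact hl u (Finset.mem_of_mem_insert_of_ne hu huv)
      · rw [Finset.sum_insert hv, Function.update_self]
        have : ∑ u ∈ V, Function.update l v (a - b) u • u = ∑ u ∈ V, l u • u := by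
          apply Finset.sum_congr rfl
          intro u hu
          rw [Function.update_of_ne]
          rintro rfl; exact hv hu
        rw [this, sub_smul, smul_neg]; abel

lemma zono_span (V : Finset (Euc d)) (t : Euc d) : vectorSpan ℝ (zono V t) = sp V := by
  classical
  apply le_antisymm
  · rw [vectorSpan_def, Submodule.span_le]
    rintro _ ⟨x, ⟨l, hl, rfl⟩, y, ⟨m, hm, rfl⟩, rfl⟩
    simp only [vsub_eq_sub, add_sub_add_left_eq_sub]
    exact Submodule.sub_mem _ (Submodule.sum_mem _ fun v hv => Submodule.smul_mem _ _ (mem_sp hv))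
      (Submodule.sum_mem _ fun v hv => Submodule.smul_mem _ _ (mem_sp hv))
  · unfold sp
    rw [Submodule.span_le]
    intro v hv
    have h1 : t + v ∈ zono V t := by
      refine ⟨fun u => if u = v then 1 else 0, ?_, ?_⟩
      · intro u _
        dsimp only
        split_ifs <;> simp
      · rw [Finset.sum_eq_single v]
        · simp
        · intro u _ hu; simp [hu]
        · intro h; exact absurd (Finset.mem_coe.mp hv) h
    have h2 : t ∈ zono V t := ⟨0, by simp, by simp⟩
    have := vsub_mem_vectorSpan ℝ h1 h2
    simpa using this

open Classical in
lemma zono_maxFace (V : Finset (Euc d)) (t c : Euc d) :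
    ∃ t', maxFace (zono V t) c = zono (V.filter (fun v => ⟪c, v⟫_ℝ = 0)) t' := by
  let s : Euc d → ℝ := fun v => if 0 ≤ ⟪c, v⟫_ℝ then 1 else -1
  have hs : ∀ v, s v * ⟪c, v⟫_ℝ = |⟪c, v⟫_ℝ| := by
    intro v
    simp only [s]
    split_ifs with h
    · rw [one_mul, abs_of_nonneg h]
    · rw [abs_of_neg (not_le.mp h)]; ring
  have hs1 : ∀ v, |s v| ≤ 1 := by
    intro v
    simp only [s]
    split_ifs <;> simp
  have hin : ∀ l : Euc d → ℝ, ⟪c, t + ∑ v ∈ V, l v • v⟫_ℝ = ⟪c, t⟫_ℝ + ∑ v ∈ V, l v * ⟪c, v⟫_ℝ := by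
    intro l
    rw [inner_add_right, inner_sum]
    simp only [inner_smul_right]
  have hle : ∀ l : Euc d → ℝ, (∀ v ∈ V, |l v| ≤ 1) → ∀ v ∈ V, l v * ⟪c, v⟫_ℝ ≤ |⟪c, v⟫_ℝ| := by
    intro l hl v hv
    calc l v * ⟪c, v⟫_ℝ ≤ |l v * ⟪c, v⟫_ℝ| := le_abs_self _
      _ = |l v| * |⟪c, v⟫_ℝ| := abs_mul _ _
      _ ≤ 1 * |⟪c, v⟫_ℝ| := mul_le_mul_of_nonneg_right (hl v hv) (abs_nonneg _)
      _ = _ := one_mul _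
  refine ⟨t + ∑ v ∈ V.filter (fun v => ¬ ⟪c, v⟫_ℝ = 0), s v • v, ?_⟩
  ext x
  constructor
  · rintro ⟨⟨l, hl, rfl⟩, hmax⟩
    have h1 := hmax (t + ∑ v ∈ V, s v • v) ⟨s, fun v _ => hs1 v, rfl⟩
    rw [hin, hin] at h1
    simp only [hs] at h1
    have h2 : ∑ v ∈ V, l v * ⟪c, v⟫_ℝ = ∑ v ∈ V, |⟪c, v⟫_ℝ| :=
      le_antisymm (Finset.sum_le_sum (hle l hl)) (by linarith)
    have h3 := (Finset.sum_eq_sum_iff_of_le (hle l hl)).mp h2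
    refine ⟨l, fun v hv => hl v (Finset.mem_filter.mp hv).1, ?_⟩
    rw [← Finset.sum_filter_add_sum_filter_not V (fun v => ⟪c, v⟫_ℝ = 0)]
    have : ∑ v ∈ V.filter (fun v => ¬ ⟪c, v⟫_ℝ = 0), l v • v =
        ∑ v ∈ V.filter (fun v => ¬ ⟪c, v⟫_ℝ = 0), s v • v := by
      apply Finset.sum_congr rfl
      intro v hv
      obtain ⟨hv1, hv2⟩ := Finset.mem_filter.mp hv
      have := h3 v hv1
      rw [← hs] at this
      rw [mul_right_cancel₀ hv2 this]
    rw [this]; abel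
  · rintro ⟨l, hl, rfl⟩
    let m : Euc d → ℝ := fun v => if ⟪c, v⟫_ℝ = 0 then l v else s v
    have hm : ∀ v ∈ V, |m v| ≤ 1 := by
      intro v hv
      simp only [m]
      split_ifs with h
      · exact hl v (Finset.mem_filter.mpr ⟨hv, h⟩)
      · exact hs1 v
    have he : t + ∑ v ∈ V.filter (fun v => ¬ ⟪c, v⟫_ℝ = 0), s v • v +
        ∑ v ∈ V.filter (fun v => ⟪c, v⟫_ℝ = 0), l v • v = t + ∑ v ∈ V, m v • v := by
      rw [← Finset.sum_filter_add_sum_filter_not V (fun v => ⟪c, v⟫_ℝ = 0) (fun v => m v • v)]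
      have e1 : ∑ v ∈ V.filter (fun v => ¬ ⟪c, v⟫_ℝ = 0), m v • v =
          ∑ v ∈ V.filter (fun v => ¬ ⟪c, v⟫_ℝ = 0), s v • v := by
        apply Finset.sum_congr rfl
        intro v hv
        simp only [m]; rw [if_neg (Finset.mem_filter.mp hv).2]
      have e2 : ∑ v ∈ V.filter (fun v => ⟪c, v⟫_ℝ = 0), m v • v =
          ∑ v ∈ V.filter (fun v => ⟪c, v⟫_ℝ = 0), l v • v := by
        apply Finset.sum_congr rfl
        intro v hv
        simp only [m]; rw [if_pos (Finset.mem_filter.mp hv).2]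
      rw [e1, e2]; abel
    rw [he]
    refine ⟨⟨m, hm, rfl⟩, ?_⟩
    rintro _ ⟨l', hl', rfl⟩
    rw [hin, hin]
    have : ∑ v ∈ V, m v * ⟪c, v⟫_ℝ = ∑ v ∈ V, |⟪c, v⟫_ℝ| := by
      apply Finset.sum_congr rfl
      intro v _
      simp only [m]
      split_ifs with h
      · rw [h]; simp
      · exact hs v
    rw [this]
    have := Finset.sum_le_sum (hle l' hl')
    linarith

open Classical in
lemma zono_maxFace_span (V : Finset (Euc d)) (t c : Euc d) :
    vectorSpan ℝ (maxFace (zono V t) c) = sp (V.filter (fun v => ⟪c, v⟫_ℝ = 0)) := by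
  obtain ⟨t', h⟩ := zono_maxFace V t c
  rw [h, zono_span]

lemma inner_sp_zero {U : Finset (Euc d)} {c x : Euc d} (h : ∀ u ∈ U, ⟪c, u⟫_ℝ = 0) (hx : x ∈ sp U) :
    ⟪c, x⟫_ℝ = 0 := by
  have : sp U ≤ LinearMap.ker (innerSL ℝ c).toLinearMap := by
    unfold sp
    rw [Submodule.span_le]
    intro u hu
    simpa using h u (Finset.mem_coe.mp hu)
  simpa using this hx

open Classical in
lemma Fl_filter {V : Finset (Euc d)} {c : Euc d} {K : Submodule ℝ (Euc d)}
    (hK : K ≤ sp (V.filter (fun v => ⟪c, v⟫_ℝ = 0))) :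
    K ∈ Fl V ↔ K ∈ Fl (V.filter (fun v => ⟪c, v⟫_ℝ = 0)) := by
  rw [mem_Fl, mem_Fl]
  constructor
  · rintro ⟨U, hU, rfl⟩
    refine ⟨U, fun u hu => Finset.mem_filter.mpr ⟨hU hu, ?_⟩, rfl⟩
    exact inner_sp_zero (fun w hw => (Finset.mem_filter.mp hw).2) (hK (mem_sp hu))
  · rintro ⟨U, hU, rfl⟩
    exact ⟨U, hU.trans (Finset.filter_subset _ _), rfl⟩

/-- faces of zonotopes -/
lemma zono_face {V : Finset (Euc d)} {t : Euc d} {F : Set (Euc d)} (hF : F ∈ faces (zono V t)) :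
    ∃ V' t', F = zono V' t' ∧ sp V' ∈ Fl V ∧ ∀ S, Wh V' (sp V') S = Wh V (sp V') S := by
  classical
  obtain ⟨c, rfl⟩ := exists_maxFace_of_faces hF
  obtain ⟨t', h⟩ := zono_maxFace V t c
  refine ⟨_, t', h, mem_Fl.mpr ⟨_, Finset.filter_subset _ _, rfl⟩, ?_⟩
  intro S
  exact Wh_congr S (fun K hK => (Fl_filter hK).symm)

open Classical in
lemma zono_ext_sum (α : ConeAngle d) (V : Finset (Euc d)) (t : Euc d) {L : Submodule ℝ (Euc d)}
    (hL : L ∈ Fl V) :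
    ∑ F ∈ (fcs (zono V t)).filter (fun F => vectorSpan ℝ F = L), extAngle α F (zono V t) = 1 := by
  have hz : ∀ v, Lᗮ.starProjection v = 0 ↔ v ∈ L := by
    intro v
    rw [Submodule.starProjection_apply_eq_zero_iff, Submodule.orthogonal_orthogonal]
  have := ext_sum α (zono_polytope V t) L ((V.filter (fun v => v ∉ L)).image (fun v => Lᗮ.starProjection v))
    ?_ ?_
  · convert this
  · intro a ha
    obtain ⟨v, hv, rfl⟩ := Finset.mem_image.mp ha
    intro h
    exact (Finset.mem_filter.mp hv).2 ((hz v).mp h)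
  · intro c hc
    rw [zono_maxFace_span]
    have hf : ∀ v ∈ V, ⟪Lᗮ.starProjection c, v⟫_ℝ = 0 ↔ v ∈ L := by
      intro v hv
      rw [Submodule.inner_starProjection_left_eq_right]
      constructor
      · intro h
        by_contra hvL
        apply hc _ (Finset.mem_image_of_mem _ (Finset.mem_filter.mpr ⟨hv, hvL⟩))
        rw [real_inner_comm]; exact h
      · intro h
        rw [(hz v).mpr h, inner_zero_right]
    apply le_antisymm
    · unfold sp
      rw [Submodule.span_le]
      intro v hv
      obtain ⟨h1, h2⟩ := Finset.mem_filter.mp (Finset.mem_coe.mp hv)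
      exact (hf v h1).mp h2
    · obtain ⟨U, hU, rfl⟩ := mem_Fl.mp hL
      apply sp_mono
      intro u hu
      exact Finset.mem_filter.mpr ⟨hU hu, (hf u (hU hu)).mpr (mem_sp hu)⟩

theorem zono_extFlag (α : ConeAngle d) (S : Finset ℕ) : ∀ (V : Finset (Euc d)) (t : Euc d),
    extFlag α (zono V t) S = Wh V (sp V) S := by
  classical
  induction S using Finset.induction_on_max with
  | empty => intro V t; rw [extFlag_eq, flag_empty, Wh_empty]
  | insert m S hm ih =>
    intro V t
    rw [extFlag_eq, flag_insert _ (zono_polytope V t) hm, Wh_insert V _ hm]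
    rw [← Finset.sum_fiberwise_of_maps_to (g := fun F => vectorSpan ℝ F)
      (t := (Fl V).filter (fun L => L ≤ sp V ∧ Module.finrank ℝ L = m))]
    · apply Finset.sum_congr rfl
      intro L hL
      obtain ⟨hL1, hL2, hL3⟩ := Finset.mem_filter.mp hL
      rw [← one_mul (Wh V L S), ← zono_ext_sum α V t hL1, Finset.sum_mul]
      apply Finset.sum_congr
      · ext F
        simp only [Finset.mem_filter]
        constructor
        · rintro ⟨⟨h1, _⟩, h2⟩; exact ⟨h1, h2⟩
        · rintro ⟨h1, h2⟩; exact ⟨⟨h1, by rw [sdim, h2, hL3]⟩, h2⟩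
      · intro F hF
        obtain ⟨hF1, hF2⟩ := Finset.mem_filter.mp hF
        obtain ⟨V', t', rfl, h1, h2⟩ := zono_face ((mem_fcs (zono_polytope V t)).mp hF1)
        rw [← extFlag_eq, ih V' t', h2, ← hF2, zono_span]
    · intro F hF
      obtain ⟨hF1, hF2⟩ := Finset.mem_filter.mp hF
      obtain ⟨V', t', rfl, h1, h2⟩ := zono_face ((mem_fcs (zono_polytope V t)).mp hF1)
      simp only [zono_span]
      refine Finset.mem_filter.mpr ⟨h1, Fl_le h1, ?_⟩
      rw [sdim, zono_span] at hF2
      exact hF2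

theorem zono_gram (α : ConeAngle d) (V : Finset (Euc d)) (c : Euc d) {t : ℕ} {S : Finset ℕ}
    (h : ∀ s ∈ S, s < t) (ht : t < sdim (zono V c)) :
    ∑ F ∈ fcs (zono V c), (-1 : ℝ) ^ sdim F * intAngle α F (zono V c) * extFlag α F (insert t S) = 0 := by
  classical
  have hG := zono_polytope V c
  have e1 : ∀ F ∈ fcs (zono V c), (-1 : ℝ) ^ sdim F * intAngle α F (zono V c) * extFlag α F (insert t S)
      = ∑ L ∈ (Fl V).filter (fun L : Submodule ℝ (Euc d) => Module.finrank ℝ L = t), (if L ≤ vectorSpan ℝ F then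
        ((-1 : ℝ) ^ sdim F * intAngle α F (zono V c)) else 0) * Wh V L S := by
    intro F hF
    obtain ⟨V', t', rfl, h1, h2⟩ := zono_face ((mem_fcs hG).mp hF)
    rw [zono_extFlag, h2, Wh_insert _ _ h, Finset.mul_sum, zono_span]
    simp only [ite_mul, zero_mul]
    rw [← Finset.sum_filter, Finset.filter_filter]
    apply Finset.sum_congr _ (fun _ _ => rfl)
    ext L
    simp only [Finset.mem_filter]
    tauto
  rw [Finset.sum_congr rfl e1, Finset.sum_comm]
  apply Finset.sum_eq_zero
  intro L hL
  obtain ⟨hL1, hL2⟩ := Finset.mem_filter.mp hL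
  rw [← Finset.sum_mul, ← Finset.sum_filter]
  have hlt : L < vectorSpan ℝ (zono V c) := by
    rw [zono_span]
    refine lt_of_le_of_ne (Fl_le hL1) ?_
    rintro rfl
    rw [sdim, zono_span] at ht
    omega
  have := gram_L0 α hG L hlt ?_
  · rw [mul_eq_zero]; left
    convert this
  · intro x hx
    rw [zono_maxFace_span]
    obtain ⟨U, hU, rfl⟩ := mem_Fl.mp hL1
    apply sp_mono
    intro u hu
    refine Finset.mem_filter.mpr ⟨hU hu, ?_⟩
    exact Submodule.inner_left_of_mem_orthogonal (mem_sp hu) hx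

/-- zonotopes -/
def IsZ (G : Set (Euc d)) : Prop := ∃ V t, G = zono V t

/-- zonotopes of dimension `n` -/
abbrev ZT (d n : ℕ) : Type := {G : Set (Euc d) // IsZ G ∧ sdim G = n}

/-- interior flag functions -/
def iF (α : ConeAngle d) (n : ℕ) (S : Finset ℕ) : ZT d n → ℝ := fun G => intFlag α G.1 S
/-- exterior flag functions -/
def eF (α : ConeAngle d) (n : ℕ) (S : Finset ℕ) : ZT d n → ℝ := fun G => extFlag α G.1 S

/-- span of interior flag functions -/
def IS (α : ConeAngle d) (n : ℕ) : Submodule ℝ (ZT d n → ℝ) :=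
  Submodule.span ℝ (iF α n ''
    ((Finset.Icc 1 (n-1)).powerset : Set (Finset ℕ)))

lemma iF_mem (α : ConeAngle d) (n : ℕ) {S : Finset ℕ} (h : S ⊆ Finset.Icc 1 (n-1)) : iF α n S ∈ IS α n :=
  Submodule.subset_span ⟨S, Finset.mem_coe.mpr (Finset.mem_powerset.mpr h), rfl⟩

lemma IsZ.polytope {G : Set (Euc d)} (h : IsZ G) : IsPolytope G := by
  obtain ⟨V, t, rfl⟩ := h; exact zono_polytope V t

lemma IsZ.face {G F : Set (Euc d)} (h : IsZ G) (hF : F ∈ faces G) : IsZ F := by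
  obtain ⟨V, t, rfl⟩ := h
  obtain ⟨V', t', rfl, _⟩ := zono_face hF
  exact ⟨V', t', rfl⟩

open Classical in
/-- convolution with interior angles at faces of dimension `j` -/
def cvl (α : ConeAngle d) (j n : ℕ) : (ZT d j → ℝ) →ₗ[ℝ] (ZT d n → ℝ) where
  toFun f := fun G => ∑ F ∈ (fcs G.1).filter (fun F => sdim F = j),
    intAngle α F G.1 * (if h : IsZ F ∧ sdim F = j then f ⟨F, h⟩ else 0)
  map_add' f g := by
    funext G
    simp only [Pi.add_apply]
    rw [← Finset.sum_add_distrib]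
    apply Finset.sum_congr rfl
    intro F _
    split_ifs
    · ring
    · ring
  map_smul' a f := by
    funext G
    simp only [Pi.smul_apply, smul_eq_mul, RingHom.id_apply]
    rw [Finset.mul_sum]
    apply Finset.sum_congr rfl
    intro F _
    split_ifs
    · ring
    · ring

open Classical in
lemma cvl_apply (α : ConeAngle d) (j n : ℕ) (g : Set (Euc d) → ℝ) (G : ZT d n) :
    cvl α j n (fun F => g F.1) G = ∑ F ∈ (fcs G.1).filter (fun F => sdim F = j), intAngle α F G.1 * g F := by
  unfold cvl
  simp only [LinearMap.coe_mk, AddHom.coe_mk]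
  apply Finset.sum_congr rfl
  intro F hF
  obtain ⟨h1, h2⟩ := Finset.mem_filter.mp hF
  rw [dif_pos ⟨G.2.1.face ((mem_fcs G.2.1.polytope).mp h1), h2⟩]

lemma cvl_mem (α : ConeAngle d) {j n : ℕ} (hj : 1 ≤ j) (hjn : j < n) {f : ZT d j → ℝ} (hf : f ∈ IS α j) :
    cvl α j n f ∈ IS α n := by
  classical
  have : IS α j ≤ (IS α n).comap (cvl α j n) := by
    unfold IS
    rw [Submodule.span_le]
    rintro _ ⟨S, hS, rfl⟩
    rw [Finset.mem_coe, Finset.mem_powerset] at hS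
    have hlt : ∀ s ∈ S, s < j := fun s hs => by
      have := Finset.mem_Icc.mp (hS hs); omega
    have e : cvl α j n (iF α j S) = iF α n (insert j S) := by
      funext G
      unfold iF
      rw [cvl_apply α j n (fun F => intFlag α F S) G]
      rw [intFlag_eq, flag_insert _ G.2.1.polytope hlt]
      rfl
    show cvl α j n (iF α j S) ∈ IS α n
    rw [e]
    apply iF_mem
    intro x hx
    rcases Finset.mem_insert.mp hx with rfl | hx
    · exact Finset.mem_Icc.mpr ⟨hj, by omega⟩
    · have := Finset.mem_Icc.mp (hS hx)
      exact Finset.mem_Icc.mpr ⟨this.1, by omega⟩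
  exact this hf

theorem eF_mem (α : ConeAngle d) (n : ℕ) : ∀ {T : Finset ℕ} (_ : T ⊆ Finset.Icc 1 (n-1)),
    eF α n T ∈ IS α n := by
  classical
  induction n using Nat.strong_induction_on with
  | _ n ih =>
  intro T
  induction T using Finset.induction_on_max with
  | empty =>
    intro _
    have : eF α n ∅ = iF α n ∅ := by
      funext G
      simp only [eF, iF, extFlag_eq, intFlag_eq, flag_empty]
    rw [this]
    exact iF_mem α n (by simp)
  | insert t T ht _ =>
    intro hT
    have htI := Finset.mem_Icc.mp (hT (Finset.mem_insert_self t T))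
    have htn : t < n := by omega
    have key : eF α n (insert t T) = (-(-1 : ℝ) ^ n) • ∑ j ∈ Finset.range n, ((-1 : ℝ) ^ j) •
        cvl α j n (eF α j (insert t T)) := by
      funext G
      simp only [Pi.smul_apply, Finset.sum_apply, smul_eq_mul]
      have hp := G.2.1.polytope
      have h0 : ∑ F ∈ fcs G.1, (-1 : ℝ) ^ sdim F * intAngle α F G.1 * extFlag α F (insert t T) = 0 := by
        obtain ⟨_, ⟨V, c, rfl⟩, hn⟩ := G
        exact zono_gram α V c ht (by rw [hn]; exact htn)
      rw [← Finset.sum_fiberwise_of_maps_to (g := sdim) (t := Finset.range (n+1))] at h0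
      · rw [Finset.sum_range_succ] at h0
        have hself : (fcs G.1).filter (fun F => sdim F = n) = {G.1} := by
          ext F
          simp only [Finset.mem_filter, Finset.mem_singleton, mem_fcs hp]
          constructor
          · rintro ⟨h1, h2⟩
            exact face_eq_of_sdim h1 (le_refl _) (faces_subset h1) (by rw [h2, G.2.2])
          · intro h; rw [h]; exact ⟨self_mem_faces hp, G.2.2⟩
        rw [hself, Finset.sum_singleton, intAngle_self α hp, G.2.2, mul_one] at h0
        have hs : ∀ j ∈ Finset.range n, (-1 : ℝ) ^ j * cvl α j n (eF α j (insert t T)) G =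
            ∑ F ∈ (fcs G.1).filter (fun F => sdim F = j),
              (-1 : ℝ) ^ sdim F * intAngle α F G.1 * extFlag α F (insert t T) := by
          intro j _
          have hc := cvl_apply α j n (fun F => extFlag α F (insert t T)) G
          have he : eF α j (insert t T) = fun F : ZT d j => extFlag α F.1 (insert t T) := rfl
          rw [he, hc, Finset.mul_sum]
          apply Finset.sum_congr rfl
          intro F hF
          rw [(Finset.mem_filter.mp hF).2]; ring
        rw [Finset.sum_congr rfl hs]
        have hsq : (-1 : ℝ) ^ n * (-1 : ℝ) ^ n = 1 := by rw [← mul_pow]; simp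
        have : eF α n (insert t T) G = extFlag α G.1 (insert t T) := rfl
        rw [this]
        linear_combination ((-1 : ℝ) ^ n) * h0 - extFlag α G.1 (insert t T) * hsq
      · intro F hF
        have := sdim_mono (faces_subset ((mem_fcs hp).mp hF))
        rw [G.2.2] at this
        exact Finset.mem_range.mpr (by omega)
    rw [key]
    apply Submodule.smul_mem
    apply Submodule.sum_mem
    intro j hj
    apply Submodule.smul_mem
    have hjn := Finset.mem_range.mp hj
    rcases lt_trichotomy j t with hjt | hjt | hjt
    · have : eF α j (insert t T) = 0 := by
        funext G
        obtain ⟨G, ⟨V, c, rfl⟩, hn⟩ := G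
        show extFlag α (zono V c) (insert t T) = 0
        rw [zono_extFlag]
        rw [sdim, zono_span] at hn
        exact Wh_zero (Finset.mem_insert_self t T) (by omega)
      rw [this, map_zero]
      exact Submodule.zero_mem _
    · subst hjt
      have : eF α j (insert j T) = eF α j T := by
        funext G
        obtain ⟨G, ⟨V, c, rfl⟩, hn⟩ := G
        show extFlag α (zono V c) (insert j T) = extFlag α (zono V c) T
        rw [zono_extFlag, zono_extFlag]
        rw [sdim, zono_span] at hn
        exact Wh_top (sp_mem_Fl V) ht hn
      rw [this]
      apply cvl_mem α htI.1 hjn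
      apply ih j hjn
      intro x hx
      have h1 := Finset.mem_Icc.mp (hT (Finset.mem_insert_of_mem hx))
      have h2 := ht x hx
      exact Finset.mem_Icc.mpr ⟨h1.1, by omega⟩
    · apply cvl_mem α (by omega) hjn
      apply ih j hjn
      intro x hx
      have h1 := Finset.mem_Icc.mp (hT hx)
      have h2 : x ≤ t := by
        rcases Finset.mem_insert.mp hx with rfl | h
        · exact le_refl _
        · exact (ht x h).le
      exact Finset.mem_Icc.mpr ⟨h1.1, by omega⟩

end GramAngles

namespace GramAngles
variable {d : ℕ}

/-- transpose of the cut operator -/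
def push (m : ℕ) (c : Finset ℕ → ℝ) (T : Finset ℕ) : ℝ :=
  ∑ S ∈ (Finset.Icc 1 m).powerset, ∑ s ∈ S, if cut s S = T then c S else 0

lemma push_sum {m m' : ℕ} (hm : m - 1 ≤ m') (c w : Finset ℕ → ℝ) :
    ∑ S ∈ (Finset.Icc 1 m).powerset, c S * ∑ s ∈ S, w (cut s S) =
      ∑ T ∈ (Finset.Icc 1 m').powerset, push m c T * w T := by
  unfold push
  simp only [Finset.sum_mul]
  rw [Finset.sum_comm]
  apply Finset.sum_congr rfl
  intro S hS
  rw [Finset.sum_comm, Finset.mul_sum]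
  apply Finset.sum_congr rfl
  intro s hs
  rw [Finset.sum_eq_single (cut s S)]
  · rw [if_pos rfl]
  · intro T _ hT
    rw [if_neg (Ne.symm hT), zero_mul]
  · intro h
    exfalso
    apply h
    rw [Finset.mem_powerset] at hS ⊢
    exact (cut_subset hS hs).trans (Finset.Icc_subset_Icc le_rfl hm)

lemma push_zero {m : ℕ} {g : Finset ℕ → ℝ}
    (h : ∀ T ∈ (Finset.Icc 1 m).powerset, g T + push m g T = 0) :
    ∀ T ∈ (Finset.Icc 1 m).powerset, g T = 0 := by
  by_contra hc
  push Not at hc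
  obtain ⟨T0, hT0, hg0⟩ := hc
  obtain ⟨T, hT, hmax⟩ := Finset.exists_max_image
    ((Finset.Icc 1 m).powerset.filter (fun T => g T ≠ 0)) (fun T => ∑ x ∈ T, x)
    ⟨T0, Finset.mem_filter.mpr ⟨hT0, hg0⟩⟩
  obtain ⟨hT1, hT2⟩ := Finset.mem_filter.mp hT
  have h1 : push m g T = 0 := by
    unfold push
    apply Finset.sum_eq_zero
    intro S hS
    apply Finset.sum_eq_zero
    intro s hs
    split_ifs with hcut
    · by_contra hgS
      have h2 := hmax S (Finset.mem_filter.mpr ⟨hS, hgS⟩)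
      have h3 := cut_sum_lt (Finset.mem_powerset.mp hS) hs
      rw [hcut] at h3
      omega
    · rfl
  have := h T hT1
  rw [h1, add_zero] at this
  exact hT2 this

/-- the linear functional given by coefficients `c` -/
def fW (m : ℕ) (c : Finset ℕ → ℝ) (V : Finset (Euc d)) : ℝ :=
  ∑ S ∈ (Finset.Icc 1 m).powerset, c S * Wh V (sp V) S

open Classical in
lemma exists_generic (V : Finset (Euc d)) :
    ∃ v ∈ sp V, ∀ K ∈ Fl V, Module.finrank ℝ K < Module.finrank ℝ (sp V) → v ∉ K := by
  let s : Finset (Submodule ℝ (sp V)) :=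
    ((Fl V).filter (fun K : Submodule ℝ (Euc d) => Module.finrank ℝ K < Module.finrank ℝ (sp V))).image
      (fun K : Submodule ℝ (Euc d) => K.comap (sp V).subtype)
  have hs : ⊤ ∉ s := by
    intro h
    obtain ⟨K, hK, he⟩ := Finset.mem_image.mp h
    obtain ⟨_, h2⟩ := Finset.mem_filter.mp hK
    rw [Submodule.comap_subtype_eq_top] at he
    exact absurd (Submodule.finrank_mono he) (not_le.mpr h2)
  have := Subspace.biUnion_ne_univ_of_top_notMem hs
  obtain ⟨v, hv⟩ := (Set.ne_univ_iff_exists_notMem _).mp this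
  refine ⟨v.1, v.2, ?_⟩
  intro K hK hlt hvK
  apply hv
  simp only [Set.mem_iUnion]
  exact ⟨_, Finset.mem_image.mpr ⟨K, Finset.mem_filter.mpr ⟨hK, hlt⟩, rfl⟩, hvK⟩

open Classical in
lemma fW_generic {n : ℕ} (hn : 1 ≤ n) (c : Finset ℕ → ℝ) {V : Finset (Euc d)} (hV : Module.finrank ℝ (sp V) = n) :
    ∃ v, sp (insert v V) = sp V ∧ fW (n-1) c (insert v V) = fW (n-1) c V + fW (n-1-1) (push (n-1) c) V := by
  obtain ⟨v, hv, hg⟩ := exists_generic V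
  have hsp : sp (insert v V) = sp V := by
    rw [sp_insert, sup_eq_left, Submodule.span_le]
    simpa using hv
  refine ⟨v, hsp, ?_⟩
  unfold fW
  rw [← push_sum le_rfl c (fun T => Wh V (sp V) T), ← Finset.sum_add_distrib]
  apply Finset.sum_congr rfl
  intro S hS
  rw [← mul_add, hsp]
  congr 1
  apply Wh_ext S (k := n-1) _ hv le_rfl
  · intro K hK _ hk
    exact hg K hK (by omega)
  · intro K hK h _; exact h
  · intro s hs
    exact Finset.mem_Icc.mp (Finset.mem_powerset.mp hS hs)

open Classical in
lemma fW_coloop {m m' : ℕ} (hm : m - 1 ≤ m') (c : Finset ℕ → ℝ) {V : Finset (Euc d)} {v : Euc d} (hv : v ∉ sp V) :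
    fW m c (insert v V) = fW m c V + fW m' (push m c) V := by
  unfold fW
  rw [← push_sum hm c (fun T => Wh V (sp V) T), ← Finset.sum_add_distrib]
  apply Finset.sum_congr rfl
  intro S hS
  rw [← mul_add]
  congr 1
  apply Wh_ext S (k := m) _ (mem_sp (Finset.mem_insert_self _ _)) (sp_mono (Finset.subset_insert _ _))
  · intro K hK _ _ hvK
    exact hv (Fl_le hK hvK)
  · intro K hK _ _; exact Fl_le hK
  · intro s hs
    exact Finset.mem_Icc.mp (Finset.mem_powerset.mp hS hs)

lemma exists_notMem {V : Finset (Euc d)} (h : Module.finrank ℝ (sp V) < d) : ∃ v, v ∉ sp V := by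
  by_contra hc
  push Not at hc
  have : sp V = ⊤ := by ext x; simp [hc x]
  rw [this, finrank_top, finrank_euclideanSpace_fin] at h
  omega

lemma fW_restrict {r m : ℕ} (hr : r ≤ m) (c : Finset ℕ → ℝ) {V : Finset (Euc d)}
    (hV : Module.finrank ℝ (sp V) = r) : fW m c V = fW r c V := by
  unfold fW
  symm
  apply Finset.sum_subset (Finset.powerset_mono.mpr (Finset.Icc_subset_Icc le_rfl hr))
  intro S hS hS'
  rw [Finset.mem_powerset] at hS hS'
  obtain ⟨x, hx, hx'⟩ := Finset.not_subset.mp hS'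
  have h1 := Finset.mem_Icc.mp (hS hx)
  rw [Finset.mem_Icc] at hx'
  rw [Wh_zero hx (by omega), mul_zero]

lemma fW_top {r : ℕ} (hr : 1 ≤ r) (c : Finset ℕ → ℝ) {V : Finset (Euc d)}
    (hV : Module.finrank ℝ (sp V) = r) :
    fW r c V = fW (r-1) (fun T => c T + c (insert r T)) V := by
  unfold fW
  have e : Finset.Icc 1 r = insert r (Finset.Icc 1 (r-1)) := by
    ext x; simp only [Finset.mem_insert, Finset.mem_Icc]; omega
  rw [e, Finset.sum_powerset_insert (by simp only [Finset.mem_Icc]; omega), ← Finset.sum_add_distrib]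
  apply Finset.sum_congr rfl
  intro S hS
  rw [Wh_top (sp_mem_Fl V) _ hV]
  · ring
  · intro s hs
    have := Finset.mem_Icc.mp (Finset.mem_powerset.mp hS hs)
    omega

theorem Wh_indep (n : ℕ) : ∀ (_ : n ≤ d) (c : Finset ℕ → ℝ)
    (_ : ∀ V : Finset (Euc d), Module.finrank ℝ (sp V) = n → fW (n-1) c V = 0),
    ∀ S ∈ (Finset.Icc 1 (n-1)).powerset, c S = 0 := by
  classical
  induction n using Nat.strong_induction_on with
  | _ n ih =>
  intro hnd c hc
  have hbot : Module.finrank ℝ (sp (∅ : Finset (Euc d))) = 0 := by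
    unfold sp; rw [Finset.coe_empty, Submodule.span_empty, finrank_bot]
  rcases Nat.eq_zero_or_pos n with rfl | hn
  · have := hc ∅ hbot
    simp [fW, Wh_empty] at this
    intro S hS
    simp at hS
    rw [hS, this]
  -- step 1 and 2
  have hg : ∀ T ∈ (Finset.Icc 1 (n-1-1)).powerset, push (n-1) c T = 0 := by
    apply push_zero
    apply ih (n-1) (by omega) (by omega)
    intro V hV
    obtain ⟨v, hv⟩ := exists_notMem (V := V) (by omega)
    have hr : Module.finrank ℝ (sp (insert v V)) = n := by
      rw [sp_insert, finrank_sup_singleton hv, hV]; omega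
    obtain ⟨w, hw1, hw2⟩ := fW_generic hn c hr
    rw [hc _ hr, hc _ (by rw [hw1, hr]), zero_add] at hw2
    rw [fW_coloop (m' := n-1-1) (by omega) _ hv] at hw2
    rw [hw2]
    unfold fW
    rw [← Finset.sum_add_distrib]
    apply Finset.sum_congr rfl
    intro S _
    ring
  -- step 3
  have hall : ∀ j ≤ n, ∀ V : Finset (Euc d), Module.finrank ℝ (sp V) = n - j → fW (n-1) c V = 0 := by
    intro j
    induction j with
    | zero => intro _ V hV; exact hc V (by omega)
    | succ j ihj =>
      intro hj V hV
      obtain ⟨v, hv⟩ := exists_notMem (V := V) (by omega)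
      have hr : Module.finrank ℝ (sp (insert v V)) = n - j := by
        rw [sp_insert, finrank_sup_singleton hv, hV]; omega
      have h1 := ihj (by omega) _ hr
      rw [fW_coloop (m' := n-1-1) le_rfl _ hv] at h1
      have h2 : fW (n-1-1) (push (n-1) c) V = 0 := by
        unfold fW
        apply Finset.sum_eq_zero
        intro T hT
        rw [hg T hT, zero_mul]
      rw [h2, add_zero] at h1
      exact h1
  -- step 4
  have hstep : ∀ r, 1 ≤ r → r ≤ n - 1 → ∀ T ∈ (Finset.Icc 1 (r-1)).powerset, c T + c (insert r T) = 0 := by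
    intro r hr1 hr2
    apply ih r (by omega) (by omega) (fun T => c T + c (insert r T))
    intro V hV
    rw [← fW_top hr1 c hV, ← fW_restrict hr2 c hV]
    exact hall (n - r) (by omega) V (by omega)
  have h0 : c ∅ = 0 := by
    have := hall n le_rfl ∅ (by omega)
    rw [fW_restrict (Nat.zero_le _) c hbot] at this
    simpa [fW, Wh_empty] using this
  intro S
  induction S using Finset.induction_on_max with
  | empty => intro _; exact h0
  | insert t S ht ihS =>
    intro hS
    rw [Finset.mem_powerset] at hS
    have htI := Finset.mem_Icc.mp (hS (Finset.mem_insert_self t S))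
    have h1 := ihS (Finset.mem_powerset.mpr ((Finset.subset_insert _ _).trans hS))
    have h2 := hstep t htI.1 htI.2 S ?_
    · linarith
    · rw [Finset.mem_powerset]
      intro x hx
      have h3 := Finset.mem_Icc.mp (hS (Finset.mem_insert_of_mem hx))
      have h4 := ht x hx
      exact Finset.mem_Icc.mpr ⟨h3.1, by omega⟩

end GramAngles

namespace GramAngles
variable {d : ℕ}

/-- the index family `2^{1,…,d-1}` -/
abbrev PP (d : ℕ) : Finset (Finset ℕ) := (Finset.Icc 1 (d-1)).powerset

lemma dim_lemma (hd : 0 < d) (Y : Set (Finset ℕ → ℝ)) (h1 : ∀ y ∈ Y, y ∅ = 1)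
    (ha : ∀ S : Finset ℕ, S ⊆ Finset.range d → ∃ b : Finset ℕ → ℝ, ∀ y ∈ Y, y S = ∑ T ∈ PP d, b T * y T)
    (hb : ∀ c : Finset ℕ → ℝ, (∀ y ∈ Y, ∑ T ∈ PP d, c T * y T = 0) → ∀ T ∈ PP d, c T = 0) :
    Module.finrank ℝ (vectorSpan ℝ ((fun y : Finset ℕ → ℝ =>
      fun S : {S : Finset (Fin d) // S.Nonempty} => y (S.1.image Fin.val)) '' Y)) = 2 ^ (d-1) - 1 := by
  classical
  choose! b hb' using ha
  have hsub : ∀ S : Finset (Fin d), S.image Fin.val ⊆ Finset.range d := by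
    intro S x hx
    obtain ⟨i, _, rfl⟩ := Finset.mem_image.mp hx
    exact Finset.mem_range.mpr i.2
  let R : (Finset ℕ → ℝ) → (PP d → ℝ) := fun y T => y T.1
  let B : (PP d → ℝ) →ₗ[ℝ] ({S : Finset (Fin d) // S.Nonempty} → ℝ) :=
    { toFun := fun z S => ∑ T : PP d, b (S.1.image Fin.val) T.1 * z T
      map_add' := by
        intro z w; funext S
        simp only [Pi.add_apply, mul_add, Finset.sum_add_distrib]
      map_smul' := by
        intro a z; funext S
        simp only [Pi.smul_apply, smul_eq_mul, RingHom.id_apply, Finset.mul_sum]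
        apply Finset.sum_congr rfl; intro T _; ring }
  have hBapp : ∀ z S, B z S = ∑ T : PP d, b (S.1.image Fin.val) T.1 * z T := fun _ _ => rfl
  have hconv : ∀ (c y : Finset ℕ → ℝ), ∑ T : PP d, c T.1 * R y T = ∑ T ∈ PP d, c T * y T := by
    intro c y
    exact Finset.sum_coe_sort (PP d) (fun T => c T * y T)
  have hBR : ∀ y ∈ Y, B (R y) = fun S => y (S.1.image Fin.val) := by
    intro y hy
    funext S
    rw [hBapp, hconv, ← hb' _ (hsub _) y hy]
  have himg : ((fun y : Finset ℕ → ℝ =>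
      fun S : {S : Finset (Fin d) // S.Nonempty} => y (S.1.image Fin.val)) '' Y) = B '' (R '' Y) := by
    rw [Set.image_image]
    apply Set.image_congr
    intro y hy
    exact (hBR y hy).symm
  rw [himg, vectorSpan_image_lin]
  -- span is everything
  have hspan : Submodule.span ℝ (R '' Y) = ⊤ := by
    by_contra hne
    obtain ⟨f, hf0, hf⟩ := Submodule.exists_le_ker_of_lt_top _ (lt_top_iff_ne_top.mpr hne)
    apply hf0
    let c : Finset ℕ → ℝ := fun S => if h : S ∈ PP d then f (fun j => if (⟨S, h⟩ : PP d) = j then 1 else 0) else 0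
    have hc : ∀ T : PP d, c T.1 = f (fun j => if T = j then 1 else 0) := by
      intro T
      simp only [c]
      rw [dif_pos T.2]
    have hz := hb c ?_
    · ext T
      have := hz T.1 T.2
      rw [hc] at this
      rw [LinearMap.zero_comp, LinearMap.zero_apply, ← this]
      simp only [LinearMap.comp_apply]
      congr 1
      funext j
      rw [LinearMap.single_apply, Pi.single_apply]
      simp only [eq_comm]
    · intro y hy
      rw [← hconv]
      have : f (R y) = 0 := hf (Submodule.subset_span ⟨y, hy, rfl⟩)
      rw [LinearMap.pi_apply_eq_sum_univ] at this
      rw [← this]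
      apply Finset.sum_congr rfl
      intro T _
      rw [hc, smul_eq_mul, mul_comm]
  have hmem0 : ∅ ∈ PP d := Finset.empty_mem_powerset _
  let ev : (PP d → ℝ) →ₗ[ℝ] ℝ := LinearMap.proj ⟨∅, hmem0⟩
  have hev : ∀ z, ev z = z ⟨∅, hmem0⟩ := fun _ => rfl
  have hevR : ∀ y ∈ Y, ev (R y) = 1 := fun y hy => h1 y hy
  have hne : Y.Nonempty := by
    by_contra hY
    rw [Set.not_nonempty_iff_eq_empty] at hY
    have := hb (fun _ => 1) (by simp [hY]) ∅ hmem0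
    norm_num at this
  obtain ⟨y0, hy0⟩ := hne
  have hvs : vectorSpan ℝ (R '' Y) = LinearMap.ker ev := by
    apply le_antisymm
    · rw [vectorSpan_def, Submodule.span_le]
      rintro _ ⟨_, ⟨y, hy, rfl⟩, _, ⟨y', hy', rfl⟩, rfl⟩
      simp only [vsub_eq_sub, SetLike.mem_coe, LinearMap.mem_ker, map_sub]
      rw [hevR y hy, hevR y' hy', sub_self]
    · intro z hz
      have key : ∀ w ∈ Submodule.span ℝ (R '' Y), w - ev w • R y0 ∈ vectorSpan ℝ (R '' Y) := by
        intro w hw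
        induction hw using Submodule.span_induction with
        | mem x hx =>
          obtain ⟨y, hy, rfl⟩ := hx
          rw [hevR y hy, one_smul]
          exact vsub_mem_vectorSpan ℝ ⟨y, hy, rfl⟩ ⟨y0, hy0, rfl⟩
        | zero => simp
        | add x y _ _ hx hy =>
          have := Submodule.add_mem _ hx hy
          rw [map_add, add_smul]
          convert this using 1
          abel
        | smul a x _ hx =>
          have := Submodule.smul_mem _ a hx
          rw [map_smul, smul_assoc, ← smul_sub]
          exact this
      have := key z (by rw [hspan]; trivial)
      rw [LinearMap.mem_ker.mp hz, zero_smul, sub_zero] at this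
      exact this
  rw [hvs]
  have hinj : LinearMap.ker B ⊓ LinearMap.ker ev = ⊥ := by
    rw [Submodule.eq_bot_iff]
    rintro z ⟨hz1, hz2⟩
    funext T
    by_cases hT : T.1 = ∅
    · have := LinearMap.mem_ker.mp hz2
      rw [hev] at this
      have hT' : T = ⟨∅, hmem0⟩ := Subtype.ext hT
      rw [hT', this]; rfl
    · have hTd : ∀ x ∈ T.1, x < d := by
        intro x hx
        have := Finset.mem_Icc.mp (Finset.mem_powerset.mp T.2 hx)
        omega
      let S : Finset (Fin d) := Finset.univ.filter (fun i => i.val ∈ T.1)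
      have hS : S.image Fin.val = T.1 := by
        ext x
        simp only [S, Finset.mem_image, Finset.mem_filter, Finset.mem_univ, true_and]
        constructor
        · rintro ⟨i, hi, rfl⟩; exact hi
        · intro hx; exact ⟨⟨x, hTd x hx⟩, hx, rfl⟩
      have hSne : S.Nonempty := by
        rw [← Finset.image_nonempty (f := Fin.val), hS]
        exact Finset.nonempty_of_ne_empty hT
      have hagree : ∀ w ∈ Submodule.span ℝ (R '' Y), B w ⟨S, hSne⟩ = w T := by
        intro w hw
        induction hw using Submodule.span_induction with
        | mem x hx =>
          obtain ⟨y, hy, rfl⟩ := hx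
          rw [hBR y hy]
          simp only [hS, R]
        | zero => simp
        | add x y _ _ hx hy => rw [map_add, Pi.add_apply, Pi.add_apply, hx, hy]
        | smul a x _ hx => rw [map_smul, Pi.smul_apply, Pi.smul_apply, hx]
      have h3 := hagree z (by rw [hspan]; trivial)
      rw [LinearMap.mem_ker.mp hz1] at h3
      exact h3.symm
  have hf := finrank_map_of_mem B (LinearMap.ker ev)
  rw [hinj, finrank_bot, add_zero] at hf
  rw [hf]
  have hev0 : ev ≠ 0 := by
    intro h
    have := hevR y0 hy0
    rw [h] at this
    simp at this
  have h4 := Module.Dual.finrank_ker_add_one_of_ne_zero (f := ev) hev0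
  rw [Module.finrank_fintype_fun_eq_card, Fintype.card_coe, Finset.card_powerset, Nat.card_Icc] at h4
  have h5 : d - 1 + 1 - 1 = d - 1 := by omega
  rw [h5] at h4
  omega

/-- enough: relations for `insert 0 T` -/
lemma ha_of_zero (hd : 0 < d) (Y : Set (Finset ℕ → ℝ))
    (ha : ∀ S ∈ PP d, ∃ b : Finset ℕ → ℝ, ∀ y ∈ Y, y (insert 0 S) = ∑ T ∈ PP d, b T * y T)
    (S : Finset ℕ) (hS : S ⊆ Finset.range d) :
    ∃ b : Finset ℕ → ℝ, ∀ y ∈ Y, y S = ∑ T ∈ PP d, b T * y T := by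
  classical
  have hmem : S.erase 0 ∈ PP d := by
    rw [Finset.mem_powerset]
    intro x hx
    obtain ⟨h0, hx⟩ := Finset.mem_erase.mp hx
    have := Finset.mem_range.mp (hS hx)
    exact Finset.mem_Icc.mpr ⟨by omega, by omega⟩
  by_cases h0 : 0 ∈ S
  · obtain ⟨b, hb⟩ := ha _ hmem
    rw [Finset.insert_erase h0] at hb
    exact ⟨b, hb⟩
  · rw [Finset.erase_eq_of_notMem h0] at hmem
    refine ⟨fun T => if T = S then 1 else 0, ?_⟩
    intro y _
    simp only [ite_mul, one_mul, zero_mul]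
    rw [Finset.sum_ite_eq' (PP d) S, if_pos hmem]

/-- set of exterior flag vectors -/
def Yext (α : ConeAngle d) : Set (Finset ℕ → ℝ) := {y | ∃ P, IsPolytope P ∧ sdim P = d ∧ y = extFlag α P}
/-- set of interior flag vectors -/
def Yint (α : ConeAngle d) : Set (Finset ℕ → ℝ) := {y | ∃ P, IsPolytope P ∧ sdim P = d ∧ y = intFlag α P}

lemma ext_indep (α : ConeAngle d) (c : Finset ℕ → ℝ)
    (h : ∀ G : ZT d d, ∑ T ∈ PP d, c T * extFlag α G.1 T = 0) : ∀ T ∈ PP d, c T = 0 := by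
  apply Wh_indep d le_rfl c
  intro V hV
  have := h ⟨zono V 0, ⟨V, 0, rfl⟩, by rw [sdim, zono_span, hV]⟩
  simp only [zono_extFlag] at this
  exact this

lemma int_indep (α : ConeAngle d) (c : Finset ℕ → ℝ)
    (h : ∀ G : ZT d d, ∑ T ∈ PP d, c T * intFlag α G.1 T = 0) : ∀ T ∈ PP d, c T = 0 := by
  classical
  have hE : LinearIndependent ℝ (fun T : PP d => eF α d T.1) := by
    rw [Fintype.linearIndependent_iff]
    intro g hg T
    have := ext_indep α (fun S => if hS : S ∈ PP d then g ⟨S, hS⟩ else 0) ?_ T.1 T.2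
    · rw [dif_pos T.2] at this; exact this
    · intro G
      have h2 := congrFun hg G
      simp only [Finset.sum_apply, Pi.smul_apply, smul_eq_mul, Pi.zero_apply] at h2
      rw [← Finset.sum_coe_sort, ← h2]
      apply Finset.sum_congr rfl
      intro T _
      rw [dif_pos T.2]; rfl
  have hIS : IS α d = Submodule.span ℝ (Set.range (fun T : PP d => iF α d T.1)) := by
    unfold IS
    congr 1
    ext f
    constructor
    · rintro ⟨S, hS, rfl⟩; exact ⟨⟨S, hS⟩, rfl⟩
    · rintro ⟨S, rfl⟩; exact ⟨S.1, S.2, rfl⟩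
  have hI : LinearIndependent ℝ (fun T : PP d => iF α d T.1) := by
    rw [linearIndependent_iff_card_le_finrank_span, ← finrank_span_eq_card hE]
    unfold Set.finrank
    haveI : FiniteDimensional ℝ (Submodule.span ℝ (Set.range (fun T : PP d => iF α d T.1))) :=
      FiniteDimensional.span_of_finite ℝ (Set.finite_range _)
    apply Submodule.finrank_mono
    rw [Submodule.span_le, ← hIS]
    rintro _ ⟨T, rfl⟩
    exact eF_mem α d (Finset.mem_powerset.mp T.2)
  rw [Fintype.linearIndependent_iff] at hI
  intro T hT
  refine hI (fun T => c T.1) ?_ ⟨T, hT⟩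
  funext G
  simp only [Finset.sum_apply, Pi.smul_apply, smul_eq_mul, Pi.zero_apply]
  rw [← h G]
  exact Finset.sum_coe_sort (PP d) (fun T => c T * intFlag α G.1 T)

theorem ext_dim (hd : 0 < d) (α : ConeAngle d) :
    Module.finrank ℝ (affineSpan ℝ
      {v : {S : Finset (Fin d) // S.Nonempty} → ℝ | ∃ P : Set (Euc d),
        IsPolytope P ∧ sdim P = d ∧
        v = fun S => extFlag α P (S.1.image Fin.val)}).direction = 2 ^ (d - 1) - 1 := by
  classical
  have key := dim_lemma hd (Yext α) ?_ (ha_of_zero hd _ ?_) ?_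
  · rw [direction_affineSpan, ← key]
    suffices hset : {v : {S : Finset (Fin d) // S.Nonempty} → ℝ | ∃ P : Set (Euc d),
        IsPolytope P ∧ sdim P = d ∧ v = fun S => extFlag α P (S.1.image Fin.val)} =
        (fun y : Finset ℕ → ℝ => fun S : {S : Finset (Fin d) // S.Nonempty} =>
          y (S.1.image Fin.val)) '' Yext α by rw [hset]
    ext v
    constructor
    · rintro ⟨P, hP, hP', rfl⟩; exact ⟨_, ⟨P, hP, hP', rfl⟩, rfl⟩
    · rintro ⟨_, ⟨P, hP, hP', rfl⟩, rfl⟩; exact ⟨P, hP, hP', rfl⟩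
  · rintro _ ⟨P, hP, hP', rfl⟩; exact flag_empty _ _
  · intro S hS
    refine ⟨fun T => if T = S then 1 else 0, ?_⟩
    rintro _ ⟨P, hP, hP', rfl⟩
    simp only [ite_mul, one_mul, zero_mul]
    rw [Finset.sum_ite_eq' (PP d) S, if_pos hS]
    exact ext_rel α S hP (fun s hs => (Finset.mem_Icc.mp (Finset.mem_powerset.mp hS hs)).1)
  · intro c hc
    apply ext_indep α c
    intro G
    exact hc _ ⟨G.1, G.2.1.polytope, G.2.2, rfl⟩

theorem int_dim (hd : 0 < d) (α : ConeAngle d) :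
    Module.finrank ℝ (affineSpan ℝ
      {v : {S : Finset (Fin d) // S.Nonempty} → ℝ | ∃ P : Set (Euc d),
        IsPolytope P ∧ sdim P = d ∧
        v = fun S => intFlag α P (S.1.image Fin.val)}).direction = 2 ^ (d - 1) - 1 := by
  classical
  have key := dim_lemma hd (Yint α) ?_ (ha_of_zero hd _ ?_) ?_
  · rw [direction_affineSpan, ← key]
    suffices hset : {v : {S : Finset (Fin d) // S.Nonempty} → ℝ | ∃ P : Set (Euc d),
        IsPolytope P ∧ sdim P = d ∧ v = fun S => intFlag α P (S.1.image Fin.val)} =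
        (fun y : Finset ℕ → ℝ => fun S : {S : Finset (Fin d) // S.Nonempty} =>
          y (S.1.image Fin.val)) '' Yint α by rw [hset]
    ext v
    constructor
    · rintro ⟨P, hP, hP', rfl⟩; exact ⟨_, ⟨P, hP, hP', rfl⟩, rfl⟩
    · rintro ⟨_, ⟨P, hP, hP', rfl⟩, rfl⟩; exact ⟨P, hP, hP', rfl⟩
  · rintro _ ⟨P, hP, hP', rfl⟩; exact flag_empty _ _
  · intro S hS
    have hS' : ∀ s ∈ S, 1 ≤ s ∧ s < d := by
      intro s hs
      have := Finset.mem_Icc.mp (Finset.mem_powerset.mp hS hs)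
      exact ⟨this.1, by omega⟩
    obtain ⟨t, ht⟩ : ∃ t, t = (insert d S).min' (Finset.insert_nonempty _ _) := ⟨_, rfl⟩
    have ht1 : 1 ≤ t := by
      rw [ht]
      apply Finset.le_min'
      intro y hy
      rcases Finset.mem_insert.mp hy with rfl | hy
      · exact hd
      · exact (hS' y hy).1
    have htd : t ≤ d := by
      rw [ht]; exact Finset.min'_le _ _ (Finset.mem_insert_self _ _)
    refine ⟨fun T => (if T = S then (-1 : ℝ) ^ (t+1) else 0) -
      ∑ i ∈ Finset.range (t-1), if T = insert (i+1) S then (-1 : ℝ) ^ (i+1) else 0, ?_⟩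
    rintro _ ⟨P, hP, hP', rfl⟩
    have hrel := int_rel α S hP (by rw [hP']; exact hd) (by rw [hP']; exact hS') t (by simp only [hP']; exact ht)
    simp only [sub_mul, Finset.sum_sub_distrib, Finset.sum_mul, ite_mul, zero_mul]
    rw [Finset.sum_ite_eq' (PP d) S, if_pos hS, Finset.sum_comm]
    obtain ⟨m, rfl⟩ : ∃ m, t = m + 1 := ⟨t - 1, by omega⟩
    rw [Finset.sum_range_succ'] at hrel
    have e : ∀ i ∈ Finset.range (m+1-1), (∑ T ∈ PP d, if T = insert (i+1) S then
        (-1 : ℝ) ^ (i+1) * intFlag α P T else 0) = (-1 : ℝ) ^ (i+1) * intFlag α P (insert (i+1) S) := by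
      intro i hi
      have hi' := Finset.mem_range.mp hi
      rw [Finset.sum_ite_eq' (PP d) (insert (i+1) S), if_pos]
      rw [Finset.mem_powerset]
      intro x hx
      rcases Finset.mem_insert.mp hx with rfl | hx
      · exact Finset.mem_Icc.mpr ⟨by omega, by omega⟩
      · exact Finset.mem_powerset.mp hS hx
    rw [Finset.sum_congr rfl e]
    rw [Nat.add_sub_cancel]
    linear_combination hrel
  · intro c hc
    apply int_indep α c
    intro G
    exact hc _ ⟨G.1, G.2.1.polytope, G.2.2, rfl⟩

theorem statement17 (d : ℕ) (hd : 0 < d) (α : ConeAngle d) :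
    (∀ P : Set (Euc d), IsPolytope P → sdim P = d →
      ∀ S : Finset ℕ, (∀ s ∈ S, 1 ≤ s ∧ s ≤ d - 1) →
        extFlag α P S = extFlag α P (insert 0 S) ∧
        (∀ t : ℕ, t = (insert d S).min' (Finset.insert_nonempty _ _) →
          ∑ i ∈ Finset.range t, (-1 : ℝ) ^ i * intFlag α P (insert i S) =
            (-1) ^ (t + 1) * intFlag α P S)) ∧
    Module.finrank ℝ (affineSpan ℝ
      {v : {S : Finset (Fin d) // S.Nonempty} → ℝ | ∃ P : Set (Euc d),
        IsPolytope P ∧ sdim P = d ∧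
        v = fun S => extFlag α P (S.1.image Fin.val)}).direction = 2 ^ (d - 1) - 1 ∧
    Module.finrank ℝ (affineSpan ℝ
      {v : {S : Finset (Fin d) // S.Nonempty} → ℝ | ∃ P : Set (Euc d),
        IsPolytope P ∧ sdim P = d ∧
        v = fun S => intFlag α P (S.1.image Fin.val)}).direction = 2 ^ (d - 1) - 1 := by
  refine ⟨?_, ext_dim hd α, int_dim hd α⟩
  intro P hP hP' S hS
  refine ⟨(ext_rel α S hP (fun s hs => (hS s hs).1)).symm, ?_⟩
  intro t ht
  refine int_rel α S hP (by rw [hP']; exact hd) ?_ t (by simp only [hP']; exact ht)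
  intro s hs
  have := hS s hs
  rw [hP']
  exact ⟨this.1, by omega⟩

end GramAngles
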